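/- Fix an integer n ≥ 1. There exists a constant c = c(n) > 0 such that the following holds for all f, B, d. Let f ∈ ℤ[x_1,…,x_{n+1}] be a primitive polynomial of degree d ≥ 1, irreducible over ℚ, and for each i let f_i denote its degree-i homogeneous part. Let B ≥ 1 be a real number. Then there exists a polynomial g ∈ ℤ[x_1,…,x_{n+1}], not divisible by f, which vanishes at every point x ∈ ℤ^{n+1} satisfying f(x) = 0 and |x_i| ≤ B for all i, and whose degree is at most c·B^{1/d^{1/n}}·d^{2−1/n}·min(log‖f_d‖ + d·log B + d^2, d^2·b(f))/‖f_d‖^{1/(n·d^{1+1/n})} + c·d^{1−1/n}·log B + c·d^{4−1/n}. -/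

import Mathlib

/-- The maximum of the absolute values of the coefficients of `f`, as a real number. -/
noncomputable def normMax {σ : Type*} (f : MvPolynomial σ ℤ) : ℝ :=
  ((f.support.sup fun m => (f.coeff m).natAbs : ℕ) : ℝ)

open Classical in
/-- The badness `b(f)`: `0` if `f` is not absolutely irreducible, and otherwise the
product of `exp(log p / p)` over the primes `p > 27 d^4` (where `d = deg f`) modulo
which `f` is not irreducible over the algebraic closure of `F_p`. -/
noncomputable def badness {σ : Type*} (f : MvPolynomial σ ℤ) : ℝ :=
  if Irreducible (MvPolynomial.map (Int.castRingHom (AlgebraicClosure ℚ)) f) then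
    ∏ᶠ p ∈ {p : ℕ | ∃ hp : Nat.Prime p,
        27 * f.totalDegree ^ 4 < p ∧
        ¬ Irreducible (letI : Fact (Nat.Prime p) := ⟨hp⟩;
          MvPolynomial.map (Int.castRingHom (AlgebraicClosure (ZMod p))) f)},
      Real.exp (Real.log p / p)
  else 0

namespace EV

open Finset

/-- the primes up to `N` -/
def prs (N : ℕ) : Finset ℕ := (Finset.range (N + 1)).filter Nat.Prime

theorem mem_prs {N p : ℕ} : p ∈ prs N ↔ p ≤ N ∧ p.Prime := by
  simp [prs]

theorem log_factorial_eq (N : ℕ) :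
    Real.log (N.factorial : ℝ) = ∑ p ∈ prs N, ((N.factorial.factorization p : ℕ) : ℝ) * Real.log p := by
  have h1 : ∏ p ∈ prs N, p ^ (N.factorial.factorization p) = N.factorial := by
    conv_rhs => rw [← Nat.prod_factorization_pow_eq_self (Nat.factorial_ne_zero N)]
    rw [Finsupp.prod]
    symm
    apply Finset.prod_subset
    · intro p hp
      rw [Nat.support_factorization, Nat.mem_primeFactors] at hp
      rw [mem_prs]
      exact ⟨(hp.1.dvd_factorial).1 hp.2.1, hp.1⟩
    · intro p _ hp
      rw [Finsupp.notMem_support_iff] at hp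
      rw [hp, pow_zero]
  conv_lhs => rw [← h1]
  push_cast
  rw [Real.log_prod]
  · simp [Real.log_pow]
  · intro p hp
    have := (mem_prs.1 hp).2.pos
    positivity

theorem fact_val_lower {N p : ℕ} (hp : p.Prime) :
    (N : ℝ) / p - 1 ≤ (N.factorial.factorization p : ℝ) := by
  have h1 : N / p ≤ N.factorial.factorization p := by
    rw [Nat.factorization_factorial hp (b := Nat.log p N + 2) (by omega)]
    refine le_trans (le_of_eq (by rw [pow_one]))
      (Finset.single_le_sum (f := fun i => N / p ^ i) (fun _ _ => Nat.zero_le _)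
        (Finset.mem_Ico.2 ⟨le_refl 1, by omega⟩))
  have h2 : (N : ℝ) / p < (N / p : ℕ) + 1 := by
    rw [div_lt_iff₀ (by exact_mod_cast hp.pos)]
    have := Nat.lt_div_mul_add (a := N) hp.pos
    have h : N < (N / p + 1) * p := by rw [add_mul, one_mul]; exact this
    exact_mod_cast h
  have h3 : ((N / p : ℕ) : ℝ) ≤ (N.factorial.factorization p : ℝ) := by exact_mod_cast h1
  linarith

theorem fact_val_upper {N p : ℕ} (hp : p.Prime) :
    (N.factorial.factorization p : ℝ) ≤ (N : ℝ) / p + N / (p * (p - 1)) := by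
  have h1 := Nat.factorization_factorial_le_div_pred hp N
  have h2 : ((N / (p - 1) : ℕ) : ℝ) ≤ (N : ℝ) / (p - 1 : ℕ) := Nat.cast_div_le
  have h3 : ((p - 1 : ℕ) : ℝ) = (p : ℝ) - 1 := by
    rw [Nat.cast_sub hp.one_lt.le]; simp
  have h4 : (1 : ℝ) < p := by exact_mod_cast hp.one_lt
  have h5 : ((N.factorial.factorization p : ℕ) : ℝ) ≤ ((N / (p - 1) : ℕ) : ℝ) := by
    exact_mod_cast h1
  rw [h3] at h2
  have h6 : (N : ℝ) / p + N / (p * (p - 1)) = N / (p - 1) := by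
    have : (p : ℝ) - 1 ≠ 0 := by linarith
    have : (p : ℝ) ≠ 0 := by linarith
    field_simp
    ring
  rw [h6]
  linarith

/-- sum of `log p / p` over primes up to `N` -/
noncomputable def msum (N : ℕ) : ℝ := ∑ p ∈ prs N, Real.log p / p

theorem sum_log_prs_le (N : ℕ) : ∑ p ∈ prs N, Real.log p ≤ Real.log 4 * N := by
  have h := Chebyshev.theta_le_log4_mul_x (x := (N : ℝ)) (by positivity)
  rw [Chebyshev.theta_eq_sum_Icc] at h
  refine le_trans (le_of_eq ?_) h
  rw [Nat.floor_natCast]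
  apply Finset.sum_congr _ (fun _ _ => rfl)
  ext p
  simp [prs]

theorem msum_upper {N : ℕ} (hN : 1 ≤ N) : msum N ≤ Real.log N + Real.log 4 := by
  have hN0 : (0 : ℝ) < N := by exact_mod_cast hN
  have h1 : ∑ p ∈ prs N, ((N : ℝ) / p - 1) * Real.log p ≤ Real.log (N.factorial : ℝ) := by
    rw [log_factorial_eq]
    apply Finset.sum_le_sum
    intro p hp
    have hp' := (mem_prs.1 hp).2
    have : (1 : ℝ) ≤ p := by exact_mod_cast hp'.one_lt.le
    exact mul_le_mul_of_nonneg_right (fact_val_lower hp') (Real.log_nonneg this)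
  have h2 : Real.log (N.factorial : ℝ) ≤ N * Real.log N := by
    rw [← Real.log_pow]
    apply Real.log_le_log
    · exact_mod_cast Nat.factorial_pos N
    · exact_mod_cast Nat.factorial_le_pow N
  have h3 : ∑ p ∈ prs N, ((N : ℝ) / p - 1) * Real.log p
      = N * msum N - ∑ p ∈ prs N, Real.log p := by
    rw [msum, Finset.mul_sum, ← Finset.sum_sub_distrib]
    apply Finset.sum_congr rfl
    intro p _
    ring
  have h4 := sum_log_prs_le N
  have h5 : N * msum N ≤ N * (Real.log N + Real.log 4) := by
    rw [h3] at h1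
    linarith
  exact le_of_mul_le_mul_left h5 hN0

theorem exists_tail_bound : ∃ C : ℝ, 0 ≤ C ∧ ∀ N : ℕ,
    ∑ p ∈ prs N, Real.log p / (p * (p - 1)) ≤ C := by
  have hs : Summable (fun k : ℕ => 4 * (1 / (k : ℝ) ^ (3 / 2 : ℝ))) :=
    (Real.summable_one_div_nat_rpow.2 (by norm_num)).mul_left 4
  refine ⟨∑' k : ℕ, 4 * (1 / (k : ℝ) ^ (3 / 2 : ℝ)), tsum_nonneg (fun k => by positivity), ?_⟩
  intro N
  refine le_trans ?_ (hs.sum_le_tsum (prs N) (fun k _ => by positivity))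
  apply Finset.sum_le_sum
  intro p hp
  have hp' := (mem_prs.1 hp).2
  have h2 : (2 : ℝ) ≤ p := by exact_mod_cast hp'.two_le
  have h0 : (0 : ℝ) < p := by linarith
  have hl : Real.log p ≤ (p : ℝ) ^ (1 / 2 : ℝ) / (1 / 2) :=
    Real.log_le_rpow_div h0.le (by norm_num)
  have hq : (p : ℝ) ^ (2 : ℕ) = (p : ℝ) ^ (1 / 2 : ℝ) * (p : ℝ) ^ (3 / 2 : ℝ) := by
    rw [← Real.rpow_add h0, ← Real.rpow_natCast]
    norm_num
  have hpos : (0 : ℝ) < (p : ℝ) ^ (3 / 2 : ℝ) := Real.rpow_pos_of_pos h0 _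
  have hpos2 : (0 : ℝ) < (p : ℝ) ^ (1 / 2 : ℝ) := Real.rpow_pos_of_pos h0 _
  rw [← mul_div_assoc, mul_one, div_le_div_iff₀ (by nlinarith) hpos]
  calc Real.log p * (p : ℝ) ^ (3 / 2 : ℝ)
      ≤ ((p : ℝ) ^ (1 / 2 : ℝ) / (1 / 2)) * (p : ℝ) ^ (3 / 2 : ℝ) :=
        mul_le_mul_of_nonneg_right hl hpos.le
    _ = 2 * (p : ℝ) ^ (2 : ℕ) := by rw [hq]; ring
    _ ≤ 4 * (p * (p - 1)) := by nlinarith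

theorem msum_lower : ∃ C : ℝ, 0 ≤ C ∧ ∀ N : ℕ, 1 ≤ N → Real.log N - C ≤ msum N := by
  obtain ⟨C, hC0, hC⟩ := exists_tail_bound
  refine ⟨C + 1, by linarith, ?_⟩
  intro N hN
  have hN0 : (0 : ℝ) < N := by exact_mod_cast hN
  have h1 : Real.log (N.factorial : ℝ) ≤
      ∑ p ∈ prs N, ((N : ℝ) / p + N / (p * (p - 1))) * Real.log p := by
    rw [log_factorial_eq]
    apply Finset.sum_le_sum
    intro p hp
    have hp' := (mem_prs.1 hp).2
    have : (1 : ℝ) ≤ p := by exact_mod_cast hp'.one_lt.le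
    exact mul_le_mul_of_nonneg_right (fact_val_upper hp') (Real.log_nonneg this)
  have h2 : N * Real.log N - N ≤ Real.log (N.factorial : ℝ) := by
    have h := Stirling.le_log_factorial_stirling (n := N) (by omega)
    have h' : 0 ≤ Real.log N := Real.log_nonneg (by exact_mod_cast hN)
    have h'' : 0 ≤ Real.log (2 * Real.pi) :=
      Real.log_nonneg (by have := Real.pi_gt_three; linarith)
    linarith
  have h3 : ∑ p ∈ prs N, ((N : ℝ) / p + N / (p * (p - 1))) * Real.log p
      = N * (msum N + ∑ p ∈ prs N, Real.log p / (p * (p - 1))) := by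
    rw [msum, ← Finset.sum_add_distrib, Finset.mul_sum]
    apply Finset.sum_congr rfl
    intro p _
    ring
  have h4 := hC N
  have h5 : N * (Real.log N - 1) ≤ N * (msum N + ∑ p ∈ prs N, Real.log p / (p * (p - 1))) := by
    rw [h3] at h1
    linarith
  have := le_of_mul_le_mul_left h5 hN0
  linarith

/-- tail of the sum of `log p / p ^ (3/2)`. -/
theorem tail_three_half : ∃ C : ℝ, 0 ≤ C ∧ ∀ y N : ℕ, 1 ≤ y →
    ∑ p ∈ (prs N).filter (fun p => y < p), Real.log p / (p * Real.sqrt p) ≤ C / Real.sqrt y := by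
  obtain ⟨C, hC0, hC⟩ := msum_lower
  set D : ℝ := Real.log 2 + Real.log 4 + C with hD
  have hl2 : 0 ≤ Real.log 2 := Real.log_nonneg (by norm_num)
  have hl4 : 0 ≤ Real.log 4 := Real.log_nonneg (by norm_num)
  have hD0 : 0 ≤ D := by positivity
  have block : ∀ y : ℕ, 1 ≤ y →
      ∑ p ∈ (prs (2 * y)).filter (fun p => y < p), Real.log p / (p * Real.sqrt p)
        ≤ D / Real.sqrt y := by
    intro y hy
    have hy0 : (0 : ℝ) < y := by exact_mod_cast hy
    have hsub : prs y ⊆ prs (2 * y) := by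
      intro p hp
      rw [mem_prs] at hp ⊢
      exact ⟨by omega, hp.2⟩
    have e1 : ∑ p ∈ (prs (2 * y)).filter (fun p => y < p), Real.log p / p
        = msum (2 * y) - msum y := by
      have : (prs (2 * y)).filter (fun p => y < p) = prs (2 * y) \ prs y := by
        ext p
        simp only [Finset.mem_filter, Finset.mem_sdiff, mem_prs]
        constructor
        · rintro ⟨h1, h2⟩
          exact ⟨h1, fun h => by omega⟩
        · rintro ⟨h1, h2⟩
          refine ⟨h1, ?_⟩
          by_contra h
          exact h2 ⟨by omega, h1.2⟩
      rw [this, msum, msum, eq_sub_iff_add_eq, Finset.sum_sdiff hsub]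
    have e2 : msum (2 * y) - msum y ≤ D := by
      have a1 := msum_upper (N := 2 * y) (by omega)
      have a2 := hC y hy
      push_cast at a1
      rw [Real.log_mul (by norm_num) hy0.ne'] at a1
      linarith
    calc ∑ p ∈ (prs (2 * y)).filter (fun p => y < p), Real.log p / (p * Real.sqrt p)
        ≤ ∑ p ∈ (prs (2 * y)).filter (fun p => y < p), (Real.log p / p) * (1 / Real.sqrt y) := by
          apply Finset.sum_le_sum
          intro p hp
          rw [Finset.mem_filter, mem_prs] at hp
          have hp0 : (1 : ℝ) ≤ p := by exact_mod_cast hp.1.2.one_lt.le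
          have : Real.log p / (p * Real.sqrt p) = (Real.log p / p) * (1 / Real.sqrt p) := by
            rw [div_mul_div_comm, mul_one]
          rw [this]
          apply mul_le_mul_of_nonneg_left
          · apply one_div_le_one_div_of_le (Real.sqrt_pos.2 hy0)
            exact Real.sqrt_le_sqrt (by exact_mod_cast hp.2.le)
          · exact div_nonneg (Real.log_nonneg hp0) (by linarith)
      _ = (msum (2 * y) - msum y) * (1 / Real.sqrt y) := by rw [← Finset.sum_mul, e1]
      _ ≤ D * (1 / Real.sqrt y) := by
          apply mul_le_mul_of_nonneg_right e2
          positivity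
      _ = D / Real.sqrt y := by ring
  refine ⟨4 * D, by positivity, ?_⟩
  have key : ∀ k y N : ℕ, 1 ≤ y → N ≤ 2 ^ k * y →
      ∑ p ∈ (prs N).filter (fun p => y < p), Real.log p / (p * Real.sqrt p)
        ≤ 4 * D / Real.sqrt y := by
    intro k
    induction k with
    | zero =>
      intro y N hy hN
      have : (prs N).filter (fun p => y < p) = ∅ := by
        apply Finset.filter_eq_empty_iff.2
        intro p hp
        rw [mem_prs] at hp
        omega
      rw [this, Finset.sum_empty]
      positivity
    | succ k ih =>
      intro y N hy hN
      have hy0 : (0 : ℝ) < y := by exact_mod_cast hy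
      have h1 := ih (2 * y) N (by omega) (by rw [pow_succ] at hN; nlinarith)
      have h2 := block y hy
      have hsub : (prs N).filter (fun p => y < p) ⊆
          (prs (2 * y)).filter (fun p => y < p) ∪ (prs N).filter (fun p => 2 * y < p) := by
        intro p hp
        simp only [Finset.mem_filter, Finset.mem_union, mem_prs] at hp ⊢
        rcases le_or_gt p (2 * y) with h | h
        · left; exact ⟨⟨h, hp.1.2⟩, hp.2⟩
        · right; exact ⟨hp.1, h⟩
      have hnn : ∀ p ∈ (prs (2 * y)).filter (fun p => y < p) ∪ (prs N).filter (fun p => 2 * y < p),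
          0 ≤ Real.log p / (p * Real.sqrt p) := by
        intro p _
        exact div_nonneg (Real.log_natCast_nonneg p) (by positivity)
      have h3 : ∑ p ∈ (prs N).filter (fun p => y < p), Real.log p / (p * Real.sqrt p) ≤
          ∑ p ∈ (prs (2 * y)).filter (fun p => y < p), Real.log p / (p * Real.sqrt p) +
          ∑ p ∈ (prs N).filter (fun p => 2 * y < p), Real.log p / (p * Real.sqrt p) := by
        refine le_trans (Finset.sum_le_sum_of_subset_of_nonneg hsub (fun p hp _ => hnn p hp)) ?_
        rw [← Finset.sum_union_inter]
        have : 0 ≤ ∑ p ∈ (prs (2 * y)).filter (fun p => y < p) ∩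
            (prs N).filter (fun p => 2 * y < p), Real.log p / (p * Real.sqrt p) := by
          apply Finset.sum_nonneg
          intro p _
          exact div_nonneg (Real.log_natCast_nonneg p) (by positivity)
        linarith
      have h4 : 4 * D / Real.sqrt ((2 * y : ℕ) : ℝ) ≤ 3 * D / Real.sqrt y := by
        have s1 : Real.sqrt ((2 * y : ℕ) : ℝ) = Real.sqrt 2 * Real.sqrt y := by
          push_cast
          rw [Real.sqrt_mul (by norm_num)]
        have s2 : (4 : ℝ) / 3 ≤ Real.sqrt 2 := Real.le_sqrt_of_sq_le (by norm_num)
        have s3 : 0 < Real.sqrt y := Real.sqrt_pos.2 hy0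
        rw [s1, div_le_div_iff₀ (by positivity) s3]
        nlinarith [mul_nonneg hD0 s3.le]
      have h5 : 4 * D / Real.sqrt y = 3 * D / Real.sqrt y + D / Real.sqrt y := by ring
      linarith
  intro y N hy
  refine key N y N hy ?_
  have : N ≤ 2 ^ N := Nat.lt_two_pow_self.le
  nlinarith

end EV

namespace EV

theorem exists_minor {ι κ K : Type*} [Field K] [Fintype κ] [DecidableEq κ]
    (A : ι → κ → K) (hA : ∀ v : κ → K, (∀ i, ∑ k, A i k * v k = 0) → v = 0) :
    ∃ e : κ → ι, (Matrix.of (fun a b => A (e a) b)).det ≠ 0 := by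
  have hspan : Submodule.span K (Set.range A) = ⊤ := by
    by_contra hne
    obtain ⟨φ, hφ, hle⟩ := Submodule.exists_le_ker_of_lt_top _ (lt_top_iff_ne_top.2 hne)
    apply hφ
    have hv := hA (fun k => φ (Pi.single k 1)) (by
      intro i
      have h1 : A i ∈ LinearMap.ker φ := hle (Submodule.subset_span ⟨i, rfl⟩)
      rw [LinearMap.mem_ker] at h1
      rw [← h1]
      conv_rhs => rw [pi_eq_sum_univ' (A i)]
      rw [map_sum]
      apply Finset.sum_congr rfl
      intro k _
      rw [map_smul, smul_eq_mul])
    apply LinearMap.pi_ext'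
    intro k
    ext
    simpa using congrFun hv k
  obtain ⟨s, hs, hsp, hli⟩ := exists_linearIndependent K (Set.range A)
  have hb : ⊤ ≤ Submodule.span K (Set.range (Subtype.val : s → κ → K)) := by
    rw [Subtype.range_coe, hsp, hspan]
  let b := Module.Basis.mk hli hb
  let e0 : κ ≃ s := (Pi.basisFun K κ).indexEquiv b
  have hch : ∀ k : κ, ∃ i, A i = (e0 k : κ → K) := fun k => hs (e0 k).2
  choose e he using hch
  refine ⟨e, ?_⟩
  have hli2 : LinearIndependent K (fun k : κ => A (e k)) := by
    have : (fun k : κ => A (e k)) = (Subtype.val : s → κ → K) ∘ e0 := by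
      funext k
      exact he k
    rw [this]
    exact hli.comp _ e0.injective
  have hu := (Matrix.linearIndependent_rows_iff_isUnit (A := Matrix.of (fun a b => A (e a) b))).1 hli2
  exact ((Matrix.isUnit_iff_isUnit_det _).1 hu).ne_zero

end EV

namespace EV

open MvPolynomial

/-- coefficientwise application of an additive map -/
noncomputable def cmap {σ K L : Type*} [CommSemiring K] [CommSemiring L] (ψ : L → K)
    (u : MvPolynomial σ L) : MvPolynomial σ K :=
  ∑ m ∈ u.support, monomial m (ψ (u.coeff m))

theorem coeff_cmap {σ K L : Type*} [CommSemiring K] [CommSemiring L] (ψ : L → K) (h0 : ψ 0 = 0)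
    (u : MvPolynomial σ L) (m : σ →₀ ℕ) : (cmap ψ u).coeff m = ψ (u.coeff m) := by
  classical
  rw [cmap, coeff_sum]
  simp only [coeff_monomial]
  rw [Finset.sum_ite_eq']
  split_ifs with h
  · rfl
  · rw [notMem_support_iff.1 h, h0]

theorem support_cmap {σ K L : Type*} [CommSemiring K] [CommSemiring L] (ψ : L → K) (h0 : ψ 0 = 0)
    (u : MvPolynomial σ L) : (cmap ψ u).support ⊆ u.support := by
  intro m hm
  rw [mem_support_iff, coeff_cmap ψ h0] at hm
  rw [mem_support_iff]
  intro h
  exact hm (by rw [h, h0])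

theorem totalDegree_cmap {σ K L : Type*} [CommSemiring K] [CommSemiring L] (ψ : L → K)
    (h0 : ψ 0 = 0) (u : MvPolynomial σ L) : (cmap ψ u).totalDegree ≤ u.totalDegree :=
  Finset.sup_mono (support_cmap ψ h0 u)

theorem totalDegree_map_inj {σ K L : Type*} [CommSemiring K] [CommSemiring L] (φ : K →+* L)
    (hφ : Function.Injective φ) (u : MvPolynomial σ K) :
    (map φ u).totalDegree = u.totalDegree := by
  rw [totalDegree, totalDegree, support_map_of_injective _ hφ]

theorem eval_map_comp {σ K L : Type*} [CommSemiring K] [CommSemiring L] (φ : K →+* L)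
    (x : σ → K) (u : MvPolynomial σ K) : eval (fun i => φ (x i)) (map φ u) = φ (eval x u) := by
  rw [eval_map, eval₂_comp]
  rfl

theorem eval_cmap {σ K L : Type*} [Fintype σ] [Field K] [Field L] [Algebra K L] (ψ : L →ₗ[K] K)
    (u : MvPolynomial σ L) (x : σ → K) :
    eval x (cmap ψ u) = ψ (eval (fun i => algebraMap K L (x i)) u) := by
  rw [cmap, map_sum, eval_eq' _ u, map_sum]
  apply Finset.sum_congr rfl
  intro m _
  rw [eval_monomial]
  have : u.coeff m * ∏ i, (algebraMap K L (x i)) ^ (m i) = (∏ i, x i ^ m i) • u.coeff m := by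
    rw [Algebra.smul_def, map_prod, mul_comm]
    simp
  rw [this, map_smul, smul_eq_mul, mul_comm]
  congr 1
  simp [Finsupp.prod_fintype]

theorem clear_denoms {σ : Type*} (P : MvPolynomial σ ℚ) :
    ∃ D : ℤ, D ≠ 0 ∧ ∃ Q : MvPolynomial σ ℤ, map (Int.castRingHom ℚ) Q = C (D : ℚ) * P := by
  obtain ⟨b, hb⟩ := IsLocalization.exist_integer_multiples (nonZeroDivisors ℤ) P.support P.coeff
  refine ⟨b, nonZeroDivisors.coe_ne_zero b, ?_⟩
  refine ⟨cmap (fun q : ℚ => ((b : ℤ) * q).num) P, ?_⟩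
  ext m
  rw [coeff_map, coeff_cmap _ (by simp), coeff_C_mul]
  by_cases hm : m ∈ P.support
  · obtain ⟨z, hz⟩ := hb m hm
    have : ((b : ℤ) : ℚ) * P.coeff m = z := by
      rw [← zsmul_eq_mul]; exact hz.symm
    simp [this]
  · rw [notMem_support_iff.1 hm]; simp

theorem nonabs_case {σ : Type*} [Fintype σ] (f : MvPolynomial σ ℤ)
    (hirr : Irreducible (map (Int.castRingHom ℚ) f))
    (hna : ¬ Irreducible (map (Int.castRingHom (AlgebraicClosure ℚ)) f)) :
    ∃ g : MvPolynomial σ ℤ, ¬ f ∣ g ∧ (∀ x : σ → ℤ, eval x f = 0 → eval x g = 0) ∧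
      g.totalDegree ≤ f.totalDegree := by
  set L := AlgebraicClosure ℚ
  set F := map (Int.castRingHom ℚ) f with hF
  set FL := map (Int.castRingHom L) f with hFL
  have inj1 : Function.Injective (Int.castRingHom ℚ) := Int.cast_injective
  have inj2 : Function.Injective (Int.castRingHom L) := Int.cast_injective
  have dF : F.totalDegree = f.totalDegree := totalDegree_map_inj _ inj1 f
  have dFL : FL.totalDegree = f.totalDegree := totalDegree_map_inj _ inj2 f
  have hF0 : F ≠ 0 := hirr.ne_zero
  have hf0 : f ≠ 0 := by
    rintro rfl; exact hF0 (by simp [hF])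
  have hFL0 : FL ≠ 0 := by
    intro h
    exact hf0 (map_injective _ inj2 (by rw [← hFL, h, map_zero]))
  have hfd : f.totalDegree ≠ 0 := by
    intro h
    rw [← dF] at h
    exact hirr.not_isUnit (isUnit_iff_totalDegree_of_isReduced.2 ⟨by
      rw [totalDegree_eq_zero_iff_eq_C] at h
      rw [isUnit_iff_ne_zero]
      intro h'
      rw [h'] at h
      exact hF0 (by rw [h, C_0]), h⟩)
  have hnu : ∀ a : MvPolynomial σ L, a ≠ 0 → a.totalDegree = 0 → IsUnit a := by
    intro a ha h
    refine isUnit_iff_totalDegree_of_isReduced.2 ⟨?_, h⟩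
    rw [totalDegree_eq_zero_iff_eq_C] at h
    rw [isUnit_iff_ne_zero]
    intro h'
    rw [h'] at h
    exact ha (by rw [h, C_0])
  have hFLu : ¬ IsUnit FL := by
    intro h
    have := (isUnit_iff_totalDegree_of_isReduced.1 h).2
    exact hfd (by rw [← dFL, this])
  rw [irreducible_iff] at hna
  push Not at hna
  obtain ⟨u, w, huw, hu, hw⟩ := hna hFLu
  have hu0 : u ≠ 0 := by rintro rfl; exact hFL0 (by rw [huw, zero_mul])
  have hw0 : w ≠ 0 := by rintro rfl; exact hFL0 (by rw [huw, mul_zero])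
  have hud : u.totalDegree ≠ 0 := fun h => hu (hnu u hu0 h)
  have hwd : w.totalDegree ≠ 0 := fun h => hw (hnu w hw0 h)
  have hdeg : u.totalDegree + w.totalDegree = f.totalDegree := by
    rw [← dFL, huw, totalDegree_mul_of_isDomain hu0 hw0]
  -- functional
  have hfun : ∀ a : MvPolynomial σ L, a ≠ 0 → ∃ ψ : L →ₗ[ℚ] ℚ, cmap ψ a ≠ 0 := by
    intro a ha
    obtain ⟨m, hm⟩ := ne_zero_iff.1 ha
    obtain ⟨ψ, hψ⟩ : ∃ ψ : L →ₗ[ℚ] ℚ, ψ (a.coeff m) ≠ 0 := by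
      by_contra hcon
      push Not at hcon
      exact hm ((Module.forall_dual_apply_eq_zero_iff ℚ _).1 hcon)
    exact ⟨ψ, fun h => hψ (by rw [← coeff_cmap ψ (map_zero _), h, coeff_zero])⟩
  obtain ⟨ψ, hψ⟩ := hfun u hu0
  obtain ⟨ψ', hψ'⟩ := hfun w hw0
  set P := cmap ψ u * cmap ψ' w with hP
  have hPd : P.totalDegree ≤ f.totalDegree := by
    rw [← hdeg]
    exact (totalDegree_mul _ _).trans (add_le_add (totalDegree_cmap _ (map_zero _) _)
      (totalDegree_cmap _ (map_zero _) _))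
  have hFP : ¬ F ∣ P := by
    intro h
    have hdv : ∀ a : MvPolynomial σ ℚ, a ≠ 0 → a.totalDegree < f.totalDegree → ¬ F ∣ a := by
      rintro a ha had ⟨b, rfl⟩
      have hb : b ≠ 0 := by rintro rfl; exact ha (by rw [mul_zero])
      rw [totalDegree_mul_of_isDomain hF0 hb, dF] at had
      omega
    rcases hirr.prime.dvd_or_dvd h with h | h
    · exact hdv _ hψ (lt_of_le_of_lt (totalDegree_cmap _ (map_zero _) _) (by omega)) h
    · exact hdv _ hψ' (lt_of_le_of_lt (totalDegree_cmap _ (map_zero _) _) (by omega)) h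
  obtain ⟨D, hD, Q, hQ⟩ := clear_denoms P
  have hDu : IsUnit (C (D : ℚ) : MvPolynomial σ ℚ) :=
    (isUnit_iff_ne_zero.2 (by exact_mod_cast hD)).map C
  refine ⟨Q, ?_, ?_, ?_⟩
  · intro h
    apply hFP
    have h2 : F ∣ C (D : ℚ) * P := by rw [← hQ]; exact map_dvd _ h
    exact (hDu.dvd_mul_left).1 h2
  · intro x hx
    have hxQ : eval (fun i => (x i : ℚ)) (map (Int.castRingHom ℚ) Q) = ((eval x Q : ℤ) : ℚ) :=
      eval_map_comp (Int.castRingHom ℚ) x Q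
    have hxL : eval (fun i => (algebraMap ℚ L (x i : ℚ))) FL = 0 := by
      have h := eval_map_comp (Int.castRingHom L) x f
      rw [hx, map_zero] at h
      rw [← h]
      congr 2
    have : ((eval x Q : ℤ) : ℚ) = 0 := by
      rw [← hxQ, hQ, map_mul, hP, map_mul, eval_cmap, eval_cmap]
      rw [huw, map_mul, mul_eq_zero] at hxL
      rcases hxL with h | h
      · rw [h]; simp
      · rw [h]; simp
    exact_mod_cast this
  · rw [← totalDegree_map_inj _ inj1 Q, hQ]
    refine (totalDegree_mul _ _).trans ?_
    rw [totalDegree_C, zero_add]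
    exact hPd

end EV

namespace EV

open Polynomial

section TDsec
variable {K : Type*} [CommRing K]

/-- total degree at most `D` -/
def TD (D : ℕ) (P : K[X][X]) : Prop := ∀ i j, D < i + j → (P.coeff i).coeff j = 0

theorem TD.mono {D E : ℕ} {P : K[X][X]} (h : TD D P) (hDE : D ≤ E) : TD E P :=
  fun i j hij => h i j (lt_of_le_of_lt hDE hij)

theorem TD.zero (D : ℕ) : TD D (0 : K[X][X]) := fun i j _ => by simp

theorem TD.add {D : ℕ} {P Q : K[X][X]} (h : TD D P) (h' : TD D Q) : TD D (P + Q) :=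
  fun i j hij => by simp [h i j hij, h' i j hij]

theorem TD.neg {D : ℕ} {P : K[X][X]} (h : TD D P) : TD D (-P) :=
  fun i j hij => by simp [h i j hij]

theorem TD.sub {D : ℕ} {P Q : K[X][X]} (h : TD D P) (h' : TD D Q) : TD D (P - Q) :=
  fun i j hij => by simp [h i j hij, h' i j hij]

theorem TD.sum {D : ℕ} {ι : Type*} (s : Finset ι) {P : ι → K[X][X]} (h : ∀ i ∈ s, TD D (P i)) :
    TD D (∑ i ∈ s, P i) := fun i j hij => by
  rw [finsetSum_coeff, finsetSum_coeff]
  exact Finset.sum_eq_zero (fun a ha => h a ha i j hij)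

theorem TD.mul {D E : ℕ} {P Q : K[X][X]} (h : TD D P) (h' : TD E Q) : TD (D + E) (P * Q) := by
  intro i j hij
  rw [coeff_mul, finsetSum_coeff]
  apply Finset.sum_eq_zero
  rintro ⟨a, b⟩ hab
  rw [coeff_mul]
  apply Finset.sum_eq_zero
  rintro ⟨a', b'⟩ hab'
  rw [Finset.HasAntidiagonal.mem_antidiagonal] at hab hab'
  dsimp only at hab hab' ⊢
  rcases lt_or_ge D (a + a') with h1 | h1
  · simp [h a a' h1]
  · simp [h' b b' (by omega)]

theorem TD.C_C (c : K) : TD 0 (C (C c) : K[X][X]) := by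
  intro i j hij
  rw [coeff_C]
  split_ifs with h
  · rw [coeff_C, if_neg (by omega)]
  · simp

theorem TD.C_X : TD 1 (C X : K[X][X]) := by
  intro i j hij
  rw [coeff_C]
  split_ifs with h
  · rw [coeff_X, if_neg (by omega)]
  · simp

theorem TD.X' : TD 1 (X : K[X][X]) := by
  intro i j hij
  rw [coeff_X]
  split_ifs with h
  · rw [coeff_one, if_neg (by omega)]
  · simp

theorem TD.one : TD 0 (1 : K[X][X]) := by
  have := TD.C_C (1 : K)
  simpa using this

theorem TD.pow {D : ℕ} {P : K[X][X]} (h : TD D P) (k : ℕ) : TD (k * D) (P ^ k) := by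
  induction k with
  | zero => simpa using TD.one
  | succ k ih =>
    rw [pow_succ, Nat.succ_mul]
    exact ih.mul h

theorem TD.smul {D : ℕ} {P : K[X][X]} (h : TD D P) (c : K) : TD D (C (C c) * P) := by
  simpa using (TD.C_C c).mul h

theorem exists_TD (P : K[X][X]) : ∃ D, TD D P := by
  refine ⟨P.natDegree + P.support.sup (fun i => (P.coeff i).natDegree), fun i j hij => ?_⟩
  by_cases hi : i ∈ P.support
  · apply coeff_eq_zero_of_natDegree_lt
    have h1 := Finset.le_sup (f := fun i => (P.coeff i).natDegree) hi
    have h2 := le_natDegree_of_mem_supp i hi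
    omega
  · rw [notMem_support_iff.1 hi]; simp

theorem TD.monomial {D i j : ℕ} (c : K) (h : i + j ≤ D) :
    TD D (monomial i (monomial j c) : K[X][X]) := by
  intro a b hab
  rw [coeff_monomial]
  split_ifs with h1
  · rw [coeff_monomial, if_neg (by omega)]
  · simp

theorem TD.modByMonic {D δ : ℕ} {F : K[X][X]} (hF : F.Monic) (hδ : F.natDegree = δ)
    (hTF : TD δ F) {P : K[X][X]} (hP : TD D P) : TD D (P %ₘ F) := by
  rcases subsingleton_or_nontrivial K with hK | hK
  · intro i j _
    exact Subsingleton.elim _ _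
  suffices h : ∀ n : ℕ, ∀ P : K[X][X], P.natDegree < n → TD D P →
      ∃ q r : K[X][X], r + F * q = P ∧ r.degree < F.degree ∧ TD D r by
    obtain ⟨q, r, h1, h2, h3⟩ := h (P.natDegree + 1) P (Nat.lt_succ_self _) hP
    have := (div_modByMonic_unique q r hF ⟨h1, h2⟩).2
    rw [this]
    exact h3
  intro n
  induction n with
  | zero => intro P h; omega
  | succ n ih =>
    intro P hn hP
    by_cases hd : P.degree < F.degree
    · exact ⟨0, P, by simp, hd, hP⟩
    · push Not at hd
      have hP0 : P ≠ 0 := by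
        rintro rfl
        rw [degree_zero] at hd
        exact hF.ne_zero (degree_eq_bot.1 (le_bot_iff.1 hd))
      have hnd : δ ≤ P.natDegree := by rw [← hδ]; exact natDegree_le_natDegree hd
      set k := P.natDegree with hk
      set Q : K[X][X] := C P.leadingCoeff * X ^ (k - δ) with hQ
      have hlt : (P - Q * F).degree < P.degree := by
        have := div_wf_lemma ⟨hd, hP0⟩ hF
        rw [hQ, ← hδ, mul_comm]
        simpa [← hk] using this
      have hkD : k ≤ D := by
        by_contra hcon
        apply hP0
        rw [← leadingCoeff_eq_zero]
        ext j
        exact hP k j (by omega)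
      have hTQ : TD (D - δ) Q := by
        intro i j hij
        rw [hQ, coeff_C_mul, coeff_X_pow]
        split_ifs with h
        · rw [mul_one]
          exact hP k j (by omega)
        · simp
      have hT : TD D (P - Q * F) := by
        refine hP.sub ?_
        have := hTQ.mul hTF
        rwa [Nat.sub_add_cancel (by omega)] at this
      by_cases hz : P - Q * F = 0
      · refine ⟨Q, 0, ?_, ?_, TD.zero D⟩
        · rw [sub_eq_zero] at hz
          rw [zero_add, hz, mul_comm]
        · rw [degree_zero]; exact bot_lt_iff_ne_bot.2 (fun h => hF.ne_zero (degree_eq_bot.1 h))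
      · obtain ⟨q, r, h1, h2, h3⟩ := ih (P - Q * F) (by
          have := natDegree_lt_natDegree hz hlt
          omega) hT
        refine ⟨q + Q, r, ?_, h2, h3⟩
        linear_combination h1

/-- index set of normal forms -/
def idx (δ D : ℕ) : Finset (ℕ × ℕ) :=
  (Finset.range δ ×ˢ Finset.range (D + 1)).filter (fun x => x.1 + x.2 ≤ D)

theorem mem_idx {δ D : ℕ} {x : ℕ × ℕ} : x ∈ idx δ D ↔ x.1 < δ ∧ x.1 + x.2 ≤ D := by
  simp only [idx, Finset.mem_filter, Finset.mem_product, Finset.mem_range]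
  omega

theorem card_idx (δ D : ℕ) : (idx δ D).card = ∑ i ∈ Finset.range δ, (D + 1 - i) := by
  have h := Finset.card_eq_sum_card_fiberwise (s := idx δ D) (t := Finset.range δ)
    (f := Prod.fst) (by
      intro x hx
      simpa using (mem_idx.1 hx).1)
  rw [h]
  apply Finset.sum_congr rfl
  intro i hi
  rw [Finset.mem_range] at hi
  have : Finset.filter (fun x => x.1 = i) (idx δ D) =
      (Finset.range (D + 1 - i)).map ⟨fun j => (i, j), fun a b h => by simpa using h⟩ := by
    ext ⟨a, b⟩
    simp only [Finset.mem_filter, mem_idx, Finset.mem_map, Finset.mem_range]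
    constructor
    · rintro ⟨⟨h1, h2⟩, h3⟩
      subst h3
      exact ⟨b, by omega, rfl⟩
    · rintro ⟨j, hj, h3⟩
      have h4 : i = a := congrArg Prod.fst h3
      have h5 : j = b := congrArg Prod.snd h3
      subst h4 h5
      exact ⟨⟨hi, by omega⟩, rfl⟩
  rw [this, Finset.card_map, Finset.card_range]

theorem card_idx_sub (δ D e : ℕ) (h : δ ≤ D + 1) :
    (idx δ (D + e)).card = (idx δ D).card + δ * e := by
  rw [card_idx, card_idx]
  have : ∀ i ∈ Finset.range δ, (D + e + 1 - i) = (D + 1 - i) + e := by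
    intro i hi
    rw [Finset.mem_range] at hi
    omega
  rw [Finset.sum_congr rfl this, Finset.sum_add_distrib, Finset.sum_const, Finset.card_range,
    smul_eq_mul]

theorem card_idx_le (δ D : ℕ) : (idx δ D).card ≤ δ * (D + 1) := by
  rw [card_idx]
  calc ∑ i ∈ Finset.range δ, (D + 1 - i) ≤ ∑ i ∈ Finset.range δ, (D + 1) :=
        Finset.sum_le_sum (fun i _ => Nat.sub_le _ _)
    _ = δ * (D + 1) := by simp

theorem card_idx_ge (δ D : ℕ) : δ * (D + 1) ≤ (idx δ D).card + δ * δ := by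
  rw [card_idx]
  calc δ * (D + 1) = ∑ i ∈ Finset.range δ, (D + 1) := by simp
    _ ≤ ∑ i ∈ Finset.range δ, ((D + 1 - i) + δ) := by
        apply Finset.sum_le_sum
        intro i hi
        rw [Finset.mem_range] at hi
        omega
    _ = _ := by rw [Finset.sum_add_distrib]; simp

/-- the normal form with given coefficients -/
noncomputable def nf (δ D : ℕ) : (idx δ D → K) →ₗ[K] K[X][X] where
  toFun c := ∑ x : idx δ D, monomial x.1.1 (monomial x.1.2 (c x))
  map_add' a b := by simp [Finset.sum_add_distrib]
  map_smul' r a := by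
    rw [RingHom.id_apply, Finset.smul_sum]
    apply Finset.sum_congr rfl
    intro x _
    rw [smul_monomial, smul_monomial]
    rfl

theorem nf_apply (δ D : ℕ) (c : idx δ D → K) :
    nf δ D c = ∑ x : idx δ D, monomial x.1.1 (monomial x.1.2 (c x)) := rfl

theorem coeff_nf (δ D : ℕ) (c : idx δ D → K) (x : idx δ D) :
    ((nf δ D c).coeff x.1.1).coeff x.1.2 = c x := by
  classical
  rw [nf_apply, finsetSum_coeff, finsetSum_coeff, Finset.sum_eq_single x]
  · simp
  · intro y _ hy
    rw [coeff_monomial]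
    split_ifs with h1
    · rw [coeff_monomial]
      split_ifs with h2
      · exact absurd (Subtype.ext (Prod.ext h1 h2)) hy
      · rfl
    · simp
  · intro h; exact absurd (Finset.mem_univ _) h

theorem nf_injective (δ D : ℕ) : Function.Injective (nf (K := K) δ D) := by
  intro a b h
  funext x
  rw [← coeff_nf δ D a x, ← coeff_nf δ D b x, h]

theorem TD_nf (δ D : ℕ) (c : idx δ D → K) : TD D (nf δ D c) := by
  rw [nf_apply]
  exact TD.sum _ (fun x _ => TD.monomial _ (mem_idx.1 x.2).2)

theorem degree_nf (δ D : ℕ) (c : idx δ D → K) : (nf δ D c).degree < δ := by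
  rw [degree_lt_iff_coeff_zero]
  intro m hm
  rw [nf_apply, finsetSum_coeff]
  apply Finset.sum_eq_zero
  intro x _
  have := (mem_idx.1 x.2).1
  rw [coeff_monomial, if_neg (by omega)]

/-- the coordinates of a polynomial -/
noncomputable def co (δ D : ℕ) : K[X][X] →ₗ[K] (idx δ D → K) where
  toFun P x := (P.coeff x.1.1).coeff x.1.2
  map_add' a b := by funext x; simp
  map_smul' r a := by funext x; simp

theorem co_apply (δ D : ℕ) (P : K[X][X]) (x : idx δ D) :
    co δ D P x = (P.coeff x.1.1).coeff x.1.2 := rfl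

theorem nf_co {δ D : ℕ} {P : K[X][X]} (hd : P.degree < δ) (hT : TD D P) :
    nf δ D (co δ D P) = P := by
  ext i j
  by_cases h : (i, j) ∈ idx δ D
  · have := coeff_nf δ D (co δ D P) ⟨(i, j), h⟩
    exact this
  · rw [mem_idx] at h
    simp only [not_and_or, not_lt, not_le] at h
    rcases h with h | h
    · rw [(degree_lt_iff_coeff_zero _ _).1 hd i h,
        (degree_lt_iff_coeff_zero _ _).1 (degree_nf δ D _) i h]
    · rw [hT i j h, TD_nf δ D _ i j h]

end TDsec

end EV

namespace EV

open Polynomial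

theorem bezout {K : Type*} [Field K] {F : K[X][X]} {δ e : ℕ} (hF : F.Monic)
    (hδ : F.natDegree = δ) (hTF : TD δ F) (hirr : Irreducible F) {u : K[X][X]} (hu : TD e u)
    (hFu : ¬ F ∣ u) {W : Type*} [AddCommGroup W] [Module K W] [FiniteDimensional K W]
    (Φ : K[X][X] →ₗ[K] W) (hs : Function.Surjective Φ) (hΦF : ∀ a, Φ (F * a) = 0)
    (hΦu : ∀ a, Φ (u * a) = 0) : Module.finrank K W ≤ δ * e := by
  have hdF : F.degree = (δ : WithBot ℕ) := by rw [degree_eq_natDegree hF.ne_zero, hδ]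
  have hmod : ∀ a, Φ (a %ₘ F) = Φ a := by
    intro a
    conv_rhs => rw [← modByMonic_add_div a F]
    rw [map_add, hΦF, add_zero]
  let b := Module.finBasis K W
  choose a ha using fun k => hs (b k)
  choose Dk hDk using fun k => exists_TD (a k %ₘ F)
  set D := Finset.univ.sup Dk + δ with hD
  have hsurj : Function.Surjective (Φ ∘ₗ nf δ (D + e)) := by
    rw [← LinearMap.range_eq_top, eq_top_iff, ← b.span_eq, Submodule.span_le]
    rintro _ ⟨k, rfl⟩
    refine ⟨co δ (D + e) (a k %ₘ F), ?_⟩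
    rw [LinearMap.comp_apply, nf_co, hmod, ha]
    · rw [← hdF]; exact degree_modByMonic_lt _ hF
    · refine (hDk k).mono ?_
      have := Finset.le_sup (f := Dk) (Finset.mem_univ k)
      omega
  -- injection into the kernel
  let ψ : (idx δ D → K) →ₗ[K] (idx δ (D + e) → K) :=
    (co δ (D + e)) ∘ₗ ((modByMonicHom F).restrictScalars K) ∘ₗ
      (LinearMap.mulLeft K u) ∘ₗ (nf δ D)
  have hψ : ∀ c, nf δ (D + e) (ψ c) = (u * nf δ D c) %ₘ F := by
    intro c
    have : ψ c = co δ (D + e) ((u * nf δ D c) %ₘ F) := rfl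
    rw [this, nf_co]
    · rw [← hdF]; exact degree_modByMonic_lt _ hF
    · apply TD.modByMonic hF hδ hTF
      rw [add_comm]
      exact hu.mul (TD_nf δ D c)
  have hψker : ∀ c, ψ c ∈ LinearMap.ker (Φ ∘ₗ nf δ (D + e)) := by
    intro c
    rw [LinearMap.mem_ker, LinearMap.comp_apply, hψ, hmod, hΦu]
  have hψinj : Function.Injective ψ := by
    rw [← LinearMap.ker_eq_bot, LinearMap.ker_eq_bot']
    intro c hc
    have h1 := hψ c
    rw [hc, map_zero] at h1
    have h2 : F ∣ u * nf δ D c := (modByMonic_eq_zero_iff_dvd hF).1 h1.symm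
    have h3 : F ∣ nf δ D c := (hirr.prime.dvd_or_dvd h2).resolve_left hFu
    have h4 : nf δ D c = 0 := by
      apply eq_zero_of_dvd_of_degree_lt h3
      rw [hdF]
      exact degree_nf δ D c
    exact nf_injective δ D (by rw [h4, map_zero])
  have h1 : (idx δ D).card ≤ Module.finrank K (LinearMap.ker (Φ ∘ₗ nf δ (D + e))) := by
    have := LinearMap.finrank_le_finrank_of_injective (f := ψ.codRestrict _ hψker)
      (by
        intro x y hxy
        exact hψinj (congrArg Subtype.val hxy))
    rwa [Module.finrank_fintype_fun_eq_card, Fintype.card_coe] at this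
  have h2 := LinearMap.finrank_range_add_finrank_ker (Φ ∘ₗ nf δ (D + e))
  rw [LinearMap.range_eq_top.2 hsurj, finrank_top, Module.finrank_fintype_fun_eq_card,
    Fintype.card_coe, card_idx_sub _ _ _ (by omega)] at h2
  omega

/-- A jet of a curve at the point with `T = T0`, `X = x0`. -/
structure Jet (K : Type*) [Field K] (T0 x0 : K) where
  φ : K[X][X] →+* PowerSeries K
  hC : ∀ c, φ (C (C c)) = PowerSeries.C c
  hT : PowerSeries.constantCoeff (φ (C X)) = T0
  hX : PowerSeries.constantCoeff (φ X) = x0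

theorem Jet.const {K : Type*} [Field K] {T0 x0 : K} (J : Jet K T0 x0) (u : K[X][X]) :
    PowerSeries.constantCoeff (J.φ u) = evalEval T0 x0 u := by
  have : (PowerSeries.constantCoeff).comp J.φ = evalEvalRingHom T0 x0 := by
    ext
    · simp [J.hC]
    · simp [J.hT]
    · simp [J.hX]
  have h := RingHom.congr_fun this u
  simpa using h

theorem Jet.smul {K : Type*} [Field K] {T0 x0 : K} (J : Jet K T0 x0) (c : K) (u : K[X][X]) :
    J.φ (c • u) = c • J.φ u := by
  have : c • u = C (C c) * u := by
    rw [← smul_eq_C_mul, ← algebraMap_eq, algebraMap_smul]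
  rw [this, map_mul, J.hC, ← PowerSeries.smul_eq_C_mul]

theorem bezout_jets {K : Type*} [Field K] {F : K[X][X]} {δ e : ℕ} (hF : F.Monic)
    (hδ : F.natDegree = δ) (hTF : TD δ F) (hirr : Irreducible F) {u : K[X][X]} (hu : TD e u)
    (hFu : ¬ F ∣ u) {ι : Type*} [Fintype ι] (pt : ι → K × K) (hpt : Function.Injective pt)
    (J : ∀ i, Jet K (pt i).1 (pt i).2) (m : ℕ)
    (hsurj : ∀ i, ∀ w : PowerSeries K, ∃ a, PowerSeries.X ^ m ∣ (J i).φ a - w)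
    (hJF : ∀ i, PowerSeries.X ^ m ∣ (J i).φ F) (hJu : ∀ i, PowerSeries.X ^ m ∣ (J i).φ u) :
    Fintype.card ι * m ≤ δ * e := by
  classical
  let Φ : K[X][X] →ₗ[K] (ι → Fin m → K) :=
    { toFun := fun a i j => PowerSeries.coeff j ((J i).φ a)
      map_add' := fun a b => by funext i j; simp
      map_smul' := fun c a => by funext i j; simp [Jet.smul] }
  have hΦ : ∀ a i j, Φ a i j = PowerSeries.coeff j ((J i).φ a) := fun _ _ _ => rfl
  have hz : ∀ v : K[X][X], (∀ i, PowerSeries.X ^ m ∣ (J i).φ v) → ∀ a, Φ (v * a) = 0 := by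
    intro v hv a
    funext i j
    rw [hΦ, map_mul]
    exact (PowerSeries.X_pow_dvd_iff.1 ((hv i).mul_right _)) j j.2
  have hs : Function.Surjective Φ := by
    intro w
    let I : ι → Ideal K[X][X] := fun i =>
      Ideal.comap (J i).φ (Ideal.span {(PowerSeries.X : PowerSeries K) ^ m})
    have hI : ∀ i a, a ∈ I i ↔ PowerSeries.X ^ m ∣ (J i).φ a := by
      intro i a
      rw [Ideal.mem_comap, Ideal.mem_span_singleton]
    have hcop : Pairwise (Function.onFun IsCoprime I) := by
      intro i j hij
      have hne : pt i ≠ pt j := fun h => hij (hpt h)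
      obtain ⟨ℓ, h1, h2⟩ : ∃ ℓ : K[X][X], evalEval (pt i).1 (pt i).2 ℓ = 0 ∧
          evalEval (pt j).1 (pt j).2 ℓ = 1 := by
        by_cases h : (pt i).1 = (pt j).1
        · have h' : (pt j).2 - (pt i).2 ≠ 0 := by
            intro h'
            exact hne (Prod.ext h (sub_eq_zero.1 h').symm)
          refine ⟨C (C ((pt j).2 - (pt i).2)⁻¹) * (X - C (C (pt i).2)), ?_, ?_⟩
          · simp [evalEval]
          · simp [evalEval, h']
        · have h' : (pt j).1 - (pt i).1 ≠ 0 := by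
            intro h'
            exact h (sub_eq_zero.1 h').symm
          refine ⟨C (C ((pt j).1 - (pt i).1)⁻¹) * (C X - C (C (pt i).1)), ?_, ?_⟩
          · simp [evalEval]
          · simp [evalEval, h']
      have hXp : ∀ (k : ι) (a : K[X][X]), evalEval (pt k).1 (pt k).2 a = 0 → a ^ m ∈ I k := by
        intro k a h
        rw [hI, map_pow]
        apply pow_dvd_pow_of_dvd
        rw [PowerSeries.X_dvd_iff, Jet.const, h]
      have hc : IsCoprime (ℓ ^ m) ((1 - ℓ) ^ m) := by
        apply IsCoprime.pow
        exact ⟨1, 1, by ring⟩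
      obtain ⟨x, y, hxy⟩ := hc
      show IsCoprime (I i) (I j)
      rw [Ideal.isCoprime_iff_exists]
      refine ⟨x * ℓ ^ m, Ideal.mul_mem_left _ _ (hXp i ℓ h1), y * (1 - ℓ) ^ m,
        Ideal.mul_mem_left _ _ (hXp j _ ?_), hxy⟩
      have := map_sub (evalEvalRingHom (pt j).1 (pt j).2) 1 ℓ
      simp only [coe_evalEvalRingHom] at this
      rw [this, h2, ← coe_evalEvalRingHom, map_one, sub_self]
    choose a ha using fun i => hsurj i (PowerSeries.mk (fun k => if h : k < m then w i ⟨k, h⟩ else 0))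
    obtain ⟨r, hr⟩ := Ideal.pi_quotient_surjective hcop (fun i => Ideal.Quotient.mk _ (a i))
    refine ⟨r, ?_⟩
    funext i j
    rw [hΦ]
    have h1 : r - a i ∈ I i := by
      rw [← Ideal.Quotient.eq]
      exact hr i
    rw [hI, map_sub] at h1
    have h2 := dvd_add h1 (ha i)
    have h3 := PowerSeries.X_pow_dvd_iff.1 h2 j j.2
    simp only [sub_add_sub_cancel, map_sub, PowerSeries.coeff_mk] at h3
    rw [sub_eq_zero.1 h3]
    simp
  have := bezout hF hδ hTF hirr hu hFu Φ hs (hz F hJF) (hz u hJu)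
  rw [Module.finrank_pi_fintype] at this
  simpa using this

/-- evaluation jet -/
noncomputable def evalJet {K : Type*} [Field K] (T0 x0 : K) : Jet K T0 x0 where
  φ := (PowerSeries.C).comp (evalEvalRingHom T0 x0)
  hC := by intro c; simp
  hT := by simp
  hX := by simp

theorem bezout_points {K : Type*} [Field K] {F : K[X][X]} {δ e : ℕ} (hF : F.Monic)
    (hδ : F.natDegree = δ) (hTF : TD δ F) (hirr : Irreducible F) {u : K[X][X]} (hu : TD e u)
    (hFu : ¬ F ∣ u) (S : Finset (K × K)) (hSF : ∀ x ∈ S, evalEval x.1 x.2 F = 0)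
    (hSu : ∀ x ∈ S, evalEval x.1 x.2 u = 0) : S.card ≤ δ * e := by
  have h := bezout_jets hF hδ hTF hirr hu hFu (ι := S) (fun x => x.1) Subtype.val_injective
    (fun x => evalJet x.1.1 x.1.2) 1 ?_ ?_ ?_
  · simpa using h
  · intro i w
    refine ⟨C (C (PowerSeries.constantCoeff w)), ?_⟩
    rw [pow_one, PowerSeries.X_dvd_iff, map_sub, Jet.hC]
    simp
  · intro i
    rw [pow_one, PowerSeries.X_dvd_iff, Jet.const]
    exact hSF _ i.2
  · intro i
    rw [pow_one, PowerSeries.X_dvd_iff, Jet.const]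
    exact hSu _ i.2

end EV

namespace EV

open Polynomial

section
variable {K : Type*} [CommRing K]

/-- the derivation `∂/∂T` on `K[T][X]`, as a function -/
noncomputable def dTfun (P : K[X][X]) : K[X][X] :=
  ∑ i ∈ P.support, monomial i (derivative (P.coeff i))

theorem coeff_dTfun (P : K[X][X]) (i : ℕ) : (dTfun P).coeff i = derivative (P.coeff i) := by
  rw [dTfun, finsetSum_coeff]
  simp only [coeff_monomial]
  rw [Finset.sum_ite_eq']
  split_ifs with h
  · rfl
  · rw [notMem_support_iff.1 h, derivative_zero]

/-- the derivation `∂/∂T` on `K[T][X]` -/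
noncomputable def dT : Derivation K K[X][X] K[X][X] where
  toFun := dTfun
  map_add' a b := by ext1 i; simp [coeff_dTfun]
  map_smul' c a := by ext1 i; simp [coeff_dTfun]
  map_one_eq_zero' := by
    ext1 i
    show (dTfun 1).coeff i = _
    rw [coeff_dTfun, coeff_one]
    split_ifs <;> simp
  leibniz' a b := by
    ext1 i
    show (dTfun (a * b)).coeff i = _
    rw [coeff_dTfun]
    show _ = (a * dTfun b + b * dTfun a).coeff i
    rw [coeff_add, mul_comm b, coeff_mul, coeff_mul, coeff_mul, derivative_sum,
      ← Finset.sum_add_distrib]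
    apply Finset.sum_congr rfl
    intro x _
    rw [derivative_mul, coeff_dTfun, coeff_dTfun, add_comm]

theorem coeff_dT (P : K[X][X]) (i : ℕ) : (dT P).coeff i = derivative (P.coeff i) :=
  coeff_dTfun P i

theorem dT_C (a : K[X]) : dT (C a) = C (derivative a) := by
  ext1 i
  rw [coeff_dT, coeff_C, coeff_C]
  split_ifs <;> simp

theorem dT_X : dT (X : K[X][X]) = 0 := by
  ext1 i
  rw [coeff_dT, coeff_X]
  split_ifs <;> simp

theorem TD.dT {D : ℕ} {P : K[X][X]} (h : TD (D + 1) P) : TD D (dT P) := by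
  intro i j hij
  rw [coeff_dT, coeff_derivative, h i (j + 1) (by omega), zero_mul]

theorem TD.derivative {D : ℕ} {P : K[X][X]} (h : TD (D + 1) P) : TD D (derivative P) := by
  intro i j hij
  rw [coeff_derivative]
  have : ((i : K[X]) + 1) = C ((i : K) + 1) := by simp
  rw [this, coeff_mul_C, h (i + 1) j (by omega), zero_mul]

/-- the derivation along the curve `F = 0`. -/
noncomputable def Dv (F : K[X][X]) : Derivation K K[X][X] K[X][X] :=
  (derivative F) • dT - (dT F) • (derivative'.restrictScalars K)

theorem Dv_apply (F u : K[X][X]) :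
    Dv F u = derivative F * dT u - dT F * derivative u := rfl

theorem TD.Dv {D δ : ℕ} {F P : K[X][X]} (hF : TD (δ + 1) F) (h : TD D P) :
    TD (D + δ) (Dv F P) := by
  rw [Dv_apply]
  have h' : TD (D + 1) P := h.mono (by omega)
  have h1 := hF.derivative.mul h'.dT
  have h2 := hF.dT.mul h'.derivative
  rw [add_comm] at h1 h2
  exact h1.sub h2

theorem Dv_self (F : K[X][X]) : Dv F F = 0 := by
  rw [Dv_apply]; ring

theorem Dv_dvd {F u : K[X][X]} (h : F ∣ u) : F ∣ Dv F u := by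
  obtain ⟨w, rfl⟩ := h
  rw [Derivation.leibniz, Dv_self, smul_zero, add_zero, smul_eq_mul]
  exact dvd_mul_right _ _

end

section
variable {K : Type*} [Field K]

theorem exists_branch {F : K[X][X]} (hF : F.Monic) {T0 x0 : K} (h0 : evalEval T0 x0 F = 0)
    (h1 : evalEval T0 x0 (derivative F) ≠ 0) :
    ∃ J : Jet K T0 x0, J.φ (C X) = PowerSeries.C T0 + PowerSeries.X ∧ J.φ F = 0 := by
  let i : K[X] →+* PowerSeries K := eval₂RingHom PowerSeries.C (PowerSeries.C T0 + PowerSeries.X)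
  have hi : (PowerSeries.constantCoeff).comp i = evalRingHom T0 := by
    ext <;> simp [i]
  have key : ∀ u : K[X][X], ∀ a : PowerSeries K, PowerSeries.constantCoeff a = x0 →
      PowerSeries.constantCoeff (eval₂ i a u) = evalEval T0 x0 u := by
    intro u a ha
    rw [hom_eval₂, hi, ha, eval₂_evalRingHom]
  have hH : HenselianRing (PowerSeries K) (Ideal.span {PowerSeries.X}) := inferInstance
  obtain ⟨a, ha, ha0⟩ := hH.is_henselian (F.map i) (hF.map i) (PowerSeries.C x0) (by
      rw [Ideal.mem_span_singleton, PowerSeries.X_dvd_iff, eval_map, key _ _ (by simp), h0]) (by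
      rw [derivative_map, eval_map]
      apply IsUnit.map
      rw [PowerSeries.isUnit_iff_constantCoeff, key _ _ (by simp)]
      exact isUnit_iff_ne_zero.2 h1)
  have hax : PowerSeries.constantCoeff a = x0 := by
    rw [Ideal.mem_span_singleton, PowerSeries.X_dvd_iff, map_sub] at ha0
    simpa using sub_eq_zero.1 ha0
  refine ⟨⟨eval₂RingHom i a, ?_, ?_, ?_⟩, ?_, ?_⟩
  · intro c; simp [i]
  · simp [i]
  · simp [hax]
  · simp [i]
  · rw [IsRoot, eval_map] at ha
    simpa using ha

theorem branch_surj {T0 x0 : K} (J : Jet K T0 x0)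
    (hT : J.φ (C X) = PowerSeries.C T0 + PowerSeries.X) (m : ℕ) (w : PowerSeries K) :
    ∃ a, PowerSeries.X ^ m ∣ J.φ a - w := by
  have h1 : (J.φ.comp C).comp (compRingHom (X - C T0)) = coeToPowerSeries.ringHom := by
    ext1
    · ext1 c
      simp [J.hC]
    · simp [J.hC, hT]
  refine ⟨C ((w.trunc m).comp (X - C T0)), ?_⟩
  have h2 := RingHom.congr_fun h1 (w.trunc m)
  simp only [RingHom.comp_apply, coe_compRingHom_apply, coeToPowerSeries.ringHom_apply] at h2
  rw [h2, PowerSeries.X_pow_dvd_iff]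
  intro k hk
  rw [map_sub, coeff_coe, PowerSeries.coeff_trunc, if_pos hk, sub_self]

theorem branch_deriv' {T0 x0 : K} (J : Jet K T0 x0)
    (hT : J.φ (C X) = PowerSeries.C T0 + PowerSeries.X) (u : K[X][X]) :
    PowerSeries.derivative K (J.φ u) =
      J.φ (dT u) + J.φ (derivative u) * PowerSeries.derivative K (J.φ X) := by
  have hc : ∀ a : K[X], PowerSeries.derivative K (J.φ (C a)) = J.φ (C (derivative a)) := by
    intro a
    induction a using Polynomial.induction_on' with
    | add p q hp hq => simp only [map_add, hp, hq]
    | monomial k c =>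
      rw [← C_mul_X_pow_eq_monomial, derivative_C_mul_X_pow]
      simp only [map_mul, map_pow, J.hC, hT, map_natCast]
      rw [Derivation.leibniz, PowerSeries.derivative_C, PowerSeries.derivative_pow, map_add,
        PowerSeries.derivative_C, PowerSeries.derivative_X]
      simp
      ring
  induction u using Polynomial.induction_on' with
  | add p q hp hq => simp only [map_add, hp, hq]; ring
  | monomial k c =>
    rw [← C_mul_X_pow_eq_monomial]
    rw [Derivation.leibniz, derivative_C_mul_X_pow, dT_C, Derivation.leibniz_pow, dT_X]
    simp only [map_mul, map_pow, map_natCast, map_add, smul_eq_mul, map_zero, mul_zero, smul_zero]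
    rw [Derivation.leibniz, hc, PowerSeries.derivative_pow]
    simp
    ring

theorem branch_deriv {T0 x0 : K} (J : Jet K T0 x0)
    (hT : J.φ (C X) = PowerSeries.C T0 + PowerSeries.X) {F : K[X][X]} (hF : J.φ F = 0)
    (u : K[X][X]) :
    J.φ (derivative F) * PowerSeries.derivative K (J.φ u) = J.φ (Dv F u) := by
  have h1 := branch_deriv' J hT u
  have h2 := branch_deriv' J hT F
  rw [hF, map_zero] at h2
  rw [Dv_apply, map_sub, map_mul, map_mul, h1]
  linear_combination (-J.φ (derivative u)) * h2

end

end EV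

namespace EV

open Polynomial

theorem branch_order {K : Type*} [Field K] {T0 x0 : K} (J : Jet K T0 x0)
    (hT : J.φ (C X) = PowerSeries.C T0 + PowerSeries.X) {F : K[X][X]} (hF : J.φ F = 0)
    (h1 : evalEval T0 x0 (derivative F) ≠ 0) (m : ℕ) (hm : ∀ r : ℕ, 0 < r → r < m → (r : K) ≠ 0)
    (G : K[X][X]) (hG : ∀ j < m, evalEval T0 x0 ((Dv F)^[j] G) = 0) :
    PowerSeries.X ^ m ∣ J.φ G := by
  induction m generalizing G with
  | zero => simp
  | succ m ih =>
    have h2 := ih (fun r h h' => hm r h (by omega)) (Dv F G) (fun j hj => by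
      have := hG (j + 1) (by omega)
      rwa [Function.iterate_succ_apply] at this)
    rw [← branch_deriv J hT hF] at h2
    have hu : IsUnit (J.φ (derivative F)) := by
      rw [PowerSeries.isUnit_iff_constantCoeff, J.const]
      exact isUnit_iff_ne_zero.2 h1
    rw [hu.dvd_mul_left, PowerSeries.X_pow_dvd_iff] at h2
    rw [PowerSeries.X_pow_dvd_iff]
    intro k hk
    rcases k with _ | k
    · have := hG 0 (by omega)
      rw [PowerSeries.coeff_zero_eq_constantCoeff_apply, J.const]
      exact this
    · have h3 := h2 k (by omega)
      rw [PowerSeries.coeff_derivative] at h3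
      have h4 := hm (k + 1) (by omega) hk
      push_cast at h4
      exact (mul_eq_zero.1 h3).resolve_right h4

theorem not_dvd_derivative {K : Type*} [Field K] {F : K[X][X]} {δ : ℕ} (hF : F.Monic)
    (hδ : F.natDegree = δ) (hδ0 : (δ : K) ≠ 0) : ¬ F ∣ derivative F := by
  intro h
  have hδ1 : δ ≠ 0 := by rintro rfl; simp at hδ0
  have h1 : derivative F ≠ 0 := by
    intro h0
    have := congrArg (fun P => P.coeff (δ - 1)) h0
    simp only [coeff_derivative, coeff_zero] at this
    rw [Nat.sub_add_cancel (by omega)] at this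
    have h2 : F.coeff δ = 1 := by rw [← hδ]; exact hF
    rw [h2, one_mul] at this
    have h3 : ((δ - 1 : ℕ) : K[X]) + 1 = C (δ : K) := by
      have : ((δ - 1 : ℕ) : K[X]) + 1 = ((δ - 1 + 1 : ℕ) : K[X]) := by push_cast; rfl
      rw [this, Nat.sub_add_cancel (by omega)]; simp
    rw [h3] at this
    exact hδ0 (C_eq_zero.1 this)
  have h2 := natDegree_le_of_dvd h h1
  have h3 := natDegree_derivative_lt (p := F) (by omega)
  omega

theorem exists_smooth_points {L : Type*} [Field L] [IsAlgClosed L] {F : L[X][X]} {δ : ℕ}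
    (hF : F.Monic) (hδ : F.natDegree = δ) (hTF : TD δ F) (hirr : Irreducible F)
    (hδ0 : (δ : L) ≠ 0) (n : ℕ) :
    ∃ S : Finset (L × L), n < S.card ∧ ∀ x ∈ S, evalEval x.1 x.2 F = 0 ∧
      evalEval x.1 x.2 (derivative F) ≠ 0 := by
  classical
  have hδ1 : δ ≠ 0 := by rintro rfl; simp at hδ0
  have hroot : ∀ T0 : L, ∃ x0, evalEval T0 x0 F = 0 := by
    intro T0
    have hm : (F.map (evalRingHom T0)).Monic := hF.map _
    have hd : (F.map (evalRingHom T0)).degree ≠ 0 := by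
      rw [degree_eq_natDegree hm.ne_zero, hF.natDegree_map, hδ]
      exact_mod_cast hδ1
    obtain ⟨x, hx⟩ := IsAlgClosed.exists_root _ hd
    refine ⟨x, ?_⟩
    rw [IsRoot, eval_map, eval₂_evalRingHom] at hx
    exact hx
  choose r hr using hroot
  obtain ⟨A, hA⟩ := Infinite.exists_subset_card_eq L (n + 1 + δ * δ)
  set S := A.map ⟨fun T0 => (T0, r T0), fun a b h => congrArg Prod.fst h⟩ with hS
  have hSc : S.card = n + 1 + δ * δ := by rw [hS, Finset.card_map, hA]
  have hSF : ∀ x ∈ S, evalEval x.1 x.2 F = 0 := by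
    intro x hx
    rw [hS, Finset.mem_map] at hx
    obtain ⟨T0, _, rfl⟩ := hx
    exact hr T0
  have hbad := bezout_points hF hδ hTF hirr (u := derivative F) (e := δ)
    ((hTF.mono (Nat.le_succ δ)).derivative) (not_dvd_derivative hF hδ hδ0)
    (S.filter (fun x => evalEval x.1 x.2 (derivative F) = 0))
    (fun x hx => hSF x (Finset.mem_filter.1 hx).1) (fun x hx => (Finset.mem_filter.1 hx).2)
  refine ⟨S.filter (fun x => ¬ evalEval x.1 x.2 (derivative F) = 0), ?_, ?_⟩
  · have := Finset.card_filter_add_card_filter_not (s := S)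
      (fun x => evalEval x.1 x.2 (derivative F) = 0)
    omega
  · intro x hx
    rw [Finset.mem_filter] at hx
    exact ⟨hSF x hx.1, hx.2⟩

/-- the monomial `X^i T^j` -/
noncomputable def mon {K : Type*} [CommRing K] (x : ℕ × ℕ) : K[X][X] :=
  monomial x.1 (monomial x.2 1)

theorem nf_eq {K : Type*} [CommRing K] (δ D : ℕ) (c : idx δ D → K) :
    nf δ D c = ∑ x : idx δ D, C (C (c x)) * mon x.1 := by
  rw [nf_apply]
  apply Finset.sum_congr rfl
  intro x _
  rw [mon, C_mul_monomial, C_mul_monomial, mul_one]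

theorem map_mon {K L : Type*} [CommRing K] [CommRing L] (φ : K →+* L) (x : ℕ × ℕ) :
    (mon x : K[X][X]).map (mapRingHom φ) = mon x := by
  simp [mon]

/-- the Stepanov auxiliary polynomial -/
noncomputable def stG {K : Type*} [CommRing K] (p δ A k : ℕ) (α : idx δ A × idx δ k → K) :
    K[X][X] := ∑ x : idx δ A × idx δ k, C (C (α x)) * (mon x.1.1 * mon x.2.1 ^ p)

/-- the conditions of Stepanov's method -/
noncomputable def stH {K : Type*} [CommRing K] (F : K[X][X]) (δ A k j : ℕ) :
    (idx δ A × idx δ k → K) →ₗ[K] K[X][X] where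
  toFun α := ∑ x : idx δ A × idx δ k, C (C (α x)) * ((Dv F)^[j] (mon x.1.1) * mon x.2.1)
  map_add' a b := by simp [add_mul, Finset.sum_add_distrib]
  map_smul' c a := by
    rw [RingHom.id_apply, Finset.smul_sum]
    apply Finset.sum_congr rfl
    intro x _
    have : ∀ u : K[X][X], c • u = C (C c) * u := by
      intro u
      rw [← smul_eq_C_mul, ← algebraMap_eq, algebraMap_smul]
    rw [this, Pi.smul_apply, smul_eq_mul, map_mul, map_mul, mul_assoc]

theorem TD_mon {K : Type*} [CommRing K] {δ D : ℕ} (x : idx δ D) : TD D (mon x.1 : K[X][X]) :=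
  TD.monomial _ (mem_idx.1 x.2).2

theorem TD_iter {K : Type*} [CommRing K] {F u : K[X][X]} {δ D : ℕ} (hF : TD δ F) (hu : TD D u)
    (j : ℕ) : TD (D + j * δ) ((Dv F)^[j] u) := by
  induction j with
  | zero => simpa using hu
  | succ j ih =>
    rw [Function.iterate_succ_apply']
    have := TD.Dv (hF.mono (Nat.le_succ δ)) ih
    refine this.mono (by rw [Nat.succ_mul]; omega)

theorem TD_stH {K : Type*} [CommRing K] {F : K[X][X]} {δ : ℕ} (hF : TD δ F) (A k j : ℕ)
    (α : idx δ A × idx δ k → K) : TD (A + k + j * δ) (stH F δ A k j α) := by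
  show TD _ (∑ x : idx δ A × idx δ k, C (C (α x)) * ((Dv F)^[j] (mon x.1.1) * mon x.2.1))
  apply TD.sum
  intro x _
  apply TD.smul
  refine ((TD_iter hF (TD_mon x.1) j).mul (TD_mon x.2)).mono (by omega)

theorem TD_stG {K : Type*} [CommRing K] (p δ A k : ℕ)
    (α : idx δ A × idx δ k → K) : TD (A + p * k) (stG p δ A k α) := by
  apply TD.sum
  intro x _
  apply TD.smul
  exact (TD_mon x.1).mul ((TD_mon x.2).pow p)

theorem st_exists {K : Type*} [Field K] {F : K[X][X]} {δ : ℕ} (hF : F.Monic)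
    (hδ : F.natDegree = δ) (hTF : TD δ F) (A k m : ℕ)
    (hcount : ∑ j ∈ Finset.range m, (idx δ (A + k + j * δ)).card < (idx δ A).card * (idx δ k).card) :
    ∃ α : idx δ A × idx δ k → K, α ≠ 0 ∧ ∀ j < m, F ∣ stH F δ A k j α := by
  have hdF : F.degree = (δ : WithBot ℕ) := by rw [degree_eq_natDegree hF.ne_zero, hδ]
  let Ψ : (idx δ A × idx δ k → K) →ₗ[K] (∀ j : Fin m, idx δ (A + k + j * δ) → K) :=
    LinearMap.pi (fun j => (co δ (A + k + j * δ)) ∘ₗ ((modByMonicHom F).restrictScalars K) ∘ₗ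
      (stH F δ A k j))
  have hdim : Module.finrank K (∀ j : Fin m, idx δ (A + k + j * δ) → K) <
      Module.finrank K (idx δ A × idx δ k → K) := by
    rw [Module.finrank_pi_fintype, Module.finrank_fintype_fun_eq_card, Fintype.card_prod,
      Fintype.card_coe, Fintype.card_coe]
    simp only [Module.finrank_fintype_fun_eq_card, Fintype.card_coe]
    rw [Finset.sum_range] at hcount
    exact hcount
  obtain ⟨α, hα, hα0⟩ := (Submodule.ne_bot_iff _).1 (LinearMap.ker_ne_bot_of_finrank_lt (f := Ψ) hdim)
  refine ⟨α, hα0, ?_⟩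
  intro j hj
  rw [LinearMap.mem_ker] at hα
  have h1 : co δ (A + k + j * δ) (stH F δ A k j α %ₘ F) = 0 := congrFun hα ⟨j, hj⟩
  have h2 := nf_co (δ := δ) (D := A + k + j * δ) (P := stH F δ A k j α %ₘ F)
    (by rw [← hdF]; exact degree_modByMonic_lt _ hF) (TD.modByMonic hF hδ hTF (TD_stH hTF A k j α))
  rw [h1, map_zero] at h2
  exact (modByMonic_eq_zero_iff_dvd hF).1 h2.symm

theorem Dv_smul_pow {p : ℕ} {K : Type*} [CommRing K] [CharP K p] (F a b : K[X][X])
    (c : K) : Dv F (C (C c) * (a * b ^ p)) = C (C c) * (Dv F a * b ^ p) := by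
  have h0 : ∀ c : K, ∀ u : K[X][X], C (C c) * u = c • u := by
    intro c u
    rw [← smul_eq_C_mul, ← algebraMap_eq, algebraMap_smul]
  rw [h0, h0, Derivation.map_smul, Derivation.leibniz, Derivation.leibniz_pow]
  have : (p : ℕ) • (b ^ (p - 1) • Dv F b) = 0 := by
    rw [nsmul_eq_mul, CharP.cast_eq_zero, zero_mul]
  rw [this, smul_zero, zero_add, smul_eq_mul, mul_comm]

theorem Dv_iter_stG {p : ℕ} {K : Type*} [CommRing K] [CharP K p] (F : K[X][X])
    (δ A k : ℕ) (α : idx δ A × idx δ k → K) (j : ℕ) :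
    (Dv F)^[j] (stG p δ A k α) =
      ∑ x : idx δ A × idx δ k, C (C (α x)) * ((Dv F)^[j] (mon x.1.1) * mon x.2.1 ^ p) := by
  induction j with
  | zero => rfl
  | succ j ih =>
    rw [Function.iterate_succ_apply', ih, map_sum]
    apply Finset.sum_congr rfl
    intro x _
    rw [Dv_smul_pow, Function.iterate_succ_apply']

end EV

namespace EV

open Polynomial

theorem stG_not_dvd {p : ℕ} [hp : Fact p.Prime] {L : Type*} [Field L] [IsAlgClosed L] [CharP L p]
    {F : L[X][X]} {δ : ℕ} (hF : F.Monic) (hδ : F.natDegree = δ) (hTF : TD δ F)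
    (hirr : Irreducible F) (hδ0 : (δ : L) ≠ 0) (A k : ℕ) (hA : δ * A < p)
    (α : idx δ A × idx δ k → L) (hα : α ≠ 0) : ¬ F ∣ stG p δ A k α := by
  intro hdvd
  have hdF : F.degree = (δ : WithBot ℕ) := by rw [degree_eq_natDegree hF.ne_zero, hδ]
  apply hα
  obtain ⟨S, hSc, hS⟩ := exists_smooth_points hF hδ hTF hirr hδ0 (δ * k)
  have h9 : ∀ x, ∃ r, r ^ p = α x := fun x => IsAlgClosed.exists_pow_nat_eq (α x) hp.out.pos
  choose β hβ using h9
  -- the key vanishing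
  have key : ∀ P ∈ S, ∀ l : idx δ A, evalEval P.1 P.2 (nf δ k (fun i => β (l, i))) = 0 := by
    intro P hP l
    obtain ⟨h0, h1⟩ := hS P hP
    obtain ⟨J, hT, hJF⟩ := exists_branch hF h0 h1
    let α' : idx δ A → L := fun l => ∑ i : idx δ k, α (l, i) * (evalEval P.1 P.2 (mon i.1)) ^ p
    have hG : J.φ (stG p δ A k α) = 0 := by
      obtain ⟨w, hw⟩ := hdvd
      rw [hw, map_mul, hJF, zero_mul]
    have hcong : ∀ b : L[X][X], PowerSeries.X ^ p ∣
        J.φ b ^ p - PowerSeries.C (evalEval P.1 P.2 b) ^ p := by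
      intro b
      have : CharP (PowerSeries L) p :=
        charP_of_injective_ringHom (f := (PowerSeries.C : L →+* PowerSeries L))
          (PowerSeries.C_injective) p
      rw [← sub_pow_char]
      apply pow_dvd_pow_of_dvd
      rw [PowerSeries.X_dvd_iff, map_sub, J.const]
      simp
    have h3 : PowerSeries.X ^ p ∣ J.φ (nf δ A α') := by
      have h4 : PowerSeries.X ^ p ∣ J.φ (stG p δ A k α) - J.φ (nf δ A α') := by
        rw [stG, nf_eq, map_sum, map_sum, Fintype.sum_prod_type]
        rw [← Finset.sum_sub_distrib]
        apply Finset.dvd_sum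
        intro l _
        simp only [map_mul, map_pow, J.hC, α', map_sum]
        rw [Finset.sum_mul, ← Finset.sum_sub_distrib]
        apply Finset.dvd_sum
        intro i _
        have := hcong (mon i.1)
        have e : PowerSeries.C (α (l, i)) * (J.φ (mon l.1) * J.φ (mon i.1) ^ p) -
          PowerSeries.C (α (l, i)) * PowerSeries.C (evalEval P.1 P.2 (mon i.1)) ^ p * J.φ (mon l.1)
          = (PowerSeries.C (α (l, i)) * J.φ (mon l.1)) *
            (J.φ (mon i.1) ^ p - PowerSeries.C (evalEval P.1 P.2 (mon i.1)) ^ p) := by ring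
        rw [e]
        exact this.mul_left _
      rw [hG, zero_sub, dvd_neg] at h4
      exact h4
    have h5 : F ∣ nf δ A α' := by
      by_contra hn
      have := bezout_jets hF hδ hTF hirr (TD_nf δ A α') hn (ι := Unit) (fun _ => P)
        (fun _ _ _ => rfl) (fun _ => J) p (fun _ w => branch_surj J hT p w)
        (fun _ => by rw [hJF]; exact dvd_zero _) (fun _ => h3)
      simp at this
      omega
    have h6 : nf δ A α' = 0 := by
      by_contra h0
      exact hF.not_dvd_of_degree_lt h0 (by rw [hdF]; exact degree_nf δ A α') h5
    have h7 : α' = 0 := nf_injective δ A (by rw [h6, map_zero])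
    have h8 : α' l = 0 := congrFun h7 l
    have h9 : (evalEval P.1 P.2 (nf δ k (fun i => β (l, i)))) ^ p = 0 := by
      rw [← h8, nf_eq, ← coe_evalEvalRingHom, map_sum, sum_pow_char]
      apply Finset.sum_congr rfl
      intro i _
      rw [map_mul, mul_pow]
      simp [hβ]
    exact pow_eq_zero_iff hp.out.ne_zero |>.1 h9
  have hz : ∀ l : idx δ A, (fun i => β (l, i)) = 0 := by
    intro l
    have h5 : F ∣ nf δ k (fun i => β (l, i)) := by
      by_contra hn
      have := bezout_points hF hδ hTF hirr (TD_nf δ k _) hn S (fun x hx => (hS x hx).1)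
        (fun x hx => key x hx l)
      omega
    have h6 : nf δ k (fun i => β (l, i)) = 0 := by
      by_contra h0
      exact hF.not_dvd_of_degree_lt h0 (by rw [hdF]; exact degree_nf δ k _) h5
    exact nf_injective δ k (by rw [h6, map_zero])
  funext x
  rw [← hβ x]
  have : β (x.1, x.2) = 0 := congrFun (hz x.1) x.2
  rw [Prod.mk.eta] at this
  rw [this, zero_pow hp.out.ne_zero]
  rfl

theorem map_stG {p : ℕ} {K L : Type*} [CommRing K] [CommRing L] (φ : K →+* L) (δ A k : ℕ)
    (α : idx δ A × idx δ k → K) :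
    (stG p δ A k α).map (mapRingHom φ) = stG p δ A k (fun x => φ (α x)) := by
  simp [stG, Polynomial.map_sum, map_mon]

theorem TD.map {K L : Type*} [CommRing K] [CommRing L] (φ : K →+* L) {D : ℕ} {P : K[X][X]}
    (h : TD D P) : TD D (P.map (mapRingHom φ)) := by
  intro i j hij
  rw [coeff_map, coe_mapRingHom, coeff_map, h i j hij, map_zero]

theorem stepanov_count {p : ℕ} [hp : Fact p.Prime] {L : Type*} [Field L] [IsAlgClosed L]
    [Algebra (ZMod p) L] {F : (ZMod p)[X][X]} {δ : ℕ} (hF : F.Monic) (hδ : F.natDegree = δ)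
    (hTF : TD δ F) (hirrL : Irreducible (F.map (mapRingHom (algebraMap (ZMod p) L))))
    (hirr : Irreducible F) (hδ0 : 0 < δ) (hδp : δ < p) (A k m : ℕ) (hA : δ * A < p) (hm : m < p)
    (hcount : ∑ j ∈ Finset.range m, (idx δ (A + k + j * δ)).card < (idx δ A).card * (idx δ k).card)
    (S : Finset (ZMod p × ZMod p)) (hS : ∀ x ∈ S, evalEval x.1 x.2 F = 0 ∧
      evalEval x.1 x.2 (derivative F) ≠ 0) : S.card * m ≤ δ * (A + p * k) := by
  have : CharP L p := charP_of_injective_algebraMap (algebraMap (ZMod p) L).injective p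
  obtain ⟨α, hα0, hα⟩ := st_exists hF hδ hTF A k m hcount
  have hcast : ∀ r : ℕ, 0 < r → r < p → ((r : ℕ) : ZMod p) ≠ 0 := by
    intro r h h' h0
    rw [ZMod.natCast_eq_zero_iff] at h0
    exact absurd (Nat.le_of_dvd h h0) (by omega)
  have hnd : ¬ F ∣ stG p δ A k α := by
    intro h
    have h1 := Polynomial.map_dvd (mapRingHom (algebraMap (ZMod p) L)) h
    rw [map_stG] at h1
    refine stG_not_dvd (hF.map _) (by rw [hF.natDegree_map, hδ]) (hTF.map _) hirrL ?_ A k hA _ ?_ h1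
    · intro h0
      rw [CharP.cast_eq_zero_iff L p] at h0
      exact absurd (Nat.le_of_dvd hδ0 h0) (by omega)
    · intro h0
      apply hα0
      funext x
      exact (map_eq_zero_iff _ (algebraMap (ZMod p) L).injective).1 (congrFun h0 x)
  have hbr : ∀ x : S, ∃ J : Jet (ZMod p) x.1.1 x.1.2, J.φ (C X) = PowerSeries.C x.1.1 + PowerSeries.X ∧
      J.φ F = 0 := fun x => exists_branch hF (hS x.1 x.2).1 (hS x.1 x.2).2
  choose J hJT hJF using hbr
  have h := bezout_jets hF hδ hTF hirr (TD_stG p δ A k α) hnd (ι := S) (fun x => x.1)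
    Subtype.val_injective J m (fun x w => branch_surj (J x) (hJT x) m w)
    (fun x => by rw [hJF]; exact dvd_zero _) (fun x => by
      apply branch_order (J x) (hJT x) (hJF x) (hS x.1 x.2).2 m (fun r h h' => hcast r h (by omega))
      intro j hj
      rw [Dv_iter_stG]
      obtain ⟨w, hw⟩ := hα j hj
      have h1 : evalEval x.1.1 x.1.2 (stH F δ A k j α) = 0 := by
        rw [hw, ← coe_evalEvalRingHom, map_mul, coe_evalEvalRingHom, (hS x.1 x.2).1, zero_mul]
      rw [← h1]
      show _ = evalEval x.1.1 x.1.2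
        (∑ x : idx δ A × idx δ k, C (C (α x)) * ((Dv F)^[j] (mon x.1.1) * mon x.2.1))
      rw [← coe_evalEvalRingHom, map_sum, map_sum]
      apply Finset.sum_congr rfl
      intro y _
      simp only [map_mul, map_pow, ZMod.pow_card])
  simpa using h

set_option maxHeartbeats 800000 in
theorem count_ineq {p δ q : ℕ} (hδ0 : 0 < δ) (hq : q ^ 2 ≤ p) (hq1 : 100 * δ ^ 2 ≤ q)
    (A k m : ℕ) (hA : δ * A < p) (hA' : p ≤ δ * A + δ) (hk : δ * k ≤ q + δ)
    (hm : m + 8 * δ ^ 2 = δ * k) :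
    ∑ j ∈ Finset.range m, (idx δ (A + k + j * δ)).card < (idx δ A).card * (idx δ k).card := by
  have h1 : ∑ j ∈ Finset.range m, (idx δ (A + k + j * δ)).card ≤
      m * (δ * (A + k + m * δ + 1)) := by
    calc _ ≤ ∑ j ∈ Finset.range m, δ * (A + k + m * δ + 1) := by
          apply Finset.sum_le_sum
          intro j hj
          rw [Finset.mem_range] at hj
          refine (card_idx_le _ _).trans ?_
          gcongr
      _ = _ := by simp
  have h2 := card_idx_ge δ A
  have h3 := card_idx_ge δ k
  set a := (idx δ A).card
  set b := (idx δ k).card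
  refine h1.trans_lt ?_
  have hmq : m ≤ q := by nlinarith
  have e1 : p ≤ a + δ ^ 2 := by nlinarith
  have e2 : m + 7 * δ ^ 2 ≤ b := by nlinarith
  have e3 : m * (δ * (A + k + m * δ + 1)) ≤ m * (p + q + 2 * δ + m * δ ^ 2) := by
    gcongr
    nlinarith
  refine e3.trans_lt ?_
  have e4 : (a : ℤ) ≥ p - δ ^ 2 := by zify at e1; linarith
  have e5 : (b : ℤ) ≥ m + 7 * δ ^ 2 := by exact_mod_cast e2
  have hp' : (δ ^ 2 : ℤ) * 100 ≤ p := by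
    zify at hq hq1
    have : (1 : ℤ) ≤ δ := by exact_mod_cast hδ0
    nlinarith
  have e6 : ((p : ℤ) - δ ^ 2) * (m + 7 * δ ^ 2) ≤ a * b := by
    apply mul_le_mul e4 e5 (by positivity) (by positivity)
  zify
  refine lt_of_lt_of_le ?_ e6
  zify at hq hq1 hmq
  have hd : (1 : ℤ) ≤ δ := by exact_mod_cast hδ0
  have f1 : (m : ℤ) * q ≤ p := by nlinarith
  have f2 : (m : ℤ) * m ≤ p := by nlinarith
  have f3 : (m : ℤ) ≤ p := by nlinarith
  have f4 : (m : ℤ) * δ ≤ p * δ ^ 2 := by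
    have : (δ : ℤ) ≤ δ ^ 2 := by nlinarith
    have hm0 : (0 : ℤ) ≤ m := by positivity
    nlinarith
  have f5 : (m : ℤ) * m * δ ^ 2 ≤ p * δ ^ 2 := by gcongr
  have f6 : (m : ℤ) * δ ^ 2 ≤ p := by nlinarith
  have f7 : (1 : ℤ) ≤ δ ^ 2 := by nlinarith
  have f8 : (p : ℤ) ≤ p * δ ^ 2 := by nlinarith
  have f9 : (δ : ℤ) ^ 2 * 100 * δ ^ 2 ≤ p * δ ^ 2 := mul_le_mul_of_nonneg_right hp' (by positivity)
  have f10 : (0 : ℤ) < p := by linarith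
  linarith

theorem stepanov {p : ℕ} [hp : Fact p.Prime] {L : Type*} [Field L] [IsAlgClosed L]
    [Algebra (ZMod p) L] {F : (ZMod p)[X][X]} {δ : ℕ} (hF : F.Monic) (hδ : F.natDegree = δ)
    (hTF : TD δ F) (hirrL : Irreducible (F.map (mapRingHom (algebraMap (ZMod p) L))))
    (hδ0 : 0 < δ) {q : ℕ} (hq : q ^ 2 ≤ p) (hq' : p < (q + 1) ^ 2) (hq1 : 100 * δ ^ 2 ≤ q) :
    ∑ T : ZMod p, ∑ x : ZMod p, (F.map (evalRingHom T)).rootMultiplicity x ≤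
      p + 37 * δ ^ 2 * q := by
  classical
  have hirr : Irreducible F := hF.irreducible_of_irreducible_map (mapRingHom (algebraMap (ZMod p) L)) F hirrL
  have hδp : δ < p := by
    have h1 : δ ≤ δ ^ 2 := Nat.le_self_pow (by norm_num) _
    have h2 : q ≤ q ^ 2 := Nat.le_self_pow (by norm_num) _
    omega
  obtain ⟨A, hA, hA'⟩ : ∃ A, δ * A < p ∧ p ≤ δ * A + δ := by
    refine ⟨(p - 1) / δ, ?_, ?_⟩
    · have := Nat.mul_div_le (p - 1) δ
      have := hp.out.pos
      omega
    · have := Nat.lt_mul_div_succ (p - 1) hδ0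
      rw [mul_add] at this
      omega
  obtain ⟨k, hk, hk'⟩ : ∃ k, δ * k ≤ q + δ ∧ q < δ * k := by
    refine ⟨q / δ + 1, ?_, ?_⟩
    · have := Nat.mul_div_le q δ
      rw [mul_add]; omega
    · exact Nat.lt_mul_div_succ q hδ0
  obtain ⟨m, hm⟩ : ∃ m, m + 8 * δ ^ 2 = δ * k := ⟨δ * k - 8 * δ ^ 2, by omega⟩
  set S : Finset (ZMod p × ZMod p) := Finset.univ.filter
    (fun x => evalEval x.1 x.2 F = 0 ∧ evalEval x.1 x.2 (derivative F) ≠ 0) with hS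
  have hmq : m ≤ q := by nlinarith
  have h1 := stepanov_count hF hδ hTF hirrL hirr hδ0 hδp A k m hA (by nlinarith)
    (count_ineq hδ0 hq hq1 A k m hA hA' hk hm) S (fun x hx => (Finset.mem_filter.1 hx).2)
  have h2 : S.card ≤ p + 36 * δ ^ 2 * q := by
    have hm2 : q + 1 ≤ 2 * m := by nlinarith
    have hm0 : 0 < m := by omega
    have hδ1 : 1 ≤ δ ^ 2 := Nat.one_le_pow _ _ hδ0
    have e1 : S.card * m ≤ p * m + p * (9 * δ ^ 2) := by
      calc S.card * m ≤ δ * (A + p * k) := h1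
        _ = δ * A + p * (δ * k) := by ring
        _ ≤ p + p * (m + 8 * δ ^ 2) := by rw [hm]; omega
        _ ≤ p * m + p * (9 * δ ^ 2) := by nlinarith
    have e2 : p ≤ m * (4 * q) := by
      calc p ≤ (q + 1) ^ 2 := hq'.le
        _ = (q + 1) * (q + 1) := by ring
        _ ≤ (2 * m) * (2 * q) := by gcongr; nlinarith
        _ = _ := by ring
    have e3 : S.card * m ≤ (p + 36 * δ ^ 2 * q) * m := by
      refine e1.trans ?_
      have : p * (9 * δ ^ 2) ≤ (m * (4 * q)) * (9 * δ ^ 2) := by gcongr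
      linarith
    exact Nat.le_of_mul_le_mul_right e3 hm0
  set S' : Finset (ZMod p × ZMod p) := Finset.univ.filter
    (fun x => evalEval x.1 x.2 F = 0 ∧ evalEval x.1 x.2 (derivative F) = 0) with hS'
  have hcδ : ((δ : ℕ) : ZMod p) ≠ 0 := by
    intro h0
    rw [ZMod.natCast_eq_zero_iff] at h0
    exact absurd (Nat.le_of_dvd hδ0 h0) (by omega)
  have h3 : S'.card ≤ δ * δ := bezout_points hF hδ hTF hirr (u := derivative F) (e := δ)
    ((hTF.mono (Nat.le_succ δ)).derivative) (not_dvd_derivative hF hδ hcδ) S'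
    (fun x hx => (Finset.mem_filter.1 hx).2.1) (fun x hx => (Finset.mem_filter.1 hx).2.2)
  have hmon : ∀ T : ZMod p, (F.map (evalRingHom T)).Monic := fun T => hF.map _
  have hev : ∀ T x : ZMod p, (F.map (evalRingHom T)).eval x = evalEval T x F := by
    intro T x; rw [eval_map, eval₂_evalRingHom]
  have hev' : ∀ T x : ZMod p, (derivative (F.map (evalRingHom T))).eval x =
      evalEval T x (derivative F) := by
    intro T x; rw [derivative_map, eval_map, eval₂_evalRingHom]
  have hpt : ∀ T x : ZMod p, (F.map (evalRingHom T)).rootMultiplicity x ≤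
      (if (T, x) ∈ S then 1 else 0) + δ * (if (T, x) ∈ S' then 1 else 0) := by
    intro T x
    by_cases h0 : evalEval T x F = 0
    · by_cases h1 : evalEval T x (derivative F) = 0
      · have : (T, x) ∈ S' := by simp [hS', h0, h1]
        rw [if_pos this, mul_one]
        have h5 := rootMultiplicity_le_iff (hmon T).ne_zero x δ
        have h6 : (F.map (evalRingHom T)).rootMultiplicity x ≤ δ := by
          rw [h5]
          intro h
          have := natDegree_le_of_dvd h (hmon T).ne_zero
          rw [hF.natDegree_map, hδ, natDegree_pow, natDegree_X_sub_C] at this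
          omega
        omega
      · have : (T, x) ∈ S := by simp [hS, h0, h1]
        rw [if_pos this]
        have : ¬ 1 < (F.map (evalRingHom T)).rootMultiplicity x := by
          rw [one_lt_rootMultiplicity_iff_isRoot (hmon T).ne_zero]
          rintro ⟨_, h⟩
          apply h1
          rw [← hev']; exact h
        omega
    · have : (F.map (evalRingHom T)).rootMultiplicity x = 0 := by
        rw [rootMultiplicity_eq_zero_iff]
        intro h
        exact absurd (by rw [← hev]; exact h) h0
      rw [this]; exact Nat.zero_le _
  calc _ ≤ ∑ T : ZMod p, ∑ x : ZMod p, ((if (T, x) ∈ S then 1 else 0) +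
        δ * (if (T, x) ∈ S' then 1 else 0)) :=
        Finset.sum_le_sum (fun T _ => Finset.sum_le_sum (fun x _ => hpt T x))
    _ = ∑ y : ZMod p × ZMod p, ((if y ∈ S then 1 else 0) + δ * (if y ∈ S' then 1 else 0)) := by
        rw [Fintype.sum_prod_type]
    _ = S.card + δ * S'.card := by
        rw [Finset.sum_add_distrib, ← Finset.mul_sum]; simp
    _ ≤ p + 36 * δ ^ 2 * q + δ * (δ * δ) := by gcongr
    _ ≤ _ := by nlinarith [Nat.zero_le (δ ^ 2)]

end EV

namespace EV

open Polynomial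

/-! Additivity of the total degree -/

section
variable {K : Type*} [CommRing K]

/-- homogenisation with respect to a third variable -/
noncomputable def Lam : K[X][X] →+* K[X][X][X] :=
  eval₂RingHom (eval₂RingHom ((C : K[X][X] →+* K[X][X][X]).comp ((C : K[X] →+* K[X][X]).comp
    (C : K →+* K[X]))) ((C (C X) : K[X][X][X]) * X)) ((C X : K[X][X][X]) * X)

theorem coeff_Lam (P : K[X][X]) (k i j : ℕ) :
    (((Lam P).coeff k).coeff i).coeff j = if i + j = k then (P.coeff i).coeff j else 0 := by
  induction P using Polynomial.induction_on' with
  | add p q hp hq =>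
    rw [map_add]
    simp only [coeff_add, hp, hq]
    split_ifs <;> simp
  | monomial n a =>
    induction a using Polynomial.induction_on' with
    | add p q hp hq =>
      rw [map_add, map_add]
      simp only [coeff_add, hp, hq]
      split_ifs <;> simp
    | monomial l c =>
      have : Lam (monomial n (monomial l c)) = monomial (n + l) (monomial n (monomial l c)) := by
        simp only [Lam, coe_eval₂RingHom, eval₂_monomial, RingHom.comp_apply]
        simp only [← C_mul_X_pow_eq_monomial, map_mul, map_pow]
        ring
      rw [this]
      simp only [coeff_monomial]
      by_cases h1 : n + l = k
      · subst h1
        by_cases h2 : n = i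
        · subst h2
          by_cases h3 : l = j
          · subst h3; simp
          · simp [h3, coeff_monomial]
        · simp [h2, coeff_monomial]
      · by_cases h2 : n = i
        · subst h2
          by_cases h3 : l = j
          · subst h3; simp [h1]
          · simp [h1, h3, coeff_monomial]
        · simp [h1, h2]

theorem TD_iff_Lam (D : ℕ) (P : K[X][X]) : TD D P ↔ (Lam P).natDegree ≤ D := by
  constructor
  · intro h
    rw [natDegree_le_iff_coeff_eq_zero]
    intro k hk
    ext i j
    rw [coeff_Lam]
    split_ifs with h1
    · rw [h i j (by omega)]; simp
    · simp
  · intro h i j hij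
    have := natDegree_le_iff_coeff_eq_zero.1 h (i + j) hij
    have h2 := coeff_Lam P (i + j) i j
    rw [this, if_pos rfl] at h2
    simpa using h2.symm

theorem Lam_ne_zero {P : K[X][X]} (h : P ≠ 0) : Lam P ≠ 0 := by
  intro h0
  apply h
  ext i j
  have h2 := coeff_Lam P (i + j) i j
  rw [h0, if_pos rfl] at h2
  simpa using h2.symm

theorem TD_of_mul [IsDomain K] {D : ℕ} {P Q : K[X][X]} (hP : P ≠ 0) (hQ : Q ≠ 0) (h : TD D (P * Q)) :
    ∃ a b, TD a P ∧ TD b Q ∧ a + b ≤ D := by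
  refine ⟨(Lam P).natDegree, (Lam Q).natDegree, (TD_iff_Lam _ _).2 le_rfl, (TD_iff_Lam _ _).2 le_rfl, ?_⟩
  rw [TD_iff_Lam, map_mul, natDegree_mul (Lam_ne_zero hP) (Lam_ne_zero hQ)] at h
  exact h

/-- the Ruppert differential expression -/
noncomputable def Psi (F g h : K[X][X]) : K[X][X] :=
  F * (dT g - derivative h) - g * dT F + h * derivative F

/-- index set of unknowns -/
abbrev RK (δ : ℕ) := idx (δ - 1) (δ - 1) ⊕ idx δ (δ - 1)

/-- columns -/
noncomputable def rcol (δ : ℕ) : RK δ → K[X][X] × K[X][X]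
  | Sum.inl x => (mon x.1, 0)
  | Sum.inr x => (0, mon x.1)

/-- Ruppert matrix -/
noncomputable def rupA (δ : ℕ) (F : K[X][X]) (r : ℕ × ℕ) (k : RK δ) : K :=
  ((Psi F (rcol δ k).1 (rcol δ k).2).coeff r.1).coeff r.2

theorem Psi_smul_add (F g h g' h' : K[X][X]) (c c' : K) :
    Psi F (C (C c) * g + C (C c') * g') (C (C c) * h + C (C c') * h') =
      C (C c) * Psi F g h + C (C c') * Psi F g' h' := by
  have h1 : ∀ c : K, ∀ u : K[X][X], dT (C (C c) * u) = C (C c) * dT u := by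
    intro c u
    rw [Derivation.leibniz, dT_C, derivative_C, map_zero, smul_zero, add_zero, smul_eq_mul]
  have h2 : ∀ c : K, ∀ u : K[X][X], derivative (C (C c) * u) = C (C c) * derivative u := by
    intro c u
    rw [derivative_mul, derivative_C, zero_mul, zero_add]
  simp only [Psi, map_add, h1, h2]
  ring

/-- the linear form -/
noncomputable def PsiL (F : K[X][X]) : (K[X][X] × K[X][X]) →ₗ[K] K[X][X] where
  toFun x := Psi F x.1 x.2
  map_add' a b := by
    have := Psi_smul_add F a.1 a.2 b.1 b.2 1 1
    simpa using this
  map_smul' c a := by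
    have := Psi_smul_add F a.1 a.2 0 0 c 0
    have h0 : ∀ u : K[X][X], c • u = C (C c) * u := by
      intro u
      rw [← smul_eq_C_mul, ← algebraMap_eq, algebraMap_smul]
    simp only [Prod.smul_fst, Prod.smul_snd, h0, RingHom.id_apply]
    simpa using this

theorem rupA_sum (δ : ℕ) (F : K[X][X]) (r : ℕ × ℕ) (v : RK δ → K) :
    ∑ k, rupA δ F r k * v k =
      ((Psi F (nf (δ - 1) (δ - 1) (fun x => v (Sum.inl x))) (nf δ (δ - 1) (fun x => v (Sum.inr x)))).coeff
        r.1).coeff r.2 := by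
  have h0 : ∀ c : K, ∀ u : K[X][X], c • u = C (C c) * u := by
    intro c u
    rw [← smul_eq_C_mul, ← algebraMap_eq, algebraMap_smul]
  have h1 : (nf (δ - 1) (δ - 1) (fun x => v (Sum.inl x)), nf δ (δ - 1) (fun x => v (Sum.inr x))) =
      ∑ k : RK δ, v k • (rcol δ k : K[X][X] × K[X][X]) := by
    rw [Fintype.sum_sum_type]
    simp only [rcol, nf_eq, Prod.smul_mk, smul_zero, h0]
    ext1
    · rw [Prod.fst_add, Prod.fst_sum, Prod.fst_sum]; simp
    · rw [Prod.snd_add, Prod.snd_sum, Prod.snd_sum]; simp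
  have h2 : Psi F (nf (δ - 1) (δ - 1) (fun x => v (Sum.inl x))) (nf δ (δ - 1) (fun x => v (Sum.inr x))) =
      PsiL F (nf (δ - 1) (δ - 1) (fun x => v (Sum.inl x)), nf δ (δ - 1) (fun x => v (Sum.inr x))) := rfl
  rw [h2, h1, map_sum, finsetSum_coeff, finsetSum_coeff]
  apply Finset.sum_congr rfl
  intro k _
  rw [map_smul, h0, coeff_C_mul, coeff_C_mul, mul_comm]
  rfl

theorem dT_map {L : Type*} [CommRing L] (φ : K →+* L) (P : K[X][X]) :
    dT (P.map (mapRingHom φ)) = (dT P).map (mapRingHom φ) := by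
  ext1 i
  rw [coeff_dT, coeff_map, coeff_map, coeff_dT, coe_mapRingHom, derivative_map]

theorem rupA_map {L : Type*} [CommRing L] (φ : K →+* L) (δ : ℕ) (F : K[X][X]) (r : ℕ × ℕ) (k : RK δ) :
    rupA δ (F.map (mapRingHom φ)) r k = φ (rupA δ F r k) := by
  have h1 : ∀ g h : K[X][X], Psi (F.map (mapRingHom φ)) (g.map (mapRingHom φ)) (h.map (mapRingHom φ)) =
      (Psi F g h).map (mapRingHom φ) := by
    intro g h
    simp [Psi, dT_map, derivative_map, Polynomial.map_sub]
  have h2 : (rcol δ k : L[X][X] × L[X][X]) =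
      ((rcol δ k : K[X][X] × K[X][X]).1.map (mapRingHom φ),
       (rcol δ k : K[X][X] × K[X][X]).2.map (mapRingHom φ)) := by
    rcases k with x | x <;> simp [rcol, map_mon]
  rw [rupA, h2, h1, coeff_map, coe_mapRingHom, coeff_map]
  rfl

theorem dT_derivative (P : K[X][X]) : dT (derivative P) = derivative (dT P) := by
  ext1 i
  rw [coeff_dT, coeff_derivative, coeff_derivative, coeff_dT, derivative_mul]
  simp

end

theorem rup_inj {K : Type*} [Field K] {F : K[X][X]} {δ : ℕ} (hF : F.Monic)
    (hδ : F.natDegree = δ) (hTF : TD δ F) (hirr : Irreducible F) (hδ0 : 0 < δ)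
    (hchar : ∀ r : ℕ, 0 < r → r ≤ δ ^ 2 → (r : K) ≠ 0)
    {T0 x0 : K} (h0 : evalEval T0 x0 F = 0) (h1 : evalEval T0 x0 (derivative F) ≠ 0)
    (v : RK δ → K) (hv : ∀ r, ∑ k, rupA δ F r k * v k = 0) : v = 0 := by
  have hdF : F.degree = (δ : WithBot ℕ) := by rw [degree_eq_natDegree hF.ne_zero, hδ]
  obtain ⟨J, hT, hJF⟩ := exists_branch hF h0 h1
  set g := nf (δ - 1) (δ - 1) (fun x => v (Sum.inl x)) with hg
  set h := nf δ (δ - 1) (fun x => v (Sum.inr x)) with hh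
  have hPsi : Psi F g h = 0 := by
    ext i j
    have := hv (i, j)
    rw [rupA_sum] at this
    simpa using this
  have hδK : (δ : K) ≠ 0 := hchar δ hδ0 (Nat.le_self_pow (by norm_num) _)
  set w := J.φ (derivative F) with hw
  have hw0 : PowerSeries.constantCoeff w ≠ 0 := by rw [hw, J.const]; exact h1
  -- the ODE
  have hode : F ∣ derivative F * Dv F g - g * Dv F (derivative F) := by
    have e1 : derivative (Psi F g h) = 0 := by rw [hPsi, derivative_zero]
    have e2 : derivative F * Psi F g h = 0 := by rw [hPsi, mul_zero]
    rw [Psi] at e1 hPsi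
    simp only [derivative_add, derivative_sub, derivative_mul] at e1
    rw [Dv_apply, Dv_apply, dT_derivative]
    refine ⟨- derivative F * derivative (dT g - derivative h) + derivative (derivative F) * (dT g - derivative h), ?_⟩
    simp only [derivative_sub]
    linear_combination derivative F * e1 - derivative (derivative F) * hPsi
  set c : K := evalEval T0 x0 g / evalEval T0 x0 (derivative F) with hc
  set G1 := g - C (C c) * derivative F with hG1
  have hode1 : F ∣ derivative F * Dv F G1 - G1 * Dv F (derivative F) := by
    have : Dv F (C (C c) * derivative F) = C (C c) * Dv F (derivative F) := by
      have h0 : ∀ c : K, ∀ u : K[X][X], C (C c) * u = c • u := by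
        intro c u
        rw [← smul_eq_C_mul, ← algebraMap_eq, algebraMap_smul]
      rw [h0, h0, Derivation.map_smul]
    rw [hG1, map_sub, this]
    convert hode using 1
    ring
  set y := J.φ G1 with hy
  have hy0 : PowerSeries.constantCoeff y = 0 := by
    rw [hy, J.const, hG1, ← coe_evalEvalRingHom, map_sub, map_mul]
    simp only [coe_evalEvalRingHom, evalEval_C, eval_C]
    rw [hc, div_mul_cancel₀ _ h1, sub_self]
  have hD : w * PowerSeries.derivative K y = y * PowerSeries.derivative K w := by
    obtain ⟨q, hq⟩ := hode1
    have e := congrArg J.φ hq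
    rw [map_mul, hJF, zero_mul, map_sub, map_mul, map_mul, ← branch_deriv J hT hJF,
      ← branch_deriv J hT hJF, ← hw, ← hy] at e
    have hw1 : w ≠ 0 := by intro h; rw [h] at hw0; simp at hw0
    apply mul_left_cancel₀ hw1
    linear_combination e
  have hz : PowerSeries.derivative K (y * w⁻¹) = 0 := by
    have hi : w * w⁻¹ = 1 := PowerSeries.mul_inv_cancel w hw0
    have hdi : w * PowerSeries.derivative K w⁻¹ + w⁻¹ * PowerSeries.derivative K w = 0 := by
      have := congrArg (PowerSeries.derivative K) hi
      rw [Derivation.leibniz] at this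
      simpa [smul_eq_mul] using this
    rw [Derivation.leibniz, smul_eq_mul, smul_eq_mul]
    have : w * (y * PowerSeries.derivative K w⁻¹ + w⁻¹ * PowerSeries.derivative K y) = 0 := by
      linear_combination y * hdi + w⁻¹ * hD
    have hw1 : w ≠ 0 := by intro h; rw [h] at hw0; simp at hw0
    exact (mul_eq_zero.1 this).resolve_left hw1
  have hdiv : PowerSeries.X ^ (δ * (δ - 1) + 1) ∣ y := by
    have h3 : PowerSeries.X ^ (δ * (δ - 1) + 1) ∣ y * w⁻¹ := by
      rw [PowerSeries.X_pow_dvd_iff]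
      intro k hk
      rcases k with _ | k
      · rw [PowerSeries.coeff_zero_eq_constantCoeff_apply, map_mul, hy0, zero_mul]
      · have h4 := congrArg (PowerSeries.coeff k) hz
        rw [PowerSeries.coeff_derivative, map_zero] at h4
        have h5 := hchar (k + 1) (by omega) (by
          have : δ * (δ - 1) ≤ δ ^ 2 := by rw [pow_two]; exact Nat.mul_le_mul_left _ (by omega)
          omega)
        push_cast at h5
        exact (mul_eq_zero.1 h4).resolve_right h5
    have h4 := h3.mul_right w
    rwa [mul_assoc, PowerSeries.inv_mul_cancel w hw0, mul_one] at h4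
  have hTF1 : TD (δ - 1 + 1) F := by rwa [Nat.sub_add_cancel hδ0]
  have hTG : TD (δ - 1) G1 := (TD_nf _ _ _).sub (hTF1.derivative.smul c)
  have hFG : F ∣ G1 := by
    by_contra hn
    have := bezout_jets hF hδ hTF hirr hTG hn (ι := Unit) (fun _ => (T0, x0))
        (fun _ _ _ => rfl) (fun _ => J) _ (fun _ w => branch_surj J hT _ w)
        (fun _ => by rw [hJF]; exact dvd_zero _) (fun _ => hdiv)
    simp at this
  have hgd : g.degree < ((δ - 1 : ℕ) : WithBot ℕ) := degree_nf _ _ _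
  have hG10 : G1 = 0 := by
    by_contra hne
    refine hF.not_dvd_of_degree_lt hne ?_ hFG
    rw [hG1]
    refine (degree_sub_le _ _).trans_lt (max_lt ?_ ?_)
    · rw [hdF]; refine hgd.trans_le ?_; exact_mod_cast Nat.sub_le _ _
    · refine lt_of_le_of_lt ?_ (degree_derivative_lt hF.ne_zero)
      rw [← smul_eq_C_mul]; exact degree_smul_le _ _
  have hc0 : c = 0 := by
    have e := congrArg (fun P => (P.coeff (δ - 1))) hG10
    simp only [hG1, coeff_sub, coeff_C_mul, coeff_derivative, coeff_zero] at e
    rw [coeff_eq_zero_of_degree_lt hgd, Nat.sub_add_cancel hδ0] at e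
    have h2 : F.coeff δ = 1 := by rw [← hδ]; exact hF
    have h3 : ((δ - 1 : ℕ) : K[X]) + 1 = C (δ : K) := by
      have : ((δ - 1 : ℕ) : K[X]) + 1 = ((δ - 1 + 1 : ℕ) : K[X]) := by push_cast; rfl
      rw [this, Nat.sub_add_cancel hδ0]; simp
    rw [h2, h3, one_mul, zero_sub, ← C_mul, neg_eq_zero, C_eq_zero] at e
    exact (mul_eq_zero.1 e).resolve_right hδK
  have hg0 : g = 0 := by
    rw [hG1, hc0] at hG10
    simpa using hG10
  have hFh : F ∣ h := by
    rw [hg0, Psi] at hPsi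
    have : F ∣ h * derivative F := ⟨derivative h, by
      have : dT (0 : K[X][X]) = 0 := map_zero _
      rw [this] at hPsi
      linear_combination hPsi⟩
    exact (hirr.prime.dvd_or_dvd this).resolve_right (not_dvd_derivative hF hδ hδK)
  have hh0 : h = 0 := by
    by_contra hne
    exact hF.not_dvd_of_degree_lt hne (by rw [hdF]; exact degree_nf _ _ _) hFh
  have e1 : (fun x => v (Sum.inl x)) = 0 := nf_injective (δ - 1) (δ - 1) (by rw [← hg, hg0, map_zero])
  have e2 : (fun x => v (Sum.inr x)) = 0 := nf_injective δ (δ - 1) (by rw [← hh, hh0, map_zero])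
  funext k
  rcases k with x | x
  · exact congrFun e1 x
  · exact congrFun e2 x

theorem rup_not_inj_aux {K : Type*} [Field K] {F g h : K[X][X]} {δ : ℕ}
    (hPsi : Psi F g h = 0) (hgT : TD (δ - 1) g) (hhT : TD (δ - 1) h)
    (hgd : g.degree < ((δ - 1 : ℕ) : WithBot ℕ)) (hhd : h.degree < (δ : WithBot ℕ)) (hg : g ≠ 0) :
    ∃ v : RK δ → K, v ≠ 0 ∧ ∀ r, ∑ k, rupA δ F r k * v k = 0 := by
  refine ⟨Sum.elim (co (δ - 1) (δ - 1) g) (co δ (δ - 1) h), ?_, ?_⟩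
  · intro h0
    apply hg
    rw [← nf_co hgd hgT]
    have : co (δ - 1) (δ - 1) g = 0 := by
      funext x
      exact congrFun h0 (Sum.inl x)
    rw [this, map_zero]
  · intro r
    rw [rupA_sum]
    simp only [Sum.elim_inl, Sum.elim_inr]
    have e1 := nf_co hgd hgT
    have e2 := nf_co hhd hhT
    have : Psi F (nf (δ - 1) (δ - 1) (co (δ - 1) (δ - 1) g)) (nf δ (δ - 1) (co δ (δ - 1) h)) = 0 := by
      rw [e1, e2, hPsi]
    show ((Psi F (nf (δ - 1) (δ - 1) (co (δ - 1) (δ - 1) g))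
      (nf δ (δ - 1) (co δ (δ - 1) h))).coeff r.1).coeff r.2 = 0
    rw [this]; simp

theorem natDegree_dT_le {K : Type*} [CommRing K] (P : K[X][X]) : (dT P).natDegree ≤ P.natDegree := by
  rw [natDegree_le_iff_coeff_eq_zero]
  intro i hi
  rw [coeff_dT, coeff_eq_zero_of_natDegree_lt hi, derivative_zero]

theorem dT_C_C_mul {K : Type*} [CommRing K] (c : K) (u : K[X][X]) :
    dT (C (C c) * u) = C (C c) * dT u := by
  rw [Derivation.leibniz, dT_C, derivative_C, map_zero, smul_zero, add_zero, smul_eq_mul]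

theorem rup_not_inj {K : Type*} [Field K] {F : K[X][X]} {δ : ℕ} (hF : F.Monic)
    (hδ : F.natDegree = δ) (hTF : TD δ F) (hirr : ¬ Irreducible F) (hδ0 : 0 < δ)
    (hchar : ∀ r : ℕ, 0 < r → r ≤ δ → (r : K) ≠ 0) :
    ∃ v : RK δ → K, v ≠ 0 ∧ ∀ r, ∑ k, rupA δ F r k * v k = 0 := by
  have hF1 : F ≠ 1 := by rintro rfl; simp at hδ; omega
  have hdm : ∀ u w : K[X][X], dT (u * w) = u * dT w + w * dT u := by
    intro u w; rw [Derivation.leibniz]; rfl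
  by_cases hsq : Squarefree F
  · rw [hF.irreducible_iff_natDegree'] at hirr
    push Not at hirr
    obtain ⟨u, w, hu, hw, huw, hdw⟩ := hirr hF1
    rw [Finset.mem_Ioc] at hdw
    have hsum : u.natDegree + w.natDegree = δ := by rw [← hu.natDegree_mul hw, huw, hδ]
    obtain ⟨a, ha⟩ : ∃ a, u.natDegree = a := ⟨_, rfl⟩
    obtain ⟨b, hb⟩ : ∃ b, w.natDegree = b := ⟨_, rfl⟩
    rw [ha, hb] at hsum
    have hb0 : 0 < b := by omega
    have ha0 : 0 < a := by omega
    obtain ⟨a', b', hTa, hTb, hab⟩ := TD_of_mul hu.ne_zero hw.ne_zero (by rw [huw]; exact hTF)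
    have haa : a ≤ a' := by
      by_contra hlt
      have := hTa a 0 (by omega)
      have h2 : u.coeff a = 1 := by rw [← ha]; exact hu
      rw [h2] at this; simp at this
    have hbb : b ≤ b' := by
      by_contra hlt
      have := hTb b 0 (by omega)
      have h2 : w.coeff b = 1 := by rw [← hb]; exact hw
      rw [h2] at this; simp at this
    obtain rfl : a' = a := by omega
    obtain rfl : b' = b := by omega
    have hTa1 : TD (a' - 1 + 1) u := by rwa [Nat.sub_add_cancel ha0]
    have hTb1 : TD (b' - 1 + 1) w := by rwa [Nat.sub_add_cancel hb0]
    have haK : (a' : K) ≠ 0 := hchar a' ha0 (by omega)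
    have hbK : (b' : K) ≠ 0 := hchar b' hb0 (by omega)
    have hua : u.coeff a' = 1 := by rw [← ha]; exact hu
    have hwb : w.coeff b' = 1 := by rw [← hb]; exact hw
    set g := C (C (b' : K)) * (w * derivative u) - C (C (a' : K)) * (u * derivative w) with hg
    set h := C (C (b' : K)) * (w * dT u) - C (C (a' : K)) * (u * dT w) with hh
    have du1 : (derivative u).natDegree ≤ a' - 1 := by rw [← ha]; exact natDegree_derivative_le u
    have dw1 : (derivative w).natDegree ≤ b' - 1 := by rw [← hb]; exact natDegree_derivative_le w
    have hcst : ∀ m : ℕ, 0 < m → ((m - 1 : ℕ) : K[X]) + 1 = C (m : K) := by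
      intro m hm
      have : ((m - 1 : ℕ) : K[X]) + 1 = ((m - 1 + 1 : ℕ) : K[X]) := by push_cast; rfl
      rw [this, Nat.sub_add_cancel hm]; simp
    apply rup_not_inj_aux (F := F) (g := g) (h := h)
    · rw [hg, hh, Psi, ← huw]
      simp only [map_sub, dT_C, derivative_mul, derivative_C, hdm, dT_derivative, map_zero]
      ring
    · have e1 := (hTb.mul hTa1.derivative).smul (b' : K)
      have e2 := (hTa.mul hTb1.derivative).smul (a' : K)
      exact (e1.mono (by omega)).sub (e2.mono (by omega))
    · have e1 := (hTb.mul hTa1.dT).smul (b' : K)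
      have e2 := (hTa.mul hTb1.dT).smul (a' : K)
      exact (e1.mono (by omega)).sub (e2.mono (by omega))
    · rw [degree_lt_iff_coeff_zero]
      intro m hm
      rcases hm.eq_or_lt with rfl | hm
      · have c1 : (w * derivative u).coeff (δ - 1) = C (a' : K) := by
          have : δ - 1 = b' + (a' - 1) := by omega
          rw [this, coeff_mul_add_eq_of_natDegree_le hb.le du1, hwb, coeff_derivative,
            Nat.sub_add_cancel ha0, hua, hcst a' ha0, one_mul, one_mul]
        have c2 : (u * derivative w).coeff (δ - 1) = C (b' : K) := by
          have : δ - 1 = a' + (b' - 1) := by omega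
          rw [this, coeff_mul_add_eq_of_natDegree_le ha.le dw1, hua, coeff_derivative,
            Nat.sub_add_cancel hb0, hwb, hcst b' hb0, one_mul, one_mul]
        rw [hg, coeff_sub, coeff_C_mul, coeff_C_mul, c1, c2]
        ring
      · apply coeff_eq_zero_of_natDegree_lt
        refine lt_of_le_of_lt ?_ hm
        rw [hg]
        refine (natDegree_sub_le _ _).trans (max_le ?_ ?_)
        · refine (natDegree_C_mul_le _ _).trans (natDegree_mul_le.trans ?_); omega
        · refine (natDegree_C_mul_le _ _).trans (natDegree_mul_le.trans ?_); omega
    · -- the X-degree of h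
      rw [degree_lt_iff_coeff_zero]
      have hz : ∀ (q : K[X][X]) (n : ℕ), q.Monic → q.natDegree = n → 0 < n →
          (dT q).natDegree ≤ n - 1 := by
        intro q n hq hn hn0
        rw [natDegree_le_iff_coeff_eq_zero]
        intro i hi
        rw [coeff_dT]
        rcases (show n ≤ i by omega).eq_or_lt with h | h
        · have : q.coeff i = 1 := by rw [← h, ← hn]; exact hq
          rw [this, derivative_one]
        · rw [coeff_eq_zero_of_natDegree_lt (by omega), derivative_zero]
      have z1 := hz u a' hu ha ha0
      have z2 := hz w b' hw hb hb0
      intro m hm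
      apply coeff_eq_zero_of_natDegree_lt
      refine lt_of_lt_of_le ?_ hm
      have : h.natDegree ≤ δ - 1 := by
        rw [hh]
        refine (natDegree_sub_le _ _).trans (max_le ?_ ?_)
        · refine (natDegree_C_mul_le _ _).trans (natDegree_mul_le.trans ?_); omega
        · refine (natDegree_C_mul_le _ _).trans (natDegree_mul_le.trans ?_); omega
      omega
    · intro hg0
      rw [← huw, squarefree_mul_iff] at hsq
      have hd : u ∣ w * derivative u := by
        have : C (C (b' : K)) * (w * derivative u) = u * (C (C (a' : K)) * derivative w) := by
          rw [hg] at hg0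
          linear_combination hg0
        have h2 : w * derivative u = u * (C (C (b' : K)⁻¹) * (C (C (a' : K)) * derivative w)) := by
          have h3 : C (C (b' : K)⁻¹) * C (C (b' : K)) = (1 : K[X][X]) := by
            rw [← C_mul, ← C_mul, inv_mul_cancel₀ hbK]; simp
          linear_combination C (C (b' : K)⁻¹) * this - (w * derivative u) * h3
        exact ⟨_, h2⟩
      have hd2 : u ∣ derivative u := hsq.1.dvd_of_dvd_mul_left hd
      exact not_dvd_derivative hu ha haK hd2
  · rw [Squarefree] at hsq
    push Not at hsq
    obtain ⟨x, ⟨v, hxv⟩, hx⟩ := hsq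
    have hx0 : x ≠ 0 := by rintro rfl; rw [zero_mul, zero_mul] at hxv; exact hF.ne_zero hxv
    have hv0 : v ≠ 0 := by rintro rfl; rw [mul_zero] at hxv; exact hF.ne_zero hxv
    have hlc : IsUnit x.leadingCoeff := by
      have : x.leadingCoeff * x.leadingCoeff * v.leadingCoeff = 1 := by
        rw [← leadingCoeff_mul, ← leadingCoeff_mul, ← hxv]; exact hF
      exact IsUnit.of_mul_eq_one (x.leadingCoeff * v.leadingCoeff) (by rw [← this]; ring)
    have hxd : 0 < x.natDegree := by
      by_contra h0
      have h1 := eq_C_of_natDegree_eq_zero (p := x) (by omega)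
      apply hx
      rw [h1]
      have : x.leadingCoeff = x.coeff 0 := by rw [leadingCoeff]; congr 1; omega
      rw [this] at hlc
      exact isUnit_C.2 hlc
    have hdeg : x.natDegree + x.natDegree + v.natDegree = δ := by
      rw [← hδ, hxv, natDegree_mul (mul_ne_zero hx0 hx0) hv0, natDegree_mul hx0 hx0]
    obtain ⟨a, b, hTa, hTb, hab⟩ := TD_of_mul hx0 (mul_ne_zero hx0 hv0)
      (by rw [← mul_assoc, ← hxv]; exact hTF)
    obtain ⟨a2, b2, hTa2, hTb2, hab2⟩ := TD_of_mul hx0 hv0 hTb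
    have hxa : ∀ a, TD a x → x.natDegree ≤ a := by
      intro a hTa
      by_contra hlt
      have hc : x.leadingCoeff = 0 := by
        ext j
        rw [leadingCoeff, hTa _ j (by omega)]; simp
      rw [hc] at hlc
      exact not_isUnit_zero hlc
    have ha1 := hxa a hTa
    have ha2 := hxa a2 hTa2
    have hTa1 : TD (a - 1 + 1) x := by rwa [Nat.sub_add_cancel (by omega)]
    apply rup_not_inj_aux (F := F) (g := v * derivative x) (h := v * dT x)
    · rw [Psi, hxv]
      simp only [derivative_mul, hdm, dT_derivative]
      ring
    · exact (hTb2.mul hTa1.derivative).mono (by omega)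
    · exact (hTb2.mul hTa1.dT).mono (by omega)
    · rw [degree_lt_iff_coeff_zero]
      intro m hm
      apply coeff_eq_zero_of_natDegree_lt
      refine lt_of_lt_of_le ?_ hm
      have := natDegree_mul_le (p := v) (q := derivative x)
      have := natDegree_derivative_le x
      omega
    · rw [degree_lt_iff_coeff_zero]
      intro m hm
      apply coeff_eq_zero_of_natDegree_lt
      refine lt_of_lt_of_le ?_ hm
      have := natDegree_mul_le (p := v) (q := dT x)
      have := natDegree_dT_le x
      omega
    · apply mul_ne_zero hv0
      intro h0
      have := congrArg (fun P => P.coeff (x.natDegree - 1)) h0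
      simp only [coeff_derivative, coeff_zero] at this
      rw [Nat.sub_add_cancel hxd] at this
      have h3 : ((x.natDegree - 1 : ℕ) : K[X]) + 1 = C (x.natDegree : K) := by
        have : ((x.natDegree - 1 : ℕ) : K[X]) + 1 = ((x.natDegree - 1 + 1 : ℕ) : K[X]) := by
          push_cast; rfl
        rw [this, Nat.sub_add_cancel hxd]; simp
      rw [h3] at this
      rcases mul_eq_zero.1 this with h | h
      · exact hx0 (leadingCoeff_eq_zero.1 h)
      · exact hchar _ hxd (by omega) (C_eq_zero.1 h)

/-- nonvanishing of a Ruppert minor implies irreducibility -/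
theorem irreducible_of_minor {K : Type*} [Field K] {F : K[X][X]} {δ : ℕ} (hF : F.Monic)
    (hδ : F.natDegree = δ) (hTF : TD δ F) (hδ0 : 0 < δ)
    (hchar : ∀ r : ℕ, 0 < r → r ≤ δ → (r : K) ≠ 0) (e : RK δ → ℕ × ℕ)
    (he : (Matrix.of (fun a b => rupA δ F (e a) b)).det ≠ 0) : Irreducible F := by
  by_contra hirr
  obtain ⟨v, hv0, hv⟩ := rup_not_inj hF hδ hTF hirr hδ0 hchar
  apply hv0
  have hmv : (Matrix.of (fun a b => rupA δ F (e a) b)).mulVec v = 0 := by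
    funext a
    exact hv (e a)
  exact Matrix.eq_zero_of_mulVec_eq_zero he hmv

end EV

namespace EV

open Polynomial

section
variable {R S S' σ : Type*} [CommRing R] [CommRing S] [CommRing S']

noncomputable def linf (a v z : S) : S[X][X] := C (C a) + C (C v) * X + C (C z * X)

/-- restriction of `f` to the plane `a + X v + T z` -/
noncomputable def slice (ψ : R →+* S) (a v z : σ → S) : MvPolynomial σ R →+* S[X][X] :=
  MvPolynomial.eval₂Hom (((C : S[X] →+* S[X][X]).comp (C : S →+* S[X])).comp ψ)
    (fun i => linf (a i) (v i) (z i))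

theorem TD_linf (a v z : S) : TD 1 (linf a v z) := by
  rw [linf, C_mul]
  exact (((TD.C_C a).mono zero_le_one).add (TD.X'.smul v)).add (TD.C_X.smul z)

theorem natDegree_linf (a v z : S) : (linf a v z).natDegree ≤ 1 := by
  rw [linf]
  compute_degree

theorem coeff_linf (a v z : S) : (linf a v z).coeff 1 = C v := by
  rw [linf]
  simp [coeff_C]

theorem linf_map (φ : S →+* S') (a v z : S) :
    (linf a v z).map (mapRingHom φ) = linf (φ a) (φ v) (φ z) := by
  simp [linf]

theorem slice_map (ψ : R →+* S) (φ : S →+* S') (a v z : σ → S) (f : MvPolynomial σ R) :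
    (slice ψ a v z f).map (mapRingHom φ) =
      slice (φ.comp ψ) (fun i => φ (a i)) (fun i => φ (v i)) (fun i => φ (z i)) f := by
  have : (Polynomial.mapRingHom (mapRingHom φ)).comp (slice ψ a v z) =
      slice (φ.comp ψ) (fun i => φ (a i)) (fun i => φ (v i)) (fun i => φ (z i)) := by
    apply MvPolynomial.ringHom_ext
    · intro r; simp [slice]
    · intro i; simp [slice, linf_map]
  exact congrArg (fun g => g f) this

theorem slice_map_left {R' : Type*} [CommRing R'] (ψ : R →+* S) (θ : R' →+* R) (a v z : σ → S)
    (f : MvPolynomial σ R') :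
    slice ψ a v z (MvPolynomial.map θ f) = slice (ψ.comp θ) a v z f := by
  simp only [slice, MvPolynomial.coe_eval₂Hom, MvPolynomial.eval₂_map]
  rfl

theorem evalEval_slice (ψ : R →+* S) (a v z : σ → S) (f : MvPolynomial σ R) (T0 x0 : S) :
    evalEval T0 x0 (slice ψ a v z f) =
      MvPolynomial.eval₂ ψ (fun i => a i + v i * x0 + z i * T0) f := by
  have : (evalEvalRingHom T0 x0).comp (slice ψ a v z) =
      MvPolynomial.eval₂Hom ψ (fun i => a i + v i * x0 + z i * T0) := by
    apply MvPolynomial.ringHom_ext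
    · intro r; simp [slice]
    · intro i; simp [slice, linf]
  exact congrArg (fun g => g f) this

variable [Fintype σ]

theorem degree_le_totalDegree {f : MvPolynomial σ R} {m : σ →₀ ℕ} (hm : m ∈ f.support) :
    m.degree ≤ f.totalDegree := MvPolynomial.le_totalDegree hm

theorem TD_prod {ι : Type*} (s : Finset ι) (m : ι → ℕ) (P : ι → S[X][X])
    (h : ∀ i ∈ s, TD (m i) (P i)) : TD (∑ i ∈ s, m i) (∏ i ∈ s, P i) := by
  classical
  induction s using Finset.induction_on with
  | empty => simpa using TD.one
  | insert i s hi ih =>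
    rw [Finset.prod_insert hi, Finset.sum_insert hi]
    exact (h i (Finset.mem_insert_self _ _)).mul (ih fun j hj => h j (Finset.mem_insert_of_mem hj))

theorem TD_slice_mon (a v z : σ → S) (m : σ →₀ ℕ) :
    TD m.degree (∏ i, linf (a i) (v i) (z i) ^ m i) := by
  rw [Finsupp.degree_eq_sum]
  apply TD_prod
  intro i _
  simpa using (TD_linf (a i) (v i) (z i)).pow (m i)

theorem coeff_slice_mon (a v z : σ → S) (m : σ →₀ ℕ) :
    (∏ i, linf (a i) (v i) (z i) ^ m i).coeff m.degree = C (∏ i, v i ^ m i) := by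
  classical
  rw [Finsupp.degree_eq_sum]
  have : ∀ s : Finset σ, (∏ i ∈ s, linf (a i) (v i) (z i) ^ m i).natDegree ≤ ∑ i ∈ s, m i ∧
      (∏ i ∈ s, linf (a i) (v i) (z i) ^ m i).coeff (∑ i ∈ s, m i) = C (∏ i ∈ s, v i ^ m i) := by
    intro s
    induction s using Finset.induction_on with
    | empty => simp
    | insert i s hi ih =>
      rw [Finset.prod_insert hi, Finset.sum_insert hi, Finset.prod_insert hi]
      have h1 : (linf (a i) (v i) (z i) ^ m i).natDegree ≤ m i := by
        refine natDegree_pow_le.trans ?_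
        have := natDegree_linf (a i) (v i) (z i)
        nlinarith
      refine ⟨natDegree_mul_le.trans (add_le_add h1 ih.1), ?_⟩
      rw [coeff_mul_add_eq_of_natDegree_le h1 ih.1, ih.2]
      have := coeff_pow_of_natDegree_le (natDegree_linf (a i) (v i) (z i)) (m := m i)
      rw [mul_one] at this
      rw [this, coeff_linf]
      simp
  exact (this Finset.univ).2

theorem slice_eq_sum (ψ : R →+* S) (a v z : σ → S) (f : MvPolynomial σ R) :
    slice ψ a v z f = ∑ m ∈ f.support, C (C (ψ (f.coeff m))) * ∏ i, linf (a i) (v i) (z i) ^ m i := by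
  rw [slice, MvPolynomial.coe_eval₂Hom, MvPolynomial.eval₂_eq']
  rfl

theorem TD_slice (ψ : R →+* S) (a v z : σ → S) (f : MvPolynomial σ R) {δ : ℕ}
    (hf : f.totalDegree ≤ δ) : TD δ (slice ψ a v z f) := by
  rw [slice_eq_sum]
  apply TD.sum
  intro m hm
  apply TD.smul
  refine (TD_slice_mon a v z m).mono ((degree_le_totalDegree hm).trans hf)

theorem coeff_slice (ψ : R →+* S) (a v z : σ → S) (f : MvPolynomial σ R) {δ : ℕ}
    (hf : f.totalDegree ≤ δ) : (slice ψ a v z f).coeff δ =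
      C (MvPolynomial.eval₂ ψ v (MvPolynomial.homogeneousComponent δ f)) := by
  classical
  rw [slice_eq_sum, MvPolynomial.homogeneousComponent_apply, finsetSum_coeff,
    MvPolynomial.eval₂_sum, map_sum, Finset.sum_filter]
  apply Finset.sum_congr rfl
  intro m hm
  rw [coeff_C_mul]
  split_ifs with h
  · rw [← h, coeff_slice_mon, MvPolynomial.eval₂_monomial, ← C_mul, Finsupp.prod_fintype]
    intro i; simp
  · have h1 : m.degree ≤ δ := by
      exact (degree_le_totalDegree hm).trans hf
    have : (∏ i, linf (a i) (v i) (z i) ^ m i).coeff δ = 0 := by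
      ext j
      rw [TD_slice_mon a v z m δ j (by omega)]; simp
    rw [this, mul_zero]

theorem TD.natDegree_le {D : ℕ} {P : S[X][X]} (h : TD D P) : P.natDegree ≤ D := by
  rw [natDegree_le_iff_coeff_eq_zero]
  intro i hi
  ext j
  rw [h i j (by omega)]; simp

theorem slice_monic [Nontrivial S] (ψ : R →+* S) (a v z : σ → S) (f : MvPolynomial σ R) {δ : ℕ}
    (hf : f.totalDegree ≤ δ)
    (h1 : MvPolynomial.eval₂ ψ v (MvPolynomial.homogeneousComponent δ f) = 1) :
    (slice ψ a v z f).Monic ∧ (slice ψ a v z f).natDegree = δ := by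
  have h2 := coeff_slice ψ a v z f hf
  rw [h1, C_1] at h2
  have h3 := (TD_slice ψ a v z f hf).natDegree_le
  refine ⟨monic_of_natDegree_le_of_coeff_eq_one δ h3 h2, ?_⟩
  exact natDegree_eq_of_le_of_coeff_ne_zero h3 (by rw [h2]; exact one_ne_zero)

/-- the directional derivative -/
noncomputable def dirD (v : σ → R) (f : MvPolynomial σ R) : MvPolynomial σ R :=
  ∑ i, MvPolynomial.C (v i) * MvPolynomial.pderiv i f

theorem derivative_slice (a v z : σ → R) (f : MvPolynomial σ R) :
    derivative (slice (RingHom.id R) a v z f) = slice (RingHom.id R) a v z (dirD v f) := by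
  classical
  have hC : ∀ r : R, slice (RingHom.id R) a v z (MvPolynomial.C r) = C (C r) := by
    intro r; simp [slice]
  have hX : ∀ i, slice (RingHom.id R) a v z (MvPolynomial.X i) = linf (a i) (v i) (z i) := by
    intro r; simp [slice]
  have hl : ∀ i, derivative (linf (a i) (v i) (z i)) = C (C (v i)) := by
    intro i; simp [linf]
  induction f using MvPolynomial.induction_on with
  | C r => rw [hC]; simp [dirD]
  | add p q hp hq =>
    rw [map_add, derivative_add, hp, hq, ← map_add]
    congr 1
    simp [dirD, mul_add, Finset.sum_add_distrib]
  | mul_X p i hp =>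
    have : dirD v (p * MvPolynomial.X i) =
        dirD v p * MvPolynomial.X i + p * MvPolynomial.C (v i) := by
      simp only [dirD, Derivation.leibniz, smul_eq_mul, mul_add, Finset.sum_add_distrib,
        MvPolynomial.pderiv_X]
      rw [add_comm]
      congr 1
      · rw [Finset.sum_mul]
        apply Finset.sum_congr rfl
        intro j _; ring
      · simp [Pi.single_apply]; ring
    rw [this, RingHom.map_add, RingHom.map_mul, RingHom.map_mul, RingHom.map_mul, derivative_mul,
      hp, hX, hl, hC]

end

end EV

namespace EV

open Polynomial

theorem totalDegree_dirD {R σ : Type*} [CommRing R] [Fintype σ] (v : σ → R) (f : MvPolynomial σ R) :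
    (dirD v f).totalDegree ≤ f.totalDegree - 1 := by
  classical
  refine MvPolynomial.totalDegree_finsetSum_le (fun i _ => ?_)
  refine (MvPolynomial.totalDegree_mul _ _).trans ?_
  rw [MvPolynomial.totalDegree_C, zero_add]
  conv_lhs => rw [f.as_sum, map_sum]
  refine MvPolynomial.totalDegree_finsetSum_le (fun s hs => ?_)
  rw [MvPolynomial.pderiv_monomial]
  by_cases h : s i = 0
  · simp [h]
  · refine (MvPolynomial.totalDegree_monomial_le _ _).trans ?_
    have h1 := degree_le_totalDegree hs
    have h2 : Finsupp.single i 1 ≤ s := by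
      rw [Finsupp.single_le_iff]; omega
    have h3 : (s - Finsupp.single i 1).degree + 1 = s.degree := by
      conv_rhs => rw [← tsub_add_cancel_of_le h2]
      rw [map_add, Finsupp.degree_single]
    change (s - Finsupp.single i 1).degree ≤ _
    omega

section
variable {k σ : Type*} [Field k] [Fintype σ] {f : MvPolynomial σ k} {δ : ℕ}

theorem dirD_ne_zero (hf : f.totalDegree = δ) (hδ0 : 0 < δ) (hδk : (δ : k) ≠ 0) (v : σ → k)
    (hv : MvPolynomial.eval v (MvPolynomial.homogeneousComponent δ f) = 1) : dirD v f ≠ 0 := by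
  intro h0
  have h1 := derivative_slice (fun _ => 0) v (fun _ => 0) f
  rw [h0, map_zero] at h1
  have h2 := congrArg (fun P => P.coeff (δ - 1)) h1
  simp only [coeff_derivative, coeff_zero] at h2
  rw [Nat.sub_add_cancel hδ0, coeff_slice _ _ _ _ _ hf.le] at h2
  have h3 : ((δ - 1 : ℕ) : k[X]) + 1 = C (δ : k) := by
    have : ((δ - 1 : ℕ) : k[X]) + 1 = ((δ - 1 + 1 : ℕ) : k[X]) := by push_cast; rfl
    rw [this, Nat.sub_add_cancel hδ0]; simp
  have h4 : MvPolynomial.eval₂ (RingHom.id k) v (MvPolynomial.homogeneousComponent δ f) = 1 := hv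
  rw [h3, h4, C_1, one_mul] at h2
  exact hδk (C_eq_zero.1 h2)

theorem exists_smooth [IsAlgClosed k] (hf : f.totalDegree = δ) (hirr : Irreducible f) (hδ0 : 0 < δ)
    (hδk : (δ : k) ≠ 0) (v : σ → k)
    (hv : MvPolynomial.eval v (MvPolynomial.homogeneousComponent δ f) = 1) :
    ∃ a, MvPolynomial.eval a f = 0 ∧ MvPolynomial.eval a (dirD v f) ≠ 0 := by
  by_contra hcon
  push Not at hcon
  have hprime : (Ideal.span {f}).IsPrime := by
    rw [Ideal.span_singleton_prime hirr.ne_zero]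
    exact hirr.prime
  have h1 : dirD v f ∈ Ideal.span {f} := by
    rw [← MvPolynomial.IsPrime.vanishingIdeal_zeroLocus (K := k) (Ideal.span {f}),
      MvPolynomial.mem_vanishingIdeal_iff]
    intro x hx
    rw [MvPolynomial.mem_zeroLocus_iff] at hx
    have h2 := hx f (Ideal.mem_span_singleton_self f)
    rw [MvPolynomial.aeval_eq_eval] at h2 ⊢
    exact hcon x h2
  rw [Ideal.mem_span_singleton] at h1
  have h2 := MvPolynomial.totalDegree_le_of_dvd_of_isDomain h1 (dirD_ne_zero hf hδ0 hδk v hv)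
  have h3 := totalDegree_dirD v f
  omega

/-- the shift automorphism `z ↦ z + s (a + X v)` -/
noncomputable def shf (a v : σ → k) (s : k) : (MvPolynomial σ k)[X] →+* (MvPolynomial σ k)[X] :=
  eval₂RingHom (MvPolynomial.eval₂Hom ((C : MvPolynomial σ k →+* (MvPolynomial σ k)[X]).comp MvPolynomial.C)
    (fun i => C (MvPolynomial.X i) + C (MvPolynomial.C s) *
      (C (MvPolynomial.C (a i)) + C (MvPolynomial.C (v i)) * X))) X

theorem shf_comp (a v : σ → k) (s : k) (P : (MvPolynomial σ k)[X]) :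
    shf a v s (shf a v (-s) P) = P := by
  have : (shf a v s).comp (shf a v (-s)) = RingHom.id _ := by
    ext1
    · apply MvPolynomial.ringHom_ext
      · intro r; simp [shf]
      · intro i; simp [shf]; ring
    · simp [shf]
  exact congrArg (fun g => g P) this

/-- the shift as an equivalence -/
noncomputable def shfE (a v : σ → k) : (MvPolynomial σ k)[X] ≃+* (MvPolynomial σ k)[X] :=
  RingEquiv.ofRingHom (shf a v 1) (shf a v (-1)) (RingHom.ext fun P => shf_comp a v 1 P)
    (RingHom.ext fun P => by
      have := shf_comp a v (-1) P
      rw [neg_neg] at this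
      exact this)

/-- the generic slice -/
theorem slice_irreducible (hf : f.totalDegree = δ) (hirr : Irreducible f) (a v : σ → k)
    (hv : MvPolynomial.eval v (MvPolynomial.homogeneousComponent δ f) = 1) :
    Irreducible ((slice (MvPolynomial.C) (fun i => MvPolynomial.C (a i)) (fun i => MvPolynomial.C (v i))
      (fun i => MvPolynomial.X i) f).map (mapRingHom (algebraMap (MvPolynomial σ k)
        (FractionRing (MvPolynomial σ k))))) := by
  set F0 : (MvPolynomial σ k)[X][X] := slice (MvPolynomial.C) (fun i => MvPolynomial.C (a i)) (fun i => MvPolynomial.C (v i))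
      (fun i => MvPolynomial.X i) f with hF0
  have hm : F0.Monic := by
    refine (slice_monic _ _ _ _ f hf.le ?_).1
    have h := (MvPolynomial.eval₂_comp_left (MvPolynomial.C : k →+* MvPolynomial σ k) (RingHom.id k) v
      (MvPolynomial.homogeneousComponent δ f))
    have h' : MvPolynomial.eval₂ (RingHom.id k) v (MvPolynomial.homogeneousComponent δ f) = 1 := hv
    rw [h', map_one, RingHom.comp_id] at h
    exact h.symm
  have h1 : Irreducible (F0.map (evalRingHom (1 : MvPolynomial σ k))) := by
    have e : F0.map (evalRingHom (1 : MvPolynomial σ k)) = shfE a v (C f) := by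
      have : (mapRingHom (evalRingHom (1 : MvPolynomial σ k))).comp (slice (MvPolynomial.C) (fun i => MvPolynomial.C (a i)) (fun i => MvPolynomial.C (v i))
        (fun i => MvPolynomial.X i)) = ((shf a v 1).comp C) := by
        apply MvPolynomial.ringHom_ext
        · intro r; simp [shf, slice]
        · intro i; simp [shf, slice, linf]; ring
      exact congrArg (fun g => g f) this
    rw [e, MulEquiv.irreducible_iff]
    exact (prime_C_iff.2 hirr.prime).irreducible
  have h2 : Irreducible F0 := hm.irreducible_of_irreducible_map _ _ h1
  have h3 : Irreducible (F0.map (algebraMap (MvPolynomial σ k)[X] (FractionRing (MvPolynomial σ k)[X]))) :=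
    (hm.irreducible_iff_irreducible_map_fraction_map).1 h2
  have hinj : Function.Injective ((algebraMap (MvPolynomial σ k)[X] (FractionRing (MvPolynomial σ k)[X])).comp C) :=
    (IsFractionRing.injective (MvPolynomial σ k)[X] (FractionRing (MvPolynomial σ k)[X])).comp C_injective
  obtain ⟨θ, hθ⟩ : ∃ θ : FractionRing (MvPolynomial σ k) →+* FractionRing (MvPolynomial σ k)[X],
      ∀ r, θ (algebraMap _ _ r) =
        ((algebraMap (MvPolynomial σ k)[X] (FractionRing (MvPolynomial σ k)[X])).comp C) r :=
    ⟨IsFractionRing.lift hinj, fun r => IsFractionRing.lift_algebraMap hinj r⟩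
  have h4 : (eval₂RingHom θ (algebraMap (MvPolynomial σ k)[X] (FractionRing (MvPolynomial σ k)[X]) X)).comp
      (mapRingHom (algebraMap (MvPolynomial σ k) (FractionRing (MvPolynomial σ k)))) =
      algebraMap (MvPolynomial σ k)[X] (FractionRing (MvPolynomial σ k)[X]) := by
    apply Polynomial.ringHom_ext
    · intro r
      rw [RingHom.comp_apply, coe_mapRingHom, map_C, coe_eval₂RingHom, eval₂_C, hθ]
      rfl
    · rw [RingHom.comp_apply, coe_mapRingHom, map_X, coe_eval₂RingHom, eval₂_X]
  rw [← h4, ← Polynomial.map_map] at h3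
  exact (hm.map _).irreducible_of_irreducible_map _ _ h3

end

end EV

namespace EV

open Polynomial

section
variable {R S σ : Type*} [CommRing R] [CommRing S]

theorem dirD_map [Fintype σ] (φ : R →+* S) (v : σ → R) (f : MvPolynomial σ R) :
    dirD (fun i => φ (v i)) (MvPolynomial.map φ f) = MvPolynomial.map φ (dirD v f) := by
  simp [dirD, MvPolynomial.pderiv_map]

theorem hcomp_map (φ : R →+* S) (δ : ℕ) (f : MvPolynomial σ R) :
    MvPolynomial.homogeneousComponent δ (MvPolynomial.map φ f) =
      MvPolynomial.map φ (MvPolynomial.homogeneousComponent δ f) := by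
  classical
  ext m
  simp only [MvPolynomial.coeff_homogeneousComponent, MvPolynomial.coeff_map]
  split_ifs <;> simp

theorem rupA_smul (δ : ℕ) (c : R) (F : R[X][X]) (r : ℕ × ℕ) (k : RK δ) :
    rupA δ (C (C c) * F) r k = c * rupA δ F r k := by
  have h1 : ∀ c : R, ∀ u : R[X][X], dT (C (C c) * u) = C (C c) * dT u := by
    intro c u
    rw [Derivation.leibniz, dT_C, derivative_C, map_zero, smul_zero, add_zero, smul_eq_mul]
  have h2 : ∀ c : R, ∀ u : R[X][X], derivative (C (C c) * u) = C (C c) * derivative u := by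
    intro c u
    rw [derivative_C_mul]
  have : ∀ g h : R[X][X], Psi (C (C c) * F) g h = C (C c) * Psi F g h := by
    intro g h
    rw [Psi, Psi, h1, h2]; ring
  rw [rupA, rupA, this, coeff_C_mul, coeff_C_mul]

/-- the generic minor, as a polynomial in `(a, z)` -/
noncomputable def GP (δ : ℕ) (v : σ → R) (f : MvPolynomial σ R) (e : RK δ → ℕ × ℕ) :
    MvPolynomial (σ ⊕ σ) R :=
  (Matrix.of (fun x y => rupA δ (slice MvPolynomial.C (fun i => MvPolynomial.X (Sum.inl i))
    (fun i => MvPolynomial.C (v i)) (fun i => MvPolynomial.X (Sum.inr i)) f) (e x) y)).det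

theorem det_rupA_map {δ : ℕ} (φ : R →+* S) (F : R[X][X]) (e : RK δ → ℕ × ℕ) :
    φ (Matrix.of (fun x y => rupA δ F (e x) y)).det =
      (Matrix.of (fun x y => rupA δ (F.map (mapRingHom φ)) (e x) y)).det := by
  rw [RingHom.map_det]
  congr 1
  ext x y
  simp [rupA_map]

theorem det_rupA_smul {δ : ℕ} (c : R) (F : R[X][X]) (e : RK δ → ℕ × ℕ) :
    (Matrix.of (fun x y => rupA δ (C (C c) * F) (e x) y)).det =
      c ^ Fintype.card (RK δ) * (Matrix.of (fun x y => rupA δ F (e x) y)).det := by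
  rw [← Matrix.det_smul]
  congr 1
  ext x y
  simp [rupA_smul]

theorem GP_map (φ : R →+* S) (δ : ℕ) (v : σ → R) (f : MvPolynomial σ R) (e : RK δ → ℕ × ℕ) :
    MvPolynomial.map φ (GP δ v f e) = GP δ (fun i => φ (v i)) (MvPolynomial.map φ f) e := by
  rw [GP, det_rupA_map, GP, slice_map, slice_map_left]
  have e1 : (MvPolynomial.map φ).comp (MvPolynomial.C : R →+* MvPolynomial (σ ⊕ σ) R) =
      (MvPolynomial.C : S →+* MvPolynomial (σ ⊕ σ) S).comp φ := by
    ext1 r; simp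
  rw [e1]
  simp only [MvPolynomial.map_X, MvPolynomial.map_C]

theorem GP_eval (δ : ℕ) (v : σ → R) (f : MvPolynomial σ R) (e : RK δ → ℕ × ℕ) (a z : σ → R) :
    MvPolynomial.eval (Sum.elim a z) (GP δ v f e) =
      (Matrix.of (fun x y => rupA δ (slice (RingHom.id R) a v z f) (e x) y)).det := by
  rw [GP, det_rupA_map, slice_map]
  have e1 : (MvPolynomial.eval (Sum.elim a z)).comp (MvPolynomial.C : R →+* MvPolynomial (σ ⊕ σ) R) =
      RingHom.id R := by
    ext1 r; simp
  rw [e1]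
  simp only [MvPolynomial.eval_X, MvPolynomial.eval_C, Sum.elim_inl, Sum.elim_inr]

theorem GP_smul (δ : ℕ) (c : R) (v : σ → R) (f : MvPolynomial σ R) (e : RK δ → ℕ × ℕ) :
    GP δ v (MvPolynomial.C c * f) e = MvPolynomial.C c ^ Fintype.card (RK δ) * GP δ v f e := by
  rw [GP, GP, ← det_rupA_smul, map_mul]
  have e1 : (slice (MvPolynomial.C : R →+* MvPolynomial (σ ⊕ σ) R) (fun i => MvPolynomial.X (Sum.inl i))
    (fun i => MvPolynomial.C (v i)) (fun i => MvPolynomial.X (Sum.inr i))) (MvPolynomial.C c) =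
      C (C (MvPolynomial.C c)) := by
    simp [slice]
  rw [e1]

end

theorem bertini {k σ : Type*} [Field k] [IsAlgClosed k] [Fintype σ] {f : MvPolynomial σ k} {δ : ℕ}
    (hf : f.totalDegree = δ) (hirr : Irreducible f) (hδ0 : 0 < δ)
    (hchar : ∀ r : ℕ, 0 < r → r ≤ δ ^ 2 → (r : k) ≠ 0) (v : σ → k)
    (hv : MvPolynomial.eval v (MvPolynomial.homogeneousComponent δ f) ≠ 0) :
    ∃ e, GP δ v f e ≠ 0 := by
  classical
  set c := (MvPolynomial.eval v (MvPolynomial.homogeneousComponent δ f))⁻¹ with hc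
  have hc0 : c ≠ 0 := inv_ne_zero hv
  suffices h : ∃ e, GP δ v (MvPolynomial.C c * f) e ≠ 0 by
    obtain ⟨e, he⟩ := h
    refine ⟨e, fun h0 => he ?_⟩
    rw [GP_smul, h0, mul_zero]
  have hcu : IsUnit (MvPolynomial.C c : MvPolynomial σ k) := (Ne.isUnit hc0).map MvPolynomial.C
  have hirr' : Irreducible (MvPolynomial.C c * f) := (irreducible_isUnit_mul hcu).2 hirr
  have hf' : (MvPolynomial.C c * f).totalDegree = δ := by
    rw [MvPolynomial.totalDegree_mul_of_isDomain hcu.ne_zero hirr.ne_zero, MvPolynomial.totalDegree_C, hf,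
      zero_add]
  have hv' : MvPolynomial.eval v (MvPolynomial.homogeneousComponent δ (MvPolynomial.C c * f)) = 1 := by
    rw [MvPolynomial.homogeneousComponent_C_mul, map_mul, MvPolynomial.eval_C, hc]
    exact inv_mul_cancel₀ hv
  generalize MvPolynomial.C c * f = f' at hirr' hf' hv'
  have hδk : (δ : k) ≠ 0 := hchar δ hδ0 (Nat.le_self_pow (by norm_num) _)
  obtain ⟨a, ha0, ha1⟩ := exists_smooth hf' hirr' hδ0 hδk v hv'
  have hI := slice_irreducible hf' hirr' a v hv'
  set ι := algebraMap (MvPolynomial σ k) (FractionRing (MvPolynomial σ k)) with hι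
  have hιinj : Function.Injective ι := IsFractionRing.injective _ _
  set F0 := slice (MvPolynomial.C) (fun i => MvPolynomial.C (a i)) (fun i => MvPolynomial.C (v i))
      (fun i => MvPolynomial.X i) f' with hF0
  set ψ : k →+* FractionRing (MvPolynomial σ k) := ι.comp MvPolynomial.C with hψ
  have hψinj : Function.Injective ψ := hιinj.comp (MvPolynomial.C_injective _ _)
  have hFψ : F0.map (mapRingHom ι) = slice (RingHom.id _) (fun i => ψ (a i)) (fun i => ψ (v i))
      (fun i => ι (MvPolynomial.X i)) (MvPolynomial.map ψ f') := by
    rw [hF0, slice_map, slice_map_left]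
    rfl
  have hvψ : ∀ (w : σ → k) (P : MvPolynomial σ k), MvPolynomial.eval (fun i => ψ (w i)) (MvPolynomial.map ψ P) =
      ψ (MvPolynomial.eval w P) := fun w P => eval_map_comp ψ w P
  have htd : (MvPolynomial.map ψ f').totalDegree ≤ δ := by
    rw [totalDegree_map_inj ψ hψinj, hf']
  have hmon := slice_monic (RingHom.id _) (fun i => ψ (a i)) (fun i => ψ (v i))
    (fun i => ι (MvPolynomial.X i)) (MvPolynomial.map ψ f') htd (by
      rw [hcomp_map]
      refine (hvψ v _).trans ?_
      rw [hv', map_one])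
  have hTD := TD_slice (RingHom.id _) (fun i => ψ (a i)) (fun i => ψ (v i))
    (fun i => ι (MvPolynomial.X i)) (MvPolynomial.map ψ f') htd
  have hchar' : ∀ r : ℕ, 0 < r → r ≤ δ ^ 2 → (r : FractionRing (MvPolynomial σ k)) ≠ 0 := by
    intro r h1 h2 h3
    apply hchar r h1 h2
    apply hψinj
    rw [map_natCast, map_zero, h3]
  have hinj := rup_inj (F := F0.map (mapRingHom ι)) (T0 := 0) (x0 := 0) (δ := δ) (by rw [hFψ]; exact hmon.1)
    (by rw [hFψ]; exact hmon.2) (by rw [hFψ]; exact hTD) hI hδ0 hchar' (by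
      rw [hFψ, evalEval_slice]
      simp only [mul_zero, add_zero]
      refine (hvψ a f').trans ?_
      rw [ha0, map_zero]) (by
      rw [hFψ, derivative_slice, dirD_map, evalEval_slice]
      simp only [mul_zero, add_zero]
      intro h
      have h' := (hvψ a (dirD v f')).symm.trans h
      apply ha1
      apply hψinj
      rw [h', map_zero])
  obtain ⟨e, he⟩ := exists_minor _ hinj
  refine ⟨e, fun h0 => he ?_⟩
  have h1 := congrArg (MvPolynomial.eval₂Hom (MvPolynomial.C : k →+* MvPolynomial σ k)
    (Sum.elim (fun i => MvPolynomial.C (a i)) (fun i => MvPolynomial.X i))) h0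
  rw [map_zero, GP, det_rupA_map, slice_map] at h1
  have h2 := congrArg ι h1
  rw [map_zero, det_rupA_map] at h2
  rw [← h2]
  have e1 : (MvPolynomial.eval₂Hom (MvPolynomial.C : k →+* MvPolynomial σ k)
    (Sum.elim (fun i => MvPolynomial.C (a i)) (fun i => MvPolynomial.X i))).comp (MvPolynomial.C) =
      (MvPolynomial.C : k →+* MvPolynomial σ k) := by
    ext1 r; simp
  rw [e1, hF0]
  simp

section
variable {L σ : Type*} [Field L] [Fintype σ] {f : MvPolynomial σ L} {δ : ℕ}

theorem slice_irr_of_GP (hf : f.totalDegree ≤ δ) (hδ0 : 0 < δ)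
    (hchar : ∀ r : ℕ, 0 < r → r ≤ δ → (r : L) ≠ 0) (v : σ → L)
    (hv : MvPolynomial.eval v (MvPolynomial.homogeneousComponent δ f) = 1)
    (e : RK δ → ℕ × ℕ) (a z : σ → L) (he : MvPolynomial.eval (Sum.elim a z) (GP δ v f e) ≠ 0) :
    Irreducible (slice (RingHom.id L) a v z f) := by
  have hm := slice_monic (RingHom.id L) a v z f hf hv
  rw [GP_eval] at he
  exact irreducible_of_minor hm.1 hm.2 (TD_slice _ _ _ _ f hf) hδ0 hchar e he

theorem irr_of_GP (hf : f.totalDegree = δ) (hδ0 : 0 < δ)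
    (hchar : ∀ r : ℕ, 0 < r → r ≤ δ → (r : L) ≠ 0) (v : σ → L)
    (hv : MvPolynomial.eval v (MvPolynomial.homogeneousComponent δ f) ≠ 0)
    (e : RK δ → ℕ × ℕ) (a z : σ → L) (he : MvPolynomial.eval (Sum.elim a z) (GP δ v f e) ≠ 0) :
    Irreducible f := by
  classical
  set c := (MvPolynomial.eval v (MvPolynomial.homogeneousComponent δ f))⁻¹ with hc
  have hc0 : c ≠ 0 := inv_ne_zero hv
  have hf0 : f ≠ 0 := by rintro rfl; simp at hv
  have hcu : IsUnit (MvPolynomial.C c : MvPolynomial σ L) := (Ne.isUnit hc0).map MvPolynomial.C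
  rw [← irreducible_isUnit_mul hcu]
  have hf' : (MvPolynomial.C c * f).totalDegree = δ := by
    rw [MvPolynomial.totalDegree_mul_of_isDomain hcu.ne_zero hf0, MvPolynomial.totalDegree_C, hf,
      zero_add]
  have hv' : MvPolynomial.eval v (MvPolynomial.homogeneousComponent δ (MvPolynomial.C c * f)) = 1 := by
    rw [MvPolynomial.homogeneousComponent_C_mul, map_mul, MvPolynomial.eval_C, hc]
    exact inv_mul_cancel₀ hv
  have he' : MvPolynomial.eval (Sum.elim a z) (GP δ v (MvPolynomial.C c * f) e) ≠ 0 := by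
    rw [GP_smul, map_mul, map_pow, MvPolynomial.eval_C]
    exact mul_ne_zero (pow_ne_zero _ hc0) he
  generalize MvPolynomial.C c * f = f' at hf' hv' he'
  have hI := slice_irr_of_GP hf'.le hδ0 hchar v hv' e a z he'
  have hf0' : f' ≠ 0 := by rintro rfl; simp at hv'
  have key : ∀ g h : MvPolynomial σ L, f' = g * h → IsUnit (slice (RingHom.id L) a v z g) → IsUnit g := by
    intro g h hgh hu
    have hg0 : g ≠ 0 := by rintro rfl; simp at hgh; exact hf0' hgh
    have hh0 : h ≠ 0 := by rintro rfl; simp at hgh; exact hf0' hgh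
    have hdeg : f'.totalDegree = g.totalDegree + h.totalDegree := by
      rw [hgh, MvPolynomial.totalDegree_mul_of_isDomain hg0 hh0]
    have h1 := natDegree_eq_zero_of_isUnit hu
    have hm := slice_monic (RingHom.id L) a v z f' hf'.le hv'
    have h2 : (slice (RingHom.id L) a v z h).natDegree ≤ h.totalDegree :=
      (TD_slice _ _ _ _ h le_rfl).natDegree_le
    have h3 : δ ≤ (slice (RingHom.id L) a v z h).natDegree := by
      rw [← hm.2, hgh, map_mul]
      refine natDegree_mul_le.trans ?_
      omega
    have h4 : g.totalDegree = 0 := by omega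
    rw [MvPolynomial.totalDegree_eq_zero_iff_eq_C] at h4
    rw [h4]
    apply IsUnit.map
    refine Ne.isUnit fun h5 => hg0 ?_
    rw [h4, h5, map_zero]
  refine ⟨fun hu => hI.not_isUnit (hu.map _), ?_⟩
  intro g h hgh
  have h1 : slice (RingHom.id L) a v z f' = slice (RingHom.id L) a v z g * slice (RingHom.id L) a v z h := by
    rw [hgh, map_mul]
  rcases hI.isUnit_or_isUnit h1 with h2 | h2
  · exact Or.inl (key g h hgh h2)
  · exact Or.inr (key h g (by rw [hgh, mul_comm]) h2)

end

end EV

namespace EV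

open Polynomial

section
variable {K : Type*} [CommRing K]

theorem cc_mul_mon (P : K[X][X]) (x r : ℕ × ℕ) :
    (((P * mon x).coeff r.1).coeff r.2 = 0) ∨ (x.1 ≤ r.1 ∧ x.2 ≤ r.2 ∧
      ((P * mon x).coeff r.1).coeff r.2 = (P.coeff (r.1 - x.1)).coeff (r.2 - x.2)) := by
  have e : P * mon x = P * C (X ^ x.2) * X ^ x.1 := by
    rw [mon, ← C_mul_X_pow_eq_monomial, ← C_mul_X_pow_eq_monomial, C_1, one_mul, mul_assoc]
  rw [e, coeff_mul_X_pow']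
  split_ifs with h1
  · rw [coeff_mul_C, coeff_mul_X_pow']
    split_ifs with h2
    · exact Or.inr ⟨h1, h2, rfl⟩
    · exact Or.inl rfl
  · exact Or.inl (by simp)

theorem dT_mon (x : ℕ × ℕ) : dT (mon x : K[X][X]) = C (C (x.2 : K)) * mon (x.1, x.2 - 1) := by
  ext1 i
  rw [coeff_dT, coeff_C_mul, mon, mon, coeff_monomial, coeff_monomial]
  split_ifs
  · rw [derivative_monomial, C_mul_monomial]; simp
  · simp

theorem derivative_mon (x : ℕ × ℕ) :
    derivative (mon x : K[X][X]) = C (C (x.1 : K)) * mon (x.1 - 1, x.2) := by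
  rw [mon, mon, derivative_monomial, C_mul_monomial, mul_comm]
  simp

theorem rupA_form {δ : ℕ} {F : K[X][X]} (hT : TD δ F) (r : ℕ × ℕ) (k : RK δ) :
    ∃ m1 m2 : ℤ, |m1| ≤ δ ∧ |m2| ≤ δ ∧ ∃ s1 s2 : ℕ × ℕ, rupA δ F r k =
      (m1 : K) * (F.coeff s1.1).coeff s1.2 + (m2 : K) * (F.coeff s2.1).coeff s2.2 := by
  have aux : ∀ (m : ℕ) (x : ℕ × ℕ), m ≤ δ → ∀ ε : ℤ, |ε| = 1 → ∃ m1 : ℤ, |m1| ≤ δ ∧ ∃ s1 : ℕ × ℕ,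
      (ε : K) * ((C (C (m : K)) * (F * mon x)).coeff r.1).coeff r.2 = (m1 : K) * (F.coeff s1.1).coeff s1.2 := by
    intro m x hm ε hε
    rw [coeff_C_mul, coeff_C_mul]
    rcases cc_mul_mon F x r with h | ⟨h1, h2, h3⟩
    · exact ⟨0, by simp, (0, 0), by rw [h]; simp⟩
    · refine ⟨ε * m, ?_, (r.1 - x.1, r.2 - x.2), ?_⟩
      · rw [abs_mul, hε]; simp; exact_mod_cast hm
      · rw [h3]; push_cast; ring
  have aux2 : ∀ (x : ℕ × ℕ), ∀ ε : ℤ, |ε| = 1 → ∃ m1 : ℤ, |m1| ≤ δ ∧ ∃ s1 : ℕ × ℕ,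
      (ε : K) * ((dT F * mon x).coeff r.1).coeff r.2 = (m1 : K) * (F.coeff s1.1).coeff s1.2 := by
    intro x ε hε
    rcases cc_mul_mon (dT F) x r with h | ⟨h1, h2, h3⟩
    · exact ⟨0, by simp, (0, 0), by rw [h]; simp⟩
    · rw [h3, coeff_dT, coeff_derivative]
      by_cases hr : r.2 - x.2 + 1 ≤ δ
      · refine ⟨ε * (r.2 - x.2 + 1 : ℕ), ?_, (r.1 - x.1, r.2 - x.2 + 1), ?_⟩
        · rw [abs_mul, hε, one_mul, Nat.abs_cast]; exact_mod_cast hr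
        · push_cast; ring
      · refine ⟨0, by simp, (0, 0), ?_⟩
        rw [hT (r.1 - x.1) (r.2 - x.2 + 1) (by omega)]; simp
  have aux3 : ∀ (x : ℕ × ℕ), ∀ ε : ℤ, |ε| = 1 → ∃ m1 : ℤ, |m1| ≤ δ ∧ ∃ s1 : ℕ × ℕ,
      (ε : K) * ((derivative F * mon x).coeff r.1).coeff r.2 = (m1 : K) * (F.coeff s1.1).coeff s1.2 := by
    intro x ε hε
    rcases cc_mul_mon (derivative F) x r with h | ⟨h1, h2, h3⟩
    · exact ⟨0, by simp, (0, 0), by rw [h]; simp⟩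
    · rw [h3, coeff_derivative]
      have : (F.coeff (r.1 - x.1 + 1) * (((r.1 - x.1 : ℕ) : K[X]) + 1)).coeff (r.2 - x.2) =
          (F.coeff (r.1 - x.1 + 1)).coeff (r.2 - x.2) * ((r.1 - x.1 + 1 : ℕ) : K) := by
        have e : (((r.1 - x.1 : ℕ) : K[X]) + 1) = C ((r.1 - x.1 + 1 : ℕ) : K) := by
          simp
        rw [e, coeff_mul_C]
      rw [this]
      by_cases hr : r.1 - x.1 + 1 ≤ δ
      · refine ⟨ε * (r.1 - x.1 + 1 : ℕ), ?_, (r.1 - x.1 + 1, r.2 - x.2), ?_⟩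
        · rw [abs_mul, hε, one_mul, Nat.abs_cast]; exact_mod_cast hr
        · push_cast; ring
      · refine ⟨0, by simp, (0, 0), ?_⟩
        rw [hT (r.1 - x.1 + 1) (r.2 - x.2) (by omega)]; simp
  rcases k with x | x
  · have hx := mem_idx.1 x.2
    obtain ⟨m1, hm1, s1, h1⟩ := aux x.1.2 (x.1.1, x.1.2 - 1) (by omega) 1 (by simp)
    obtain ⟨m2, hm2, s2, h2⟩ := aux2 x.1 (-1) (by simp)
    refine ⟨m1, m2, hm1, hm2, s1, s2, ?_⟩
    rw [← h1, ← h2, rupA, rcol, Psi, dT_mon]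
    simp only [derivative_zero, sub_zero, zero_mul, add_zero, coeff_sub]
    push_cast
    rw [mul_left_comm F, mul_comm (mon _) (dT F)]
    ring
  · have hx := mem_idx.1 x.2
    obtain ⟨m1, hm1, s1, h1⟩ := aux x.1.1 (x.1.1 - 1, x.1.2) (by omega) (-1) (by simp)
    obtain ⟨m2, hm2, s2, h2⟩ := aux3 x.1 1 (by simp)
    refine ⟨m1, m2, hm1, hm2, s1, s2, ?_⟩
    have e : Psi F 0 (mon x.1) = -(C (C (x.1.1 : K)) * (F * mon (x.1.1 - 1, x.1.2))) +
        derivative F * mon x.1 := by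
      rw [Psi, derivative_mon, map_zero]; ring
    rw [← h1, ← h2, rupA, rcol, e, coeff_add, coeff_add, coeff_neg, coeff_neg]
    push_cast
    ring

theorem card_RK (δ : ℕ) : Fintype.card (RK δ) ≤ 2 * δ ^ 2 := by
  rw [Fintype.card_sum, Fintype.card_coe, Fintype.card_coe]
  have h1 := card_idx_le (δ - 1) (δ - 1)
  have h2 := card_idx_le δ (δ - 1)
  rcases Nat.eq_zero_or_pos δ with h | h
  · subst h; simp at h1 h2 ⊢; simp [h1, h2]
  · have e : δ - 1 + 1 = δ := by omega
    rw [e] at h1 h2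
    have : (δ - 1) * δ ≤ δ * δ := Nat.mul_le_mul_right _ (by omega)
    nlinarith

end

/-! ### degree of the generic minor -/

/-- all coefficients have total degree at most `D` -/
def CD {τ K : Type*} [CommRing K] (D : ℕ) (P : (MvPolynomial τ K)[X][X]) : Prop :=
  ∀ i j, ((P.coeff i).coeff j).totalDegree ≤ D

section
variable {τ K : Type*} [CommRing K]

theorem CD.mono {D E : ℕ} {P : (MvPolynomial τ K)[X][X]} (h : CD D P) (hDE : D ≤ E) : CD E P :=
  fun i j => (h i j).trans hDE

theorem CD.add {D : ℕ} {P Q : (MvPolynomial τ K)[X][X]} (h : CD D P) (h' : CD D Q) : CD D (P + Q) := by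
  intro i j
  rw [coeff_add, coeff_add]
  exact (MvPolynomial.totalDegree_add _ _).trans (max_le (h i j) (h' i j))

theorem CD.mul {D E : ℕ} {P Q : (MvPolynomial τ K)[X][X]} (h : CD D P) (h' : CD E Q) :
    CD (D + E) (P * Q) := by
  intro i j
  rw [coeff_mul, finsetSum_coeff]
  refine MvPolynomial.totalDegree_finsetSum_le (fun x _ => ?_)
  rw [coeff_mul]
  refine MvPolynomial.totalDegree_finsetSum_le (fun y _ => ?_)
  exact (MvPolynomial.totalDegree_mul _ _).trans (add_le_add (h _ _) (h' _ _))

theorem CD.const (c : MvPolynomial τ K) : CD c.totalDegree (C (C c)) := by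
  intro i j
  rw [coeff_C]
  split_ifs
  · rw [coeff_C]; split_ifs <;> simp
  · simp

theorem CD.one : CD 0 (1 : (MvPolynomial τ K)[X][X]) := by
  have := CD.const (1 : MvPolynomial τ K)
  simpa using this

theorem CD.X1 : CD 0 (X : (MvPolynomial τ K)[X][X]) := by
  intro i j
  rw [coeff_X]
  split_ifs
  · rw [coeff_one]; split_ifs <;> simp
  · simp

theorem CD.X2 : CD 0 (C X : (MvPolynomial τ K)[X][X]) := by
  intro i j
  rw [coeff_C]
  split_ifs
  · rw [coeff_X]; split_ifs <;> simp
  · simp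

theorem CD.pow {D : ℕ} {P : (MvPolynomial τ K)[X][X]} (h : CD D P) (n : ℕ) : CD (n * D) (P ^ n) := by
  induction n with
  | zero => simpa using CD.one
  | succ n ih =>
    rw [pow_succ, Nat.succ_mul]; exact ih.mul h

theorem CD.prod {ι : Type*} (s : Finset ι) (m : ι → ℕ) (P : ι → (MvPolynomial τ K)[X][X])
    (h : ∀ i ∈ s, CD (m i) (P i)) : CD (∑ i ∈ s, m i) (∏ i ∈ s, P i) := by
  classical
  induction s using Finset.induction_on with
  | empty => simpa using CD.one
  | insert i s hi ih =>
    rw [Finset.prod_insert hi, Finset.sum_insert hi]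
    exact (h i (Finset.mem_insert_self _ _)).mul (ih fun j hj => h j (Finset.mem_insert_of_mem hj))

theorem CD.linf {a v z : MvPolynomial τ K} (ha : a.totalDegree ≤ 1) (hv : v.totalDegree ≤ 1)
    (hz : z.totalDegree ≤ 1) : CD 1 (EV.linf a v z) := by
  rw [EV.linf, C_mul]
  exact (((CD.const a).mono ha).add (((CD.const v).mul CD.X1).mono (by omega))).add
    (((CD.const z).mul CD.X2).mono (by omega))

theorem CD.slice {σ : Type*} [Fintype σ] (a v z : σ → MvPolynomial τ K) (ha : ∀ i, (a i).totalDegree ≤ 1)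
    (hv : ∀ i, (v i).totalDegree ≤ 1) (hz : ∀ i, (z i).totalDegree ≤ 1) (f : MvPolynomial σ K) {δ : ℕ}
    (hf : f.totalDegree ≤ δ) : CD δ (EV.slice MvPolynomial.C a v z f) := by
  rw [slice_eq_sum]
  have : ∀ s : Finset (σ →₀ ℕ), (∀ m ∈ s, m ∈ f.support) → CD δ (∑ m ∈ s,
      C (C (MvPolynomial.C (f.coeff m))) * ∏ i, EV.linf (a i) (v i) (z i) ^ m i) := by
    classical
    intro s
    induction s using Finset.induction_on with
    | empty => intro _; intro i j; simp
    | insert m s hm ih =>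
      intro h
      rw [Finset.sum_insert hm]
      refine CD.add ?_ (ih fun m' hm' => h m' (Finset.mem_insert_of_mem hm'))
      have h1 : CD (∑ i, m i * 1) (∏ i, EV.linf (a i) (v i) (z i) ^ m i) :=
        CD.prod _ _ _ (fun i _ => (CD.linf (ha i) (hv i) (hz i)).pow (m i))
      have h2 := (CD.const (MvPolynomial.C (f.coeff m) : MvPolynomial τ K)).mul h1
      refine h2.mono ?_
      have h3 := (degree_le_totalDegree (h m (Finset.mem_insert_self _ _))).trans hf
      rw [Finsupp.degree_eq_sum] at h3
      simpa using h3
  exact this _ (fun m hm => hm)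

theorem totalDegree_det_le {ι : Type*} [Fintype ι] [DecidableEq ι] (A : Matrix ι ι (MvPolynomial τ K)) (D : ℕ)
    (h : ∀ i j, (A i j).totalDegree ≤ D) : A.det.totalDegree ≤ Fintype.card ι * D := by
  rw [Matrix.det_apply]
  refine MvPolynomial.totalDegree_finsetSum_le (fun s _ => ?_)
  refine (MvPolynomial.totalDegree_smul_le _ _).trans ?_
  refine (MvPolynomial.totalDegree_finsetProd _ _).trans ?_
  refine (Finset.sum_le_sum (fun i _ => h _ _)).trans ?_
  simp

theorem totalDegree_GP {σ : Type*} [Fintype σ] {f : MvPolynomial σ K} {δ : ℕ} (hf : f.totalDegree ≤ δ)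
    (v : σ → K) (e : RK δ → ℕ × ℕ) : (GP δ v f e).totalDegree ≤ 2 * δ ^ 3 := by
  rcases subsingleton_or_nontrivial K with hK | hK
  · rw [Subsingleton.elim (GP δ v f e) 0]; simp
  have h := totalDegree_det_le (Matrix.of (fun x y => rupA δ (slice MvPolynomial.C (fun i => MvPolynomial.X (Sum.inl i))
    (fun i => MvPolynomial.C (v i)) (fun i => MvPolynomial.X (Sum.inr i)) f) (e x) y)) δ (by
      intro i j
      rw [Matrix.of_apply]
      obtain ⟨m1, m2, -, -, s1, s2, h⟩ := rupA_form (TD_slice (MvPolynomial.C) (fun i => (MvPolynomial.X (Sum.inl i) : MvPolynomial (σ ⊕ σ) K))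
        (fun i => MvPolynomial.C (v i)) (fun i => MvPolynomial.X (Sum.inr i)) f hf) (e i) j
      rw [h]
      have hc := CD.slice (fun i => (MvPolynomial.X (Sum.inl i) : MvPolynomial (σ ⊕ σ) K))
        (fun i => MvPolynomial.C (v i)) (fun i => MvPolynomial.X (Sum.inr i))
        (fun i => (MvPolynomial.totalDegree_X _).le) (fun i => by simp)
        (fun i => (MvPolynomial.totalDegree_X _).le) f hf
      have hm : ∀ (m : ℤ) (P : MvPolynomial (σ ⊕ σ) K), P.totalDegree ≤ δ → ((m : MvPolynomial (σ ⊕ σ) K) * P).totalDegree ≤ δ := by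
        intro m P hP
        rw [← zsmul_eq_mul]
        exact (MvPolynomial.totalDegree_smul_le _ _).trans hP
      exact (MvPolynomial.totalDegree_add _ _).trans (max_le (hm _ _ (hc _ _)) (hm _ _ (hc _ _))))
  refine h.trans ?_
  have := card_RK δ
  calc Fintype.card (RK δ) * δ ≤ 2 * δ ^ 2 * δ := Nat.mul_le_mul_right _ this
    _ = 2 * δ ^ 3 := by ring

end

end EV

namespace EV

open Polynomial

/-! ### multiplicities -/

section
variable {R σ : Type*} [CommRing R]

/-- translation -/
noncomputable def shift (c : σ → R) : MvPolynomial σ R →+* MvPolynomial σ R :=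
  MvPolynomial.eval₂Hom MvPolynomial.C (fun i => MvPolynomial.X i + MvPolynomial.C (c i))

theorem shift_shift (c : σ → R) (f : MvPolynomial σ R) :
    shift (fun i => - c i) (shift c f) = f := by
  have : (shift (fun i => - c i)).comp (shift c) = RingHom.id _ := by
    apply MvPolynomial.ringHom_ext
    · intro r; simp [shift]
    · intro i; simp [shift]
  exact congrArg (fun g => g f) this

theorem shift_shift' (c : σ → R) (f : MvPolynomial σ R) :
    shift c (shift (fun i => - c i) f) = f := by
  have := shift_shift (fun i => - c i) f
  simpa using this

/-- multiplicity of `f` at `c` -/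
noncomputable def mu (c : σ → R) (f : MvPolynomial σ R) : ℕ :=
  sInf ((fun m : σ →₀ ℕ => m.degree) '' ((shift c f).support : Set (σ →₀ ℕ)))

theorem mu_le (c : σ → R) (f : MvPolynomial σ R) {m : σ →₀ ℕ} (hm : m ∈ (shift c f).support) :
    mu c f ≤ m.degree := Nat.sInf_le ⟨m, hm, rfl⟩

theorem exists_mu (c : σ → R) (f : MvPolynomial σ R) (hf : f ≠ 0) :
    ∃ m ∈ (shift c f).support, m.degree = mu c f := by
  have h0 : shift c f ≠ 0 := by
    intro h
    apply hf
    rw [← shift_shift c f, h, map_zero]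
  obtain ⟨m, hm⟩ := MvPolynomial.support_nonempty.2 h0
  exact Nat.sInf_mem (s := ((fun m : σ →₀ ℕ => m.degree) '' ((shift c f).support : Set (σ →₀ ℕ)))) ⟨_, m, hm, rfl⟩

theorem expand_shift [Fintype σ] (c : σ → R) (f : MvPolynomial σ R) :
    f = ∑ m ∈ (shift c f).support, MvPolynomial.C ((shift c f).coeff m) *
      ∏ i, (MvPolynomial.X i - MvPolynomial.C (c i)) ^ m i := by
  conv_lhs => rw [← shift_shift c f]
  conv_lhs => rw [shift, MvPolynomial.coe_eval₂Hom, MvPolynomial.eval₂_eq']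
  apply Finset.sum_congr rfl
  intro m _
  congr 1
  apply Finset.prod_congr rfl
  intro i _
  rw [map_neg, sub_eq_add_neg]

theorem dvd_slice [Fintype σ] (a v z : σ → R) (f : MvPolynomial σ R) (T x : R) :
    (X - C x) ^ mu (fun i => a i + x * v i + T * z i) f ∣
      (slice (RingHom.id R) a v z f).map (evalRingHom T) := by
  set c : σ → R := fun i => a i + x * v i + T * z i with hc
  have h1 : ∀ i, (mapRingHom (evalRingHom T)) (slice (RingHom.id R) a v z (MvPolynomial.X i - MvPolynomial.C (c i))) =
      C (v i) * (X - C x) := by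
    intro i
    simp [slice, linf, hc]; ring
  change _ ∣ (mapRingHom (evalRingHom T)) (slice (RingHom.id R) a v z f)
  rw [expand_shift c f, map_sum, map_sum]
  rw [← expand_shift c f]
  apply Finset.dvd_sum
  intro m hm
  rw [map_mul, map_mul, map_prod, map_prod]
  apply Dvd.dvd.mul_left
  have h2 : ∀ i, (mapRingHom (evalRingHom T)) (slice (RingHom.id R) a v z
      ((MvPolynomial.X i - MvPolynomial.C (c i)) ^ m i)) = C (v i) ^ m i * (X - C x) ^ m i := by
    intro i
    rw [map_pow, map_pow, h1, mul_pow]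
  rw [Finset.prod_congr rfl (fun i _ => h2 i), Finset.prod_mul_distrib, Finset.prod_pow_eq_pow_sum,
    ← Finsupp.degree_eq_sum]
  exact Dvd.dvd.mul_left (pow_dvd_pow _ (mu_le c f hm)) _

end

/-- Schwartz–Zippel over `ZMod p` -/
theorem sz_zmod {p : ℕ} [Fact p.Prime] {τ : Type*} [Fintype τ] {P : MvPolynomial τ (ZMod p)} (hP : P ≠ 0) {D : ℕ}
    (hD : P.totalDegree ≤ D) [DecidablePred fun x : τ → ZMod p => MvPolynomial.eval x P = 0]
    [Fintype (τ → ZMod p)] :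
    (Finset.univ.filter (fun x : τ → ZMod p => MvPolynomial.eval x P = 0)).card * p ≤
      D * p ^ Fintype.card τ := by
  classical
  have hp0 : 0 < p := (Fact.out : p.Prime).pos
  set e := Fintype.equivFin τ
  have h := MvPolynomial.schwartz_zippel_totalDegree (p := MvPolynomial.rename e P)
    (fun h => hP (MvPolynomial.rename_injective e e.injective (by rw [h, map_zero]))) (Finset.univ : Finset (ZMod p))
  rw [show (MvPolynomial.rename e P).totalDegree = P.totalDegree from
    MvPolynomial.totalDegree_renameEquiv e P, Finset.card_univ, ZMod.card] at h
  have hc : (Finset.univ.filter (fun x : τ → ZMod p => MvPolynomial.eval x P = 0)).card ≤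
      ((Fintype.piFinset fun _ => (Finset.univ : Finset (ZMod p))).filter
        (fun x : Fin (Fintype.card τ) → ZMod p => MvPolynomial.eval x (MvPolynomial.rename e P) = 0)).card := by
    apply Finset.card_le_card_of_injOn (fun x => x ∘ e.symm)
    · intro x hx
      simp only [Finset.coe_filter, Finset.mem_univ, true_and, Set.mem_setOf_eq] at hx
      simp only [Finset.coe_filter, Fintype.mem_piFinset, Finset.mem_univ, implies_true, true_and, Set.mem_setOf_eq]
      rw [MvPolynomial.eval_rename]
      have : (x ∘ e.symm) ∘ e = x := by ext i; simp
      rw [this]; exact hx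
    · intro x _ y _ hxy
      ext i
      have := congrFun hxy (e i)
      simpa using this
  rw [div_le_div_iff₀ (by positivity) (by positivity)] at h
  have h' : ((Fintype.piFinset fun _ => (Finset.univ : Finset (ZMod p))).filter
        (fun x : Fin (Fintype.card τ) → ZMod p => MvPolynomial.eval x (MvPolynomial.rename e P) = 0)).card * p
        ≤ P.totalDegree * p ^ Fintype.card τ := by
    exact_mod_cast h
  calc _ ≤ _ := Nat.mul_le_mul_right p hc
    _ ≤ _ := h'
    _ ≤ _ := Nat.mul_le_mul_right _ hD

theorem sum_translate {p : ℕ} [Fact p.Prime] {σ : Type*} [Fintype σ] [DecidableEq σ] (g : (σ → ZMod p) → ℕ)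
    (v : σ → ZMod p) :
    ∑ a : σ → ZMod p, ∑ z : σ → ZMod p, ∑ T : ZMod p, ∑ x : ZMod p, g (fun i => a i + x * v i + T * z i) =
      p ^ Fintype.card σ * (p * p) * ∑ c, g c := by
  have h1 : ∀ (z : σ → ZMod p) (T x : ZMod p), ∑ a : σ → ZMod p, g (fun i => a i + x * v i + T * z i) = ∑ c, g c := by
    intro z T x
    refine Fintype.sum_equiv (Equiv.addRight (fun i => x * v i + T * z i)) _ _ ?_
    intro a
    congr 1
    ext i
    simp [add_assoc]
  rw [Finset.sum_comm]
  have h2 : ∀ z : σ → ZMod p, ∑ a : σ → ZMod p, ∑ T : ZMod p, ∑ x : ZMod p, g (fun i => a i + x * v i + T * z i) =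
      p * p * ∑ c, g c := by
    intro z
    rw [Finset.sum_comm]
    have h3 : ∀ T : ZMod p, ∑ a : σ → ZMod p, ∑ x : ZMod p, g (fun i => a i + x * v i + T * z i) = p * ∑ c, g c := by
      intro T
      rw [Finset.sum_comm, Finset.sum_congr rfl (fun x _ => h1 z T x)]
      simp [ZMod.card]
    rw [Finset.sum_congr rfl (fun T _ => h3 T)]
    simp [ZMod.card, mul_assoc]
  rw [Finset.sum_congr rfl (fun z _ => h2 z)]
  simp [ZMod.card, mul_assoc]

theorem lang_weil {p : ℕ} [hp : Fact p.Prime] {σ : Type*} [Fintype σ] [DecidableEq σ] {f : MvPolynomial σ (ZMod p)} {δ : ℕ}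
    (hf : f.totalDegree = δ) (hδ0 : 0 < δ)
    (hirr : Irreducible (MvPolynomial.map (algebraMap (ZMod p) (AlgebraicClosure (ZMod p))) f))
    {q : ℕ} (hq : q ^ 2 ≤ p) (hq' : p < (q + 1) ^ 2) (hq1 : 100 * δ ^ 2 ≤ q) :
    (∑ c, mu c f) * (p * p) ≤ p ^ Fintype.card σ * (p + 38 * δ ^ 2 * q) := by
  classical
  have hp0 : 0 < p := hp.out.pos
  have hδ2p : δ ^ 2 < p := by
    have h2 : q ≤ q ^ 2 := Nat.le_self_pow (by norm_num) _
    have : 0 < δ ^ 2 := by positivity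
    omega
  have hδp : δ < p := lt_of_le_of_lt (Nat.le_self_pow (by norm_num) _) hδ2p
  have hf0 : f ≠ 0 := by
    rintro rfl; simp at hf; omega
  -- a direction
  obtain ⟨v, hv⟩ : ∃ v : σ → ZMod p, MvPolynomial.eval v (MvPolynomial.homogeneousComponent δ f) ≠ 0 := by
    by_contra hcon
    push Not at hcon
    have h0 : MvPolynomial.homogeneousComponent δ f = 0 := by
      apply MvPolynomial.eq_zero_of_eval_zero_at_prod_finset _ (fun _ => Finset.univ)
      · intro i
        rw [Finset.card_univ, ZMod.card]
        refine lt_of_le_of_lt (MvPolynomial.degreeOf_le_totalDegree _ i) (lt_of_le_of_lt ?_ hδp)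
        exact (MvPolynomial.homogeneousComponent_isHomogeneous δ f).totalDegree_le
      · intro x _; exact hcon x
    obtain ⟨m, hm, hmd⟩ := Finset.exists_mem_eq_sup f.support (MvPolynomial.support_nonempty.2 hf0) (fun m => m.degree)
    have hmd' : m.degree = δ := by rw [← hmd, ← hf]; rfl
    have := congrArg (MvPolynomial.coeff m) h0
    rw [MvPolynomial.coeff_homogeneousComponent, if_pos hmd', MvPolynomial.coeff_zero] at this
    exact (MvPolynomial.mem_support_iff.1 hm) this
  -- normalise
  set c := (MvPolynomial.eval v (MvPolynomial.homogeneousComponent δ f))⁻¹ with hc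
  have hc0 : c ≠ 0 := inv_ne_zero hv
  have hmu : ∀ w, mu w f = mu w (MvPolynomial.C c * f) := by
    intro w
    have : shift w (MvPolynomial.C c * f) = MvPolynomial.C c * shift w f := by
      rw [map_mul]; simp [shift]
    rw [mu, mu, this]
    congr 2
    ext m
    simp [MvPolynomial.coeff_C_mul, hc0]
  simp only [hmu]
  have hcu : IsUnit (MvPolynomial.C c : MvPolynomial σ (ZMod p)) := (Ne.isUnit hc0).map MvPolynomial.C
  have hirr' : Irreducible (MvPolynomial.map (algebraMap (ZMod p) (AlgebraicClosure (ZMod p))) (MvPolynomial.C c * f)) := by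
    rw [map_mul]
    exact (irreducible_isUnit_mul (hcu.map _)).2 hirr
  have hf' : (MvPolynomial.C c * f).totalDegree = δ := by
    rw [MvPolynomial.totalDegree_mul_of_isDomain hcu.ne_zero hf0, MvPolynomial.totalDegree_C, hf,
      zero_add]
  have hv' : MvPolynomial.eval v (MvPolynomial.homogeneousComponent δ (MvPolynomial.C c * f)) = 1 := by
    rw [MvPolynomial.homogeneousComponent_C_mul, map_mul, MvPolynomial.eval_C, hc]
    exact inv_mul_cancel₀ hv
  clear hmu
  generalize MvPolynomial.C c * f = f' at hirr' hf' hv'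
  set ι := algebraMap (ZMod p) (AlgebraicClosure (ZMod p)) with hι
  have hcast : ∀ r : ℕ, 0 < r → r ≤ δ ^ 2 → (r : AlgebraicClosure (ZMod p)) ≠ 0 := by
    intro r h h' h0
    have h1 : ι (r : ZMod p) = 0 := by rw [map_natCast, h0]
    rw [map_eq_zero] at h1
    rw [ZMod.natCast_eq_zero_iff] at h1
    exact absurd (Nat.le_of_dvd h h1) (by omega)
  have hvι : MvPolynomial.eval (fun i => ι (v i)) (MvPolynomial.homogeneousComponent δ (MvPolynomial.map ι f')) = 1 := by
    rw [hcomp_map]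
    refine (eval_map_comp ι v _).trans ?_
    rw [hv', map_one]
  obtain ⟨e, he⟩ := bertini (by rw [totalDegree_map_inj ι ι.injective, hf']) hirr' hδ0 hcast (fun i => ι (v i)) (by rw [hvι]; exact one_ne_zero)
  rw [← GP_map] at he
  have hG0 : GP δ v f' e ≠ 0 := by
    intro h; rw [h, map_zero] at he; exact he rfl
  -- the inner sums
  set S : (σ → ZMod p) → (σ → ZMod p) → ℕ := fun a z => ∑ T : ZMod p, ∑ x : ZMod p, mu (fun i => a i + x * v i + T * z i) f' with hS
  have hmon := fun a z => slice_monic (RingHom.id (ZMod p)) a v z f' hf'.le hv'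
  have hS1 : ∀ a z, S a z ≤ ∑ T : ZMod p, ∑ x : ZMod p,
      ((slice (RingHom.id (ZMod p)) a v z f').map (evalRingHom T)).rootMultiplicity x := by
    intro a z
    refine Finset.sum_le_sum fun T _ => Finset.sum_le_sum fun x _ => ?_
    rw [le_rootMultiplicity_iff ((hmon a z).1.map _).ne_zero]
    exact dvd_slice a v z f' T x
  have hSbad : ∀ a z, S a z ≤ p * δ := by
    intro a z
    refine (hS1 a z).trans ?_
    have : ∀ T ∈ (Finset.univ : Finset (ZMod p)), ∑ x : ZMod p, ((slice (RingHom.id (ZMod p)) a v z f').map (evalRingHom T)).rootMultiplicity x ≤ δ := by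
      intro T _
      have h1 := Polynomial.card_roots' ((slice (RingHom.id (ZMod p)) a v z f').map (evalRingHom T))
      rw [(hmon a z).1.natDegree_map, (hmon a z).2] at h1
      refine le_trans (le_of_eq ?_) h1
      simp_rw [← count_roots]
      exact (Multiset.sum_count_eq_card (fun _ _ => Finset.mem_univ _))
    refine (Finset.sum_le_card_nsmul _ _ _ this).trans ?_
    rw [Finset.card_univ, ZMod.card]; rfl
  have hSgood : ∀ a z, MvPolynomial.eval (Sum.elim a z) (GP δ v f' e) ≠ 0 → S a z ≤ p + 37 * δ ^ 2 * q := by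
    intro a z hg
    refine (hS1 a z).trans ?_
    refine stepanov (L := AlgebraicClosure (ZMod p)) (hmon a z).1 (hmon a z).2 (TD_slice _ _ _ _ _ hf'.le) ?_ hδ0 hq hq' hq1
    have h1 := slice_irr_of_GP (L := AlgebraicClosure (ZMod p)) (f := MvPolynomial.map ι f') (δ := δ)
      (by rw [totalDegree_map_inj ι ι.injective, hf']) hδ0
      (fun r h h' => hcast r h (h'.trans (Nat.le_self_pow (by norm_num) _))) (fun i => ι (v i)) hvι e
      (fun i => ι (a i)) (fun i => ι (z i)) (by
        rw [← GP_map]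
        have e1 : (Sum.elim (fun i => ι (a i)) (fun i => ι (z i)) : σ ⊕ σ → AlgebraicClosure (ZMod p)) =
            fun i => ι (Sum.elim a z i) := by
          ext i; cases i <;> rfl
        rw [e1, eval_map_comp]
        exact (map_ne_zero ι).2 hg)
    rw [slice_map_left] at h1
    rw [slice_map]
    exact h1
  -- counting
  have hsum := sum_translate (p := p) (fun c => mu c f') v
  have hb := sz_zmod hG0 (totalDegree_GP hf'.le v e)
  have hcard : Fintype.card (σ ⊕ σ) = Fintype.card σ + Fintype.card σ := Fintype.card_sum
  set N := Fintype.card σ with hN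
  rw [hcard] at hb
  set bad := (Finset.univ.filter (fun y : σ ⊕ σ → ZMod p => MvPolynomial.eval y (GP δ v f' e) = 0)) with hbad
  have htot : ∑ a : σ → ZMod p, ∑ z : σ → ZMod p, S a z ≤ p ^ (N + N) * (p + 37 * δ ^ 2 * q) + bad.card * (p * δ) := by
    have e1 : ∑ a : σ → ZMod p, ∑ z : σ → ZMod p, S a z =
        ∑ y : σ ⊕ σ → ZMod p, S (y ∘ Sum.inl) (y ∘ Sum.inr) := by
      rw [← Fintype.sum_prod_type']
      refine (Fintype.sum_equiv (Equiv.sumArrowEquivProdArrow σ σ (ZMod p)) _ _ ?_).symm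
      intro y; rfl
    rw [e1]
    have e2 : ∀ y : σ ⊕ σ → ZMod p, S (y ∘ Sum.inl) (y ∘ Sum.inr) ≤ (p + 37 * δ ^ 2 * q) + if y ∈ bad then p * δ else 0 := by
      intro y
      split_ifs with h
      · exact (hSbad _ _).trans (Nat.le_add_left _ _)
      · rw [add_zero]
        apply hSgood
        rw [hbad, Finset.mem_filter] at h
        simp only [Finset.mem_univ, true_and] at h
        have e3 : Sum.elim (y ∘ Sum.inl) (y ∘ Sum.inr) = y := Sum.elim_comp_inl_inr y
        rw [e3]; exact h
    refine (Finset.sum_le_sum fun y _ => e2 y).trans ?_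
    rw [Finset.sum_add_distrib, Finset.sum_const, Finset.sum_ite_mem, Finset.univ_inter, Finset.sum_const,
      Finset.card_univ]
    simp [ZMod.card, pow_add, hN]
  have h1 : ∑ a : σ → ZMod p, ∑ z : σ → ZMod p, S a z = p ^ N * (p * p) * ∑ c, mu c f' := hsum
  rw [h1] at htot
  have h2 : bad.card * (p * δ) ≤ p ^ (N + N) * (δ ^ 2 * q) := by
    calc bad.card * (p * δ) = (bad.card * p) * δ := by ring
      _ ≤ (2 * δ ^ 3 * p ^ (N + N)) * δ := Nat.mul_le_mul_right _ hb
      _ = p ^ (N + N) * (δ ^ 2 * (2 * δ ^ 2)) := by ring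
      _ ≤ p ^ (N + N) * (δ ^ 2 * q) := by
        apply Nat.mul_le_mul_left
        apply Nat.mul_le_mul_left
        omega
  have h3 : p ^ N * ((∑ c, mu c f') * (p * p)) ≤ p ^ N * (p ^ N * (p + 38 * δ ^ 2 * q)) := by
    calc p ^ N * ((∑ c, mu c f') * (p * p)) = p ^ N * (p * p) * ∑ c, mu c f' := by ring
      _ ≤ p ^ (N + N) * (p + 37 * δ ^ 2 * q) + p ^ (N + N) * (δ ^ 2 * q) := htot.trans (Nat.add_le_add_left h2 _)
      _ = p ^ N * (p ^ N * (p + 38 * δ ^ 2 * q)) := by rw [pow_add]; ring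
  exact Nat.le_of_mul_le_mul_left h3 (pow_pos hp0 N)

end EV

namespace EV

open Polynomial

/-- coefficientwise majorant with given value at one -/
def Maj (P : ℤ[X][X]) (A : ℤ) : Prop :=
  ∃ Q : ℤ[X][X], (∀ i j, |(P.coeff i).coeff j| ≤ (Q.coeff i).coeff j) ∧ evalEval 1 1 Q = A

theorem Maj.add {P P' : ℤ[X][X]} {A A' : ℤ} (h : Maj P A) (h' : Maj P' A') : Maj (P + P') (A + A') := by
  obtain ⟨Q, h1, h2⟩ := h
  obtain ⟨Q', h1', h2'⟩ := h'
  refine ⟨Q + Q', fun i j => ?_, ?_⟩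
  · rw [coeff_add, coeff_add, coeff_add, coeff_add]
    exact (abs_add_le _ _).trans (add_le_add (h1 i j) (h1' i j))
  · rw [evalEval_add, h2, h2']

theorem Maj.mul {P P' : ℤ[X][X]} {A A' : ℤ} (h : Maj P A) (h' : Maj P' A') : Maj (P * P') (A * A') := by
  obtain ⟨Q, h1, h2⟩ := h
  obtain ⟨Q', h1', h2'⟩ := h'
  refine ⟨Q * Q', fun i j => ?_, ?_⟩
  · rw [coeff_mul, coeff_mul, finsetSum_coeff, finsetSum_coeff]
    refine (Finset.abs_sum_le_sum_abs _ _).trans (Finset.sum_le_sum fun x _ => ?_)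
    rw [coeff_mul, coeff_mul]
    refine (Finset.abs_sum_le_sum_abs _ _).trans (Finset.sum_le_sum fun y _ => ?_)
    rw [abs_mul]
    exact mul_le_mul (h1 _ _) (h1' _ _) (abs_nonneg _) ((abs_nonneg _).trans (h1 _ _))
  · rw [evalEval_mul, h2, h2']

theorem Maj.const (c : ℤ) : Maj (C (C c)) |c| := by
  refine ⟨C (C |c|), fun i j => ?_, by simp⟩
  rw [coeff_C, coeff_C]
  split_ifs
  · rw [coeff_C, coeff_C]; split_ifs <;> simp
  · simp

theorem Maj.zero : Maj 0 0 := by simpa using Maj.const 0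
theorem Maj.one : Maj 1 1 := by simpa using Maj.const 1

theorem Maj.X1 : Maj X 1 := by
  refine ⟨X, fun i j => ?_, by simp⟩
  rw [coeff_X]
  split_ifs
  · refine (abs_of_nonneg ?_).le
    rw [coeff_one]
    split_ifs <;> norm_num
  · simp

theorem Maj.X2 : Maj (C X) 1 := by
  refine ⟨C X, fun i j => ?_, by rw [evalEval_C, eval_X]⟩
  rw [coeff_C]
  split_ifs
  · rw [coeff_X]; split_ifs <;> norm_num
  · simp

theorem Maj.pow {P : ℤ[X][X]} {A : ℤ} (h : Maj P A) (n : ℕ) : Maj (P ^ n) (A ^ n) := by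
  induction n with
  | zero => simpa using Maj.one
  | succ n ih => rw [pow_succ, pow_succ]; exact ih.mul h

theorem Maj.prod {ι : Type*} (s : Finset ι) (A : ι → ℤ) (P : ι → ℤ[X][X])
    (h : ∀ i ∈ s, Maj (P i) (A i)) : Maj (∏ i ∈ s, P i) (∏ i ∈ s, A i) := by
  classical
  induction s using Finset.induction_on with
  | empty => simpa using Maj.one
  | insert i s hi ih =>
    rw [Finset.prod_insert hi, Finset.prod_insert hi]
    exact (h i (Finset.mem_insert_self _ _)).mul (ih fun j hj => h j (Finset.mem_insert_of_mem hj))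

theorem Maj.sum {ι : Type*} (s : Finset ι) (A : ι → ℤ) (P : ι → ℤ[X][X])
    (h : ∀ i ∈ s, Maj (P i) (A i)) : Maj (∑ i ∈ s, P i) (∑ i ∈ s, A i) := by
  classical
  induction s using Finset.induction_on with
  | empty => simpa using Maj.zero
  | insert i s hi ih =>
    rw [Finset.sum_insert hi, Finset.sum_insert hi]
    exact (h i (Finset.mem_insert_self _ _)).add (ih fun j hj => h j (Finset.mem_insert_of_mem hj))

theorem Maj.le {P : ℤ[X][X]} {A : ℤ} (h : Maj P A) (i j : ℕ) : |(P.coeff i).coeff j| ≤ A := by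
  obtain ⟨Q, h1, h2⟩ := h
  have h0 : ∀ i j, 0 ≤ (Q.coeff i).coeff j := fun i j => (abs_nonneg _).trans (h1 i j)
  have key : ∀ (P : ℤ[X]), (∀ j, 0 ≤ P.coeff j) → ∀ j, P.coeff j ≤ P.eval 1 := by
    intro P hP j
    rw [eval_eq_sum_range]
    simp only [one_pow, mul_one]
    by_cases hj : j ∈ Finset.range (P.natDegree + 1)
    · exact Finset.single_le_sum (f := fun j => P.coeff j) (fun i _ => hP i) hj
    · rw [Finset.mem_range, not_lt] at hj
      rw [coeff_eq_zero_of_natDegree_lt (by omega)]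
      exact Finset.sum_nonneg fun i _ => hP i
  refine (h1 i j).trans (((key _ (h0 i) j)).trans ?_)
  have h3 : (Q.map (evalRingHom 1)).eval 1 = A := by
    rw [← h2, Polynomial.map_evalRingHom_eval]
  rw [← h3]
  have h4 := key (Q.map (evalRingHom 1)) (fun i => by
    rw [coeff_map]
    exact (h0 i 0).trans (key _ (h0 i) 0)) i
  rw [coeff_map] at h4
  exact h4

theorem Maj.linf (a v z : ℤ) : Maj (EV.linf a v z) (|a| + |v| + |z|) := by
  have := ((Maj.const a).add ((Maj.const v).mul Maj.X1)).add ((Maj.const z).mul Maj.X2)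
  rw [mul_one, mul_one] at this
  rw [EV.linf, C_mul]
  exact this

theorem support_card_le {σ R : Type*} [Fintype σ] [CommRing R] (f : MvPolynomial σ R) {d : ℕ} (hf : f.totalDegree ≤ d) :
    f.support.card ≤ (d + 1) ^ Fintype.card σ := by
  classical
  have : f.support.card ≤ (Fintype.piFinset fun _ : σ => Finset.range (d + 1)).card := by
    apply Finset.card_le_card_of_injOn (fun m i => m i)
    · intro m hm
      rw [Finset.mem_coe, Fintype.mem_piFinset]
      intro i
      rw [Finset.mem_range, Nat.lt_succ_iff]
      exact (Finsupp.le_degree i m).trans ((degree_le_totalDegree hm).trans hf)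
    · intro m _ m' _ h
      ext i
      exact congrFun h i
  simpa using this

section
variable {σ : Type*} [Fintype σ] (f : MvPolynomial σ ℤ) {d : ℕ} {H : ℕ}

theorem coeff_slice_bound (hf : f.totalDegree ≤ d) (hH : ∀ m, |f.coeff m| ≤ H)
    (a v z : σ → ℤ) {A : ℕ} (hA1 : 1 ≤ A) (hA : ∀ i, |a i| + |v i| + |z i| ≤ A) (i j : ℕ) :
    |((slice (RingHom.id ℤ) a v z f).coeff i).coeff j| ≤ (d + 1) ^ Fintype.card σ * H * A ^ d := by
  rw [slice_eq_sum]
  have h1 := Maj.sum f.support (fun m => |f.coeff m| * ∏ i, (|a i| + |v i| + |z i|) ^ m i)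
    (fun m => C (C ((RingHom.id ℤ) (f.coeff m))) * ∏ i, linf (a i) (v i) (z i) ^ m i) (by
      intro m _
      exact (Maj.const _).mul (Maj.prod _ _ _ fun i _ => (Maj.linf _ _ _).pow _))
  refine (h1.le i j).trans ?_
  have h2 : ∀ m ∈ f.support, |f.coeff m| * ∏ i, (|a i| + |v i| + |z i|) ^ m i ≤ (H : ℤ) * A ^ d := by
    intro m hm
    apply mul_le_mul (hH m) _ (Finset.prod_nonneg fun i _ => by positivity) (by positivity)
    calc ∏ i, (|a i| + |v i| + |z i|) ^ m i ≤ ∏ i, (A : ℤ) ^ m i :=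
          Finset.prod_le_prod (fun i _ => by positivity) (fun i _ => pow_le_pow_left₀ (by positivity) (hA i) _)
      _ = (A : ℤ) ^ m.degree := by rw [Finset.prod_pow_eq_pow_sum, Finsupp.degree_eq_sum]
      _ ≤ (A : ℤ) ^ d := pow_le_pow_right₀ (by exact_mod_cast hA1) ((degree_le_totalDegree hm).trans hf)
  refine (Finset.sum_le_card_nsmul _ _ _ h2).trans ?_
  rw [nsmul_eq_mul, mul_assoc]
  apply mul_le_mul_of_nonneg_right _ (by positivity)
  exact_mod_cast support_card_le f hf

theorem eval_bound (hf : f.totalDegree ≤ d) (hH : ∀ m, |f.coeff m| ≤ H)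
    (v : σ → ℤ) {A : ℕ} (hA1 : 1 ≤ A) (hA : ∀ i, |v i| ≤ A) :
    |MvPolynomial.eval v f| ≤ (d + 1) ^ Fintype.card σ * H * A ^ d := by
  have h := coeff_slice_bound f hf hH v 0 0 hA1 (by simpa using hA) 0 0
  have e : slice (RingHom.id ℤ) v 0 0 f = C (C (MvPolynomial.eval v f)) := by
    have : slice (RingHom.id ℤ) v 0 0 = (C.comp C : ℤ →+* ℤ[X][X]).comp (MvPolynomial.eval v) := by
      apply MvPolynomial.ringHom_ext
      · intro r; simp [slice]
      · intro i; simp [slice, linf]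
    rw [this]; rfl
  rw [e, coeff_C_zero, coeff_C_zero] at h
  exact h

theorem GP_bound (hf : f.totalDegree ≤ d) (hH : ∀ m, |f.coeff m| ≤ H)
    (a v z : σ → ℤ) (hd : 1 ≤ d) {A : ℕ} (hA1 : 1 ≤ A) (hA : ∀ i, |a i| + |v i| + |z i| ≤ A)
    (hH1 : 1 ≤ H) (e : RK d → ℕ × ℕ) :
    |MvPolynomial.eval (Sum.elim a z) (GP d v f e)| ≤
      ((2 * d ^ 2) * (2 * d * ((d + 1) ^ Fintype.card σ * H * A ^ d)) : ℤ) ^ (2 * d ^ 2) := by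
  classical
  rw [GP_eval]
  set E : ℤ := (d + 1) ^ Fintype.card σ * H * A ^ d with hE
  have hE1 : 1 ≤ E := by
    have : 0 < E := by positivity
    omega
  have h1 : ∀ i j, (AbsoluteValue.abs : AbsoluteValue ℤ ℤ) ((Matrix.of (fun x y => rupA d (slice (RingHom.id ℤ) a v z f) (e x) y)) i j) ≤ 2 * d * E := by
    intro i j
    rw [Matrix.of_apply]
    obtain ⟨m1, m2, hm1, hm2, s1, s2, h⟩ := rupA_form (TD_slice (RingHom.id ℤ) a v z f hf) (e i) j
    rw [h, AbsoluteValue.abs_apply]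
    have b1 := coeff_slice_bound f hf hH a v z hA1 hA s1.1 s1.2
    have b2 := coeff_slice_bound f hf hH a v z hA1 hA s2.1 s2.2
    refine (abs_add_le _ _).trans ?_
    rw [abs_mul, abs_mul]
    have c1 := mul_le_mul hm1 b1 (abs_nonneg _) (by positivity)
    have c2 := mul_le_mul hm2 b2 (abs_nonneg _) (by positivity)
    simp only [Int.cast_id] at *
    linarith
  have h2 := Matrix.det_le h1
  rw [AbsoluteValue.abs_apply] at h2
  refine h2.trans ?_
  have hk := card_RK d
  set k := Fintype.card (RK d)
  have h3 : ((k.factorial : ℕ) : ℤ) ≤ ((2 * d ^ 2 : ℤ)) ^ k := by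
    have : k.factorial ≤ (2 * d ^ 2) ^ k := (Nat.factorial_le_pow k).trans (Nat.pow_le_pow_left hk k)
    exact_mod_cast this
  have hd' : (1 : ℤ) ≤ d := by exact_mod_cast hd
  have h5 : (1 : ℤ) ≤ 2 * d ^ 2 * (2 * d * E) := by
    have : 0 < (2 * d ^ 2 * (2 * d * E) : ℤ) := by positivity
    omega
  calc (k.factorial : ℕ) • (2 * d * E) ^ k = ((k.factorial : ℕ) : ℤ) * (2 * d * E) ^ k := by rw [nsmul_eq_mul]
    _ ≤ (2 * d ^ 2 : ℤ) ^ k * (2 * d * E) ^ k := mul_le_mul_of_nonneg_right h3 (by positivity)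
    _ = (2 * d ^ 2 * (2 * d * E) : ℤ) ^ k := (mul_pow _ _ _).symm
    _ ≤ _ := pow_le_pow_right₀ h5 hk

end

/-- nonvanishing at a small integer point -/
theorem exists_small {τ : Type*} [Fintype τ] (P : MvPolynomial τ ℤ) (hP : P ≠ 0) {D : ℕ} (hD : P.totalDegree ≤ D) :
    ∃ x : τ → ℤ, (∀ i, |x i| ≤ D) ∧ MvPolynomial.eval x P ≠ 0 := by
  by_contra hcon
  push Not at hcon
  apply hP
  apply MvPolynomial.eq_zero_of_eval_zero_at_prod_finset _ (fun _ => Finset.Icc (0 : ℤ) D)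
  · intro i
    have := (MvPolynomial.degreeOf_le_totalDegree P i).trans hD
    simp
    omega
  · intro x hx
    apply hcon
    intro i
    have := hx i
    rw [Finset.mem_Icc] at this
    rw [abs_of_nonneg this.1]
    exact this.2

end EV

namespace EV

open Polynomial

theorem hcomp_ne_zero {σ R : Type*} [Fintype σ] [CommRing R] {f : MvPolynomial σ R} {d : ℕ} (hd : 1 ≤ d)
    (hf : f.totalDegree = d) : MvPolynomial.homogeneousComponent d f ≠ 0 := by
  classical
  have hf0 : f ≠ 0 := by rintro rfl; simp at hf; omega
  obtain ⟨m, hm, hmd⟩ := Finset.exists_mem_eq_sup f.support (MvPolynomial.support_nonempty.2 hf0) (fun m => m.degree)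
  intro h
  have h1 := congrArg (MvPolynomial.coeff m) h
  rw [MvPolynomial.coeff_homogeneousComponent, if_pos] at h1
  · exact MvPolynomial.mem_support_iff.1 hm (by simpa using h1)
  · rw [← hf]
    apply le_antisymm (degree_le_totalDegree hm)
    rw [← hmd, MvPolynomial.totalDegree]
    apply Finset.sup_le
    intro b hb
    refine le_trans (le_of_eq ?_) (Finset.le_sup (f := fun m : σ →₀ ℕ => m.degree) hb)
    rw [Finsupp.degree]; rfl

theorem exists_bad_div {σ : Type*} [Fintype σ] (f : MvPolynomial σ ℤ) {d : ℕ} (hd : 1 ≤ d)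
    (hf : f.totalDegree = d)
    (hirr : Irreducible (MvPolynomial.map (Int.castRingHom (AlgebraicClosure ℚ)) f))
    {H : ℕ} (hH1 : 1 ≤ H) (hH : ∀ m, |f.coeff m| ≤ H) :
    ∃ Y : ℤ, Y ≠ 0 ∧ |Y| ≤ (4 * d ^ 3 * ((d + 1) ^ Fintype.card σ * H * (5 * d ^ 3) ^ d) : ℤ) ^ (2 * d ^ 2 + 1) ∧
      ∀ (p : ℕ) (hp : p.Prime), d < p →
        ¬ Irreducible (letI : Fact (Nat.Prime p) := ⟨hp⟩;
          MvPolynomial.map (Int.castRingHom (AlgebraicClosure (ZMod p))) f) → (p : ℤ) ∣ Y := by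
  classical
  have hfd := hcomp_ne_zero hd hf
  obtain ⟨v, hv, hv0⟩ := exists_small _ hfd (D := d) (by
    exact (MvPolynomial.homogeneousComponent_isHomogeneous d f).totalDegree_le)
  have hinj : Function.Injective (Int.castRingHom (AlgebraicClosure ℚ)) := Int.cast_injective
  obtain ⟨e, he⟩ := bertini (f := MvPolynomial.map (Int.castRingHom (AlgebraicClosure ℚ)) f) (δ := d)
    (by rw [totalDegree_map_inj _ hinj, hf]) hirr (by omega)
    (fun r hr _ => by exact_mod_cast hr.ne') (fun i => Int.castRingHom _ (v i)) (by
      rw [hcomp_map, eval_map_comp]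
      intro h
      apply hv0
      exact hinj (by rw [h, map_zero]))
  rw [← GP_map] at he
  have he' : GP d v f e ≠ 0 := by
    intro h; rw [h, map_zero] at he; exact he rfl
  obtain ⟨x, hx, hx0⟩ := exists_small _ he' (totalDegree_GP hf.le v e)
  set a : σ → ℤ := fun i => x (Sum.inl i) with ha
  set z : σ → ℤ := fun i => x (Sum.inr i) with hz
  have hxe : x = Sum.elim a z := by ext i; rcases i with i | i <;> rfl
  rw [hxe] at hx0
  refine ⟨MvPolynomial.eval v (MvPolynomial.homogeneousComponent d f) * MvPolynomial.eval (Sum.elim a z) (GP d v f e),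
    mul_ne_zero hv0 hx0, ?_, ?_⟩
  · have hd' : (1 : ℤ) ≤ d := by exact_mod_cast hd
    have hd3 : d ≤ d ^ 3 := Nat.le_self_pow (by norm_num) d
    have hA1 : 1 ≤ 5 * d ^ 3 := by have := Nat.pow_pos (n := 3) hd; omega
    have hA : ∀ i, |a i| + |v i| + |z i| ≤ ((5 * d ^ 3 : ℕ) : ℤ) := by
      intro i
      have h1 := hx (Sum.inl i)
      have h2 := hx (Sum.inr i)
      have h3 := hv i
      simp only [ha, hz]
      push_cast at *
      have : (d : ℤ) ≤ d ^ 3 := by exact_mod_cast hd3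
      linarith
    have b1 := eval_bound (MvPolynomial.homogeneousComponent d f) (H := H)
      (MvPolynomial.homogeneousComponent_isHomogeneous d f).totalDegree_le (fun m => by
        rw [MvPolynomial.coeff_homogeneousComponent]
        split_ifs
        · exact hH m
        · simp) v hA1 (fun i => by
          have := hA i
          have := abs_nonneg (a i)
          have := abs_nonneg (z i)
          linarith)
    have b2 := GP_bound f hf.le hH a v z hd hA1 hA hH1 e
    push_cast at b1 b2
    set E : ℤ := (d + 1) ^ Fintype.card σ * H * (5 * d ^ 3) ^ d with hE
    have hE0 : 0 < E := by positivity
    rw [abs_mul, pow_succ', ]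
    apply mul_le_mul _ _ (abs_nonneg _) (by positivity)
    · refine b1.trans ?_
      have : (1 : ℤ) ≤ 4 * d ^ 3 := by
        have := one_le_pow₀ hd' (n := 3)
        linarith
      nlinarith
    · refine b2.trans (le_of_eq ?_)
      ring
  · intro p hp hdp hred
    by_contra hdvd
    apply hred
    let _ : Fact (Nat.Prime p) := ⟨hp⟩
    have hz : ∀ u : ℤ, ((Int.castRingHom (AlgebraicClosure (ZMod p))) u = 0 ↔ (p : ℤ) ∣ u) := by
      intro u
      rw [eq_intCast]
      exact CharP.intCast_eq_zero_iff (AlgebraicClosure (ZMod p)) p u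
    have hv1 : MvPolynomial.eval (fun i => Int.castRingHom (AlgebraicClosure (ZMod p)) (v i))
        (MvPolynomial.homogeneousComponent d (MvPolynomial.map (Int.castRingHom (AlgebraicClosure (ZMod p))) f)) ≠ 0 := by
      rw [hcomp_map, eval_map_comp, Ne, hz]
      intro h
      exact hdvd (h.mul_right _)
    apply irr_of_GP (δ := d) _ (by omega) _ _ hv1 e (fun i => Int.castRingHom _ (a i)) (fun i => Int.castRingHom _ (z i))
    · have : Sum.elim (fun i => Int.castRingHom (AlgebraicClosure (ZMod p)) (a i)) (fun i => Int.castRingHom _ (z i)) =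
          fun i => Int.castRingHom (AlgebraicClosure (ZMod p)) (Sum.elim a z i) := by
        ext i; rcases i with i | i <;> rfl
      rw [this, ← GP_map, eval_map_comp, Ne, hz]
      intro h
      exact hdvd (h.mul_left _)
    · apply le_antisymm
      · rw [← hf]
        exact Finset.sup_mono (MvPolynomial.support_map_subset _ _)
      · by_contra h
        rw [not_le] at h
        rw [MvPolynomial.homogeneousComponent_eq_zero _ _ h, map_zero] at hv1
        exact hv1 rfl
    · intro r hr hrd h
      have := (CharP.cast_eq_zero_iff (AlgebraicClosure (ZMod p)) p r).1 h
      have := Nat.le_of_dvd hr this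
      omega


theorem sum_bad (N : ℕ) : ∃ C : ℝ, 0 < C ∧ ∀ (d : ℕ), 1 ≤ d → ∀ (H : ℕ), 1 ≤ H → ∀ (Y : ℤ), Y ≠ 0 →
    |Y| ≤ (4 * d ^ 3 * ((d + 1) ^ N * H * (5 * d ^ 3) ^ d) : ℤ) ^ (2 * d ^ 2 + 1) →
    ∀ S : Finset ℕ, (∀ p ∈ S, p.Prime ∧ 27 * d ^ 4 < p ∧ (p : ℤ) ∣ Y) →
      Real.exp (∑ p ∈ S, Real.log p / p) ≤ C * (1 + Real.log H / d ^ 2) := by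
  obtain ⟨C0, hC0, hM⟩ := msum_lower
  refine ⟨Real.exp (Real.log 4 + C0 + 1) * (58 + 3 * N), by positivity, ?_⟩
  intro d hd H hH Y hY hYb S hS
  have hd' : (1 : ℝ) ≤ d := by exact_mod_cast hd
  have hH' : (1 : ℝ) ≤ H := by exact_mod_cast hH
  set lH := Real.log H with hlH
  have hlH0 : 0 ≤ lH := Real.log_nonneg hH'
  have hYpos : 0 < |Y| := abs_pos.2 hY
  set L : ℝ := 3 * d ^ 2 * lH + (30 + 3 * N) * d ^ 4 with hL
  have hL0 : 0 ≤ L := by positivity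
  have hld1 : Real.log (d + 1) ≤ d := by
    have := Real.log_le_sub_one_of_pos (show (0 : ℝ) < d + 1 by positivity)
    linarith
  have hld : Real.log d ≤ d - 1 := Real.log_le_sub_one_of_pos (by positivity)
  have hl5 : Real.log 5 ≤ 2 := by
    rw [Real.log_le_iff_le_exp (by norm_num)]
    have := Real.add_one_le_exp (1 : ℝ)
    have h3 : Real.exp 2 = Real.exp 1 * Real.exp 1 := by rw [← Real.exp_add]; norm_num
    have := Real.exp_one_gt_d9
    rw [h3]; nlinarith
  have hl4 : Real.log 4 ≤ 2 := (Real.log_le_log (by norm_num) (by norm_num)).trans hl5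
  have hlogY : Real.log (|Y| : ℤ) ≤ L := by
    have h1 : ((|Y| : ℤ) : ℝ) ≤ (4 * d ^ 3 * ((d + 1) ^ N * H * (5 * d ^ 3) ^ d) : ℝ) ^ (2 * d ^ 2 + 1) := by
      exact_mod_cast hYb
    have h2 := Real.log_le_log (by exact_mod_cast hYpos) h1
    refine h2.trans ?_
    rw [Real.log_pow, Real.log_mul (by positivity) (by positivity), Real.log_mul (by positivity) (by positivity),
      Real.log_mul (by positivity) (by positivity), Real.log_mul (by positivity) (by positivity), Real.log_pow,
      Real.log_pow, Real.log_pow, Real.log_mul (by positivity) (by positivity), Real.log_pow]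
    push_cast
    have h3 : Real.log 4 + 3 * Real.log d + (N * Real.log (d + 1) + Real.log H + d * (Real.log 5 + 3 * Real.log d))
        ≤ lH + (10 + N) * d ^ 2 := by
      have a1 : (N : ℝ) * Real.log (d + 1) ≤ N * d ^ 2 := by
        apply mul_le_mul_of_nonneg_left _ (by positivity)
        nlinarith
      have a2 : (d : ℝ) * (Real.log 5 + 3 * Real.log d) ≤ d * (2 + 3 * (d - 1)) := by
        apply mul_le_mul_of_nonneg_left _ (by positivity)
        linarith
      nlinarith
    have h4 : (2 * (d : ℝ) ^ 2 + 1) ≤ 3 * d ^ 2 := by nlinarith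
    calc _ ≤ (2 * (d : ℝ) ^ 2 + 1) * (lH + (10 + N) * d ^ 2) := mul_le_mul_of_nonneg_left h3 (by positivity)
      _ ≤ (3 * d ^ 2) * (lH + (10 + N) * d ^ 2) := mul_le_mul_of_nonneg_right h4 (by positivity)
      _ = L := by rw [hL]; ring
  set Z : ℕ := ⌈L⌉₊ + 27 * d ^ 4 with hZ
  have hd4 : 1 ≤ d ^ 4 := Nat.one_le_pow _ _ hd
  have hZ1 : 1 ≤ Z := by omega
  have hZL : L ≤ Z := by
    rw [hZ]; push_cast
    have := Nat.le_ceil L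
    have : (0 : ℝ) ≤ d ^ 4 := by positivity
    linarith
  have hZ' : (0 : ℝ) < Z := by exact_mod_cast hZ1
  have hZu : (Z : ℝ) ≤ (58 + 3 * N) * d ^ 4 * (1 + lH / d ^ 2) := by
    rw [hZ]; push_cast
    have h1 := (Nat.ceil_lt_add_one hL0).le
    have h2 : (1 : ℝ) ≤ d ^ 4 := by exact_mod_cast hd4
    have h3 : (58 + 3 * N) * (d : ℝ) ^ 4 * (1 + lH / d ^ 2) = (58 + 3 * N) * d ^ 4 + (58 + 3 * N) * d ^ 2 * lH := by
      field_simp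
    rw [h3]
    have h4 : (0 : ℝ) ≤ d ^ 2 * lH := by positivity
    have h5 : (0 : ℝ) ≤ N * (d ^ 2 * lH) := by positivity
    nlinarith
  have hprod : ∑ p ∈ S, Real.log p ≤ L := by
    refine le_trans ?_ hlogY
    have hdvd : (∏ p ∈ S, p) ∣ Y.natAbs := by
      apply Finset.prod_primes_dvd
      · intro p hp; exact (hS p hp).1.prime
      · intro p hp
        exact Int.natCast_dvd.1 (hS p hp).2.2
    have h1 := Nat.le_of_dvd (Int.natAbs_pos.2 hY) hdvd
    rw [← Real.log_prod (fun p hp => by exact_mod_cast (hS p hp).1.ne_zero)]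
    apply Real.log_le_log
    · apply Finset.prod_pos
      intro p hp; exact_mod_cast (hS p hp).1.pos
    · have : ((|Y| : ℤ) : ℝ) = (Y.natAbs : ℝ) := by rw [Int.abs_eq_natAbs]; simp
      rw [this, ← Nat.cast_prod]; exact_mod_cast h1
  have hsum : ∑ p ∈ S, Real.log p / p ≤ Real.log 4 + C0 + 1 + Real.log (Z / (d : ℝ) ^ 4) := by
    have hlp : ∀ p : ℕ, 0 ≤ Real.log p / p := fun p => div_nonneg (Real.log_natCast_nonneg p) (by positivity)
    rw [← Finset.sum_filter_add_sum_filter_not S (fun p => p ≤ Z)]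
    have s1 : ∑ p ∈ S.filter (fun p => p ≤ Z), Real.log p / p ≤ msum Z - msum (27 * d ^ 4) := by
      have : ∑ p ∈ S.filter (fun p => p ≤ Z), Real.log p / p + msum (27 * d ^ 4) ≤ msum Z := by
        rw [msum, ← Finset.sum_union]
        · apply Finset.sum_le_sum_of_subset_of_nonneg
          · intro p hp
            rw [Finset.mem_union, Finset.mem_filter, mem_prs] at hp
            rw [mem_prs]
            rcases hp with hp | hp
            · exact ⟨hp.2, (hS p hp.1).1⟩
            · exact ⟨by omega, hp.2⟩
          · intro p _ _; exact hlp p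
        · rw [Finset.disjoint_left]
          intro p hp hp'
          rw [Finset.mem_filter] at hp
          rw [mem_prs] at hp'
          have := (hS p hp.1).2.1
          omega
      linarith
    have s2 : ∑ p ∈ S.filter (fun p => ¬ p ≤ Z), Real.log p / p ≤ 1 := by
      have : ∑ p ∈ S.filter (fun p => ¬ p ≤ Z), Real.log p / p ≤ ∑ p ∈ S.filter (fun p => ¬ p ≤ Z), Real.log p / Z := by
        apply Finset.sum_le_sum
        intro p hp
        rw [Finset.mem_filter] at hp
        apply div_le_div_of_nonneg_left (Real.log_natCast_nonneg p) hZ'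
        have := hp.2
        exact_mod_cast (by omega : Z ≤ p)
      refine this.trans ?_
      rw [← Finset.sum_div, div_le_one hZ']
      refine le_trans ?_ (hprod.trans hZL)
      exact Finset.sum_le_sum_of_subset_of_nonneg (Finset.filter_subset _ _) (fun p _ _ => Real.log_natCast_nonneg p)
    have s3 := msum_upper hZ1
    have s4 := hM (27 * d ^ 4) (by omega)
    have s5 : Real.log (Z / (d : ℝ) ^ 4) = Real.log Z - Real.log ((d : ℝ) ^ 4) := Real.log_div hZ'.ne' (by positivity)
    have s6 : Real.log ((d : ℝ) ^ 4) ≤ Real.log ((27 * d ^ 4 : ℕ) : ℝ) := by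
      apply Real.log_le_log (by positivity)
      push_cast
      have : (0 : ℝ) ≤ d ^ 4 := by positivity
      linarith
    linarith
  refine (Real.exp_le_exp.2 hsum).trans ?_
  rw [Real.exp_add, Real.exp_log (by positivity), mul_assoc]
  apply mul_le_mul_of_nonneg_left _ (Real.exp_pos _).le
  rw [div_le_iff₀ (by positivity)]
  refine hZu.trans (le_of_eq ?_)
  ring

end EV

namespace EV

/-- exponents of degree less than `J` -/
noncomputable def mons (N J : ℕ) : Finset (Fin N →₀ ℕ) :=
  (Finset.range J).biUnion fun j => Finset.finsuppAntidiag Finset.univ j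

theorem mem_mons {N J : ℕ} {m : Fin N →₀ ℕ} : m ∈ mons N J ↔ m.degree < J := by
  simp [mons, Finsupp.degree_eq_sum]

theorem card_mons (n J : ℕ) : (mons (n + 1) J).card = (J + n).choose (n + 1) := by
  rw [mons, Finset.card_biUnion]
  · have : ∀ j ∈ Finset.range J, (Finset.finsuppAntidiag (Finset.univ : Finset (Fin (n + 1))) j).card = (n + j).choose n := by
      intro j _
      rw [Finset.card_finsuppAntidiag_nat_eq_choose]
      simp only [Finset.card_univ, Fintype.card_fin]
      rw [show n + 1 + j - 1 = n + j by omega, ← Nat.choose_symm_add]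
    rw [Finset.sum_congr rfl this]
    induction J with
    | zero => simp
    | succ J ih =>
      rw [Finset.sum_range_succ, ih, show J + 1 + n = (n + J) + 1 by omega, Nat.choose_succ_succ, add_comm J n, add_comm]
      intro j hj
      exact this j (Finset.mem_range.2 ((Finset.mem_range.1 hj).trans (Nat.lt_succ_self J)))
  · intro i _ j _ hij
    rw [Function.onFun, Finset.disjoint_left]
    intro m hm hm'
    rw [Finset.mem_finsuppAntidiag] at hm hm'
    exact hij (hm.1.symm.trans hm'.1)

theorem det_dvd {ι L : Type*} [Fintype ι] [DecidableEq ι] [Fintype L] [DecidableEq L] (p J : ℕ) (w : L → ℕ)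
    (hw : ∀ l, w l ≤ J) (X : ι → L → ℤ) (E : L → ι → ℤ) (hX : ∀ i l, (p : ℤ) ^ w l ∣ X i l) :
    (p : ℤ) ^ (J * Fintype.card ι - ∑ l, (J - w l)) ∣ (Matrix.of fun i j => ∑ l, X i l * E l j).det := by
  have h1 : (Matrix.of fun i j => ∑ l, X i l * E l j).det =
      (Matrix.detRowAlternating : (ι → ℤ) [⋀^ι]→ₗ[ℤ] ℤ).toMultilinearMap (fun i => ∑ l, X i l • E l) := by
    change Matrix.det _ = Matrix.det _
    congr 1
    ext i j
    simp [Finset.sum_apply]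
  rw [h1, MultilinearMap.map_sum]
  apply Finset.dvd_sum
  intro r _
  rw [MultilinearMap.map_smul_univ, smul_eq_mul]
  by_cases hr : Function.Injective r
  · apply Dvd.dvd.mul_right
    have h2 : (p : ℤ) ^ (∑ i, w (r i)) ∣ ∏ i, X i (r i) := by
      rw [← Finset.prod_pow_eq_pow_sum]
      exact Finset.prod_dvd_prod_of_dvd _ _ fun i _ => hX i (r i)
    refine dvd_trans (pow_dvd_pow _ ?_) h2
    have h3 : ∑ i, (J - w (r i)) ≤ ∑ l, (J - w l) := by
      rw [← Finset.sum_image (f := fun l => J - w l) (g := r) (fun x _ y _ h => hr h)]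
      exact Finset.sum_le_sum_of_subset (Finset.subset_univ _)
    have h4 : ∑ i, (J - w (r i)) + ∑ i, w (r i) = J * Fintype.card ι := by
      rw [← Finset.sum_add_distrib]
      rw [Finset.sum_congr rfl fun i _ => Nat.sub_add_cancel (hw (r i))]
      simp [mul_comm]
    omega
  · have : (Matrix.detRowAlternating : (ι → ℤ) [⋀^ι]→ₗ[ℤ] ℤ).toMultilinearMap (fun i => E (r i)) = 0 := by
      rw [Function.Injective] at hr
      push Not at hr
      obtain ⟨i, j, hij, hne⟩ := hr
      exact AlternatingMap.map_eq_zero_of_eq _ _ (by simp [hij]) hne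
    rw [this, mul_zero]
    exact dvd_zero _

/-- reduced exponents -/
noncomputable def redK (N J : ℕ) (m0 : Fin N →₀ ℕ) : Finset (Fin N →₀ ℕ) := by
  classical exact (mons N J).filter (fun m => ¬ m0 ≤ m)

theorem mem_redK {N J : ℕ} {m0 m : Fin N →₀ ℕ} : m ∈ redK N J m0 ↔ m.degree < J ∧ ¬ m0 ≤ m := by
  classical
  rw [redK, Finset.mem_filter, mem_mons]

theorem sum_redK_le (N J : ℕ) (m0 : Fin N →₀ ℕ) :
    ∑ m ∈ redK N J m0, (J - m.degree) ≤ m0.degree * (mons N J).card := by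
  classical
  have h1 : ∑ m ∈ redK N J m0, (J - m.degree) = ((redK N J m0).sigma fun m => Finset.range (J - m.degree)).card := by
    rw [Finset.card_sigma]; simp
  have h2 : m0.degree * (mons N J).card =
      (((Finset.univ : Finset (Fin N)).sigma fun i => Finset.range (m0 i)) ×ˢ mons N J).card := by
    rw [Finset.card_product, Finset.card_sigma, Finsupp.degree_eq_sum]; simp
  rw [h1, h2]
  have hex : ∀ m, m ∈ redK N J m0 → ∃ i, m i < m0 i := by
    intro m hm
    have := (mem_redK.1 hm).2
    rw [Finsupp.le_def] at this
    push Not at this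
    exact this
  by_cases hN : Nonempty (Fin N)
  · have hex' : ∀ m, ∃ i, m ∈ redK N J m0 → m i < m0 i := by
      intro m
      by_cases hm : m ∈ redK N J m0
      · obtain ⟨i, hi⟩ := hex m hm
        exact ⟨i, fun _ => hi⟩
      · exact ⟨hN.some, fun h => absurd h hm⟩
    choose I hI using hex'
    apply Finset.card_le_card_of_injOn
      (fun x : (Σ _ : Fin N →₀ ℕ, ℕ) => ((⟨I x.1, x.1 (I x.1)⟩ : Σ _ : Fin N, ℕ), x.1.update (I x.1) x.2))
    · rintro ⟨m, t⟩ hx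
      simp only [Finset.coe_sigma, Set.mem_sigma_iff, Finset.mem_coe, Finset.mem_range] at hx
      simp only [Finset.coe_product, Set.mem_prod, Finset.mem_coe, Finset.mem_sigma, Finset.mem_univ, true_and,
        Finset.mem_range, mem_mons]
      refine ⟨hI m hx.1, ?_⟩
      have : (m.update (I m) t).degree ≤ m.degree + t := by
        rw [Finsupp.degree_eq_sum, Finsupp.degree_eq_sum]
        rw [← Finset.add_sum_erase _ _ (Finset.mem_univ (I m)), ← Finset.add_sum_erase _ (fun i => m i) (Finset.mem_univ (I m))]
        have : ∑ x ∈ Finset.univ.erase (I m), (m.update (I m) t) x = ∑ x ∈ Finset.univ.erase (I m), m x := by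
          apply Finset.sum_congr rfl
          intro x hx
          rw [Finsupp.update_apply, if_neg (Finset.ne_of_mem_erase hx)]
        rw [this, Finsupp.update_apply, if_pos rfl]
        omega
      omega
    · rintro ⟨m, t⟩ hx ⟨m', t'⟩ hx' h
      simp only [Prod.mk.injEq, Sigma.mk.injEq, heq_eq_eq] at h
      obtain ⟨⟨h3, h4⟩, h5⟩ := h
      have e1 : t = t' := by
        have := DFunLike.congr_fun h5 (I m)
        rw [Finsupp.update_apply, Finsupp.update_apply, if_pos rfl, if_pos h3] at this
        exact this
      have e2 : m = m' := by
        ext i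
        by_cases hi : i = I m
        · rw [hi, h4, ← h3]
        · have := DFunLike.congr_fun h5 i
          rw [Finsupp.update_apply, Finsupp.update_apply, if_neg hi, if_neg (by rwa [← h3])] at this
          exact this
      rw [e1, e2]
  · have : redK N J m0 = ∅ := by
      apply Finset.eq_empty_of_forall_notMem
      intro m hm
      exact hN ⟨(hex m hm).choose⟩
    rw [this]; simp

end EV

namespace EV

open MvPolynomial

theorem shift_map {R S σ : Type*} [CommRing R] [CommRing S] (φ : R →+* S) (c : σ → R) (f : MvPolynomial σ R) :
    map φ (shift c f) = shift (fun i => φ (c i)) (map φ f) := by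
  have : (map φ).comp (shift c) = (shift (fun i => φ (c i))).comp (map φ) := by
    apply MvPolynomial.ringHom_ext
    · intro r; simp [shift]
    · intro i; simp [shift]
  exact RingHom.congr_fun this f

theorem exists_min_exp {N p : ℕ} [Fact p.Prime] (c : Fin N → ZMod p) (f : MvPolynomial (Fin N) (ZMod p)) (hf : f ≠ 0) :
    ∃ m0 ∈ (shift c f).support, m0.degree = mu c f ∧
      ∀ m ∈ (shift c f).support, m ≠ m0 → MonomialOrder.degLex.toSyn m0 < MonomialOrder.degLex.toSyn m := by
  obtain ⟨m1, hm1, hm1'⟩ := exists_mu c f hf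
  obtain ⟨m0, hm0, hmin⟩ := Finset.exists_min_image (shift c f).support (fun m => MonomialOrder.degLex.toSyn m) ⟨m1, hm1⟩
  refine ⟨m0, hm0, ?_, ?_⟩
  · apply le_antisymm _ (mu_le c f hm0)
    rw [← hm1']
    have := hmin m1 hm1
    rw [MonomialOrder.degLex_le_iff] at this
    exact Finsupp.DegLex.monotone_degree this
  · intro m hm hne
    apply lt_of_le_of_ne (hmin m hm)
    intro h
    exact hne (MonomialOrder.degLex.toSyn.injective h).symm

theorem padic_reduce {N p : ℕ} [hp : Fact p.Prime] (f : MvPolynomial (Fin N) ℤ) (c : Fin N → ZMod p)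
    (hf : map (Int.castRingHom (ZMod p)) f ≠ 0) (J : ℕ) :
    ∃ m0 : Fin N →₀ ℕ, m0.degree = mu c (map (Int.castRingHom (ZMod p)) f) ∧
      ∀ u : MvPolynomial (Fin N) ℤ, ∃ a : (Fin N →₀ ℕ) → ℤ, ∀ P : Fin N → ℤ, (∀ i, (P i : ZMod p) = c i) →
        eval P f = 0 →
        (p : ℤ) ^ J ∣ eval P u - ∑ m ∈ redK N J m0, a m * ∏ i, (P i - (c i).val) ^ m i := by
  classical
  obtain ⟨m0, hm0, hdeg, hmin⟩ := exists_min_exp c _ hf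
  refine ⟨m0, hdeg, ?_⟩
  set ct : Fin N → ℤ := fun i => ((c i).val : ℤ) with hct
  have hctc : (fun i => Int.castRingHom (ZMod p) (ct i)) = c := by
    ext i; simp [hct]
  set F := shift ct f with hF
  have hFm : map (Int.castRingHom (ZMod p)) F = shift c (map (Int.castRingHom (ZMod p)) f) := by
    rw [hF, shift_map, hctc]
  have hFc : ∀ m, ((F.coeff m : ℤ) : ZMod p) = (shift c (map (Int.castRingHom (ZMod p)) f)).coeff m := by
    intro m; rw [← hFm, coeff_map]; rfl
  let Ω := {P : Fin N → ℤ // (∀ i, (P i : ZMod p) = c i) ∧ eval P f = 0}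
  let ev : MvPolynomial (Fin N) ℤ →ₗ[ℤ] (Ω → ℤ) :=
    { toFun := fun u P => eval P.1 u
      map_add' := fun u v => by ext P; simp
      map_smul' := fun r u => by ext P; simp }
  have hev : ∀ u (P : Ω), ev u P = eval P.1 u := fun _ _ => rfl
  let ym : (Fin N →₀ ℕ) → MvPolynomial (Fin N) ℤ := fun m => ∏ i, (X i - C (ct i)) ^ m i
  have hym : ∀ m (P : Fin N → ℤ), eval P (ym m) = ∏ i, (P i - ct i) ^ m i := by
    intro m P; simp [ym]
  have hymadd : ∀ m m', ym (m + m') = ym m * ym m' := by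
    intro m m'
    simp only [ym, Finsupp.add_apply, pow_add, Finset.prod_mul_distrib]
  let S1 : ((Fin N →₀ ℕ) → ℤ) →ₗ[ℤ] (Ω → ℤ) :=
    ∑ m ∈ redK N J m0, (LinearMap.proj m : ((Fin N →₀ ℕ) → ℤ) →ₗ[ℤ] ℤ).smulRight (ev (ym m))
  have hS1 : ∀ a P, S1 a P = ∑ m ∈ redK N J m0, a m * eval P.1 (ym m) := by
    intro a P
    simp [S1, Finset.sum_apply, hev]
  let S : Submodule ℤ (Ω → ℤ) := LinearMap.range S1 ⊔ LinearMap.range (((p : ℤ) ^ J) • (LinearMap.id : (Ω → ℤ) →ₗ[ℤ] (Ω → ℤ)))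
  let Q : Submodule ℤ (Ω → ℤ) := S ⊔ LinearMap.range ((p : ℤ) • ev)
  have hpy : ∀ (P : Ω) i, (p : ℤ) ∣ P.1 i - ct i := by
    intro P i
    rw [← ZMod.intCast_zmod_eq_zero_iff_dvd]
    have := congrFun hctc i
    rw [eq_intCast] at this
    rw [Int.cast_sub, P.2.1 i, this, sub_self]
  have hpQ : ∀ u : MvPolynomial (Fin N) ℤ, ev ((p : ℤ) • u) ∈ Q := by
    intro u
    apply Submodule.mem_sup_right
    exact ⟨u, by rw [LinearMap.map_smul]; rfl⟩
  have hpQ' : ∀ (z : ℤ) (u : MvPolynomial (Fin N) ℤ), (p : ℤ) ∣ z → ev (z • u) ∈ Q := by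
    rintro z u ⟨y, rfl⟩
    rw [mul_smul]; exact hpQ _
  have hbig : ∀ m : Fin N →₀ ℕ, J ≤ m.degree → ev (ym m) ∈ Q := by
    intro m hm
    apply Submodule.mem_sup_left
    apply Submodule.mem_sup_right
    have : ∀ P : Ω, (p : ℤ) ^ J ∣ ev (ym m) P := by
      intro P
      rw [hev, hym]
      refine (pow_dvd_pow _ hm).trans ?_
      rw [Finsupp.degree_eq_sum, ← Finset.prod_pow_eq_pow_sum]
      exact Finset.prod_dvd_prod_of_dvd _ _ fun i _ => pow_dvd_pow_of_dvd (hpy P i) _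
    choose g hg using this
    refine ⟨g, ?_⟩
    ext P
    rw [hg P]; rfl
  have hexp : ∀ u, ev u = ∑ m ∈ (shift ct u).support, (shift ct u).coeff m • ev (ym m) := by
    intro u
    conv_lhs => rw [expand_shift ct u]
    rw [map_sum]
    apply Finset.sum_congr rfl
    intro m _
    rw [← smul_eq_C_mul, LinearMap.map_smul]
  have hrel : ∀ u : MvPolynomial (Fin N) ℤ, ev (f * u) = 0 := by
    intro u; ext P; rw [hev, RingHom.map_mul, P.2.2, zero_mul]; rfl
  -- the main induction
  have hmain : ∀ k : ℕ, ∀ m : Fin N →₀ ℕ,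
      ((mons N J).filter (fun m' => MonomialOrder.degLex.toSyn m < MonomialOrder.degLex.toSyn m')).card ≤ k →
      ev (ym m) ∈ Q := by
    intro k
    induction k using Nat.strong_induction_on with
    | _ k ih =>
    intro m hk
    by_cases hmJ : J ≤ m.degree
    · exact hbig m hmJ
    rw [not_le] at hmJ
    by_cases hm : m0 ≤ m
    · obtain ⟨r, rfl⟩ := exists_add_of_le hm
      have hne : ((F.coeff m0 : ℤ) : ZMod p) ≠ 0 := by rw [hFc]; exact mem_support_iff.1 hm0
      obtain ⟨g, hg⟩ := ZMod.intCast_surjective (((F.coeff m0 : ℤ) : ZMod p)⁻¹)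
      have hg1 : (p : ℤ) ∣ 1 - g * F.coeff m0 := by
        rw [← ZMod.intCast_zmod_eq_zero_iff_dvd]
        push_cast
        rw [hg, inv_mul_cancel₀ hne, sub_self]
      have hFs : m0 ∈ F.support := by
        rw [mem_support_iff]; intro h; rw [h] at hne; simp at hne
      have e1 : f * ym r = ∑ m ∈ F.support, F.coeff m • ym (m + r) := by
        conv_lhs => rw [expand_shift ct f]
        rw [Finset.sum_mul]
        apply Finset.sum_congr rfl
        intro m _
        rw [hymadd, smul_eq_C_mul, mul_assoc]
      have e2 := hrel (ym r)
      rw [e1, map_sum, ← Finset.add_sum_erase _ _ hFs] at e2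
      have e3 : ev (ym (m0 + r)) = ev ((1 - g * F.coeff m0) • ym (m0 + r)) -
          g • ∑ x ∈ F.support.erase m0, ev (F.coeff x • ym (x + r)) := by
        rw [eq_neg_of_add_eq_zero_right e2, LinearMap.map_smul, LinearMap.map_smul, smul_neg, sub_neg_eq_add,
          smul_smul, ← add_smul, sub_add_cancel, one_smul]
      rw [e3]
      apply Submodule.sub_mem _ (hpQ' _ _ hg1)
      apply Submodule.smul_mem
      apply Submodule.sum_mem
      intro x hx
      rw [Finset.mem_erase] at hx
      by_cases hxp : (p : ℤ) ∣ F.coeff x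
      · exact hpQ' _ _ hxp
      · rw [LinearMap.map_smul]
        apply Submodule.smul_mem
        have hx' : x ∈ (shift c (map (Int.castRingHom (ZMod p)) f)).support := by
          rw [mem_support_iff, ← hFc, Ne, ZMod.intCast_zmod_eq_zero_iff_dvd]
          exact hxp
        have hlt : MonomialOrder.degLex.toSyn (m0 + r) < MonomialOrder.degLex.toSyn (x + r) := by
          rw [map_add, map_add]
          exact add_lt_add_left (hmin x hx' hx.1) _
        by_cases hxJ : J ≤ (x + r).degree
        · exact hbig _ hxJ
        rw [not_le] at hxJ
        refine ih _ (lt_of_lt_of_le ?_ hk) (x + r) le_rfl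
        apply Finset.card_lt_card
        rw [Finset.ssubset_iff_of_subset]
        · exact ⟨x + r, by rw [Finset.mem_filter, mem_mons]; exact ⟨hxJ, hlt⟩, by simp⟩
        · intro y hy
          rw [Finset.mem_filter] at hy ⊢
          exact ⟨hy.1, hlt.trans hy.2⟩
    · apply Submodule.mem_sup_left
      apply Submodule.mem_sup_left
      refine ⟨Pi.single m 1, ?_⟩
      ext P
      rw [hS1, Finset.sum_eq_single m, Pi.single_eq_same, one_mul, hev]
      · intro b _ hb; rw [Pi.single_eq_of_ne hb, zero_mul]
      · intro h; exact absurd (mem_redK.2 ⟨hmJ, hm⟩) h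
  have hQ : ∀ u, ev u ∈ Q := by
    intro u
    rw [hexp]
    exact Submodule.sum_mem _ fun m _ => Submodule.smul_mem _ _ (hmain _ m le_rfl)
  have hk : ∀ k : ℕ, ∀ u, ∃ s ∈ S, ∃ u', ev u = s + (p : ℤ) ^ k • ev u' := by
    intro k
    induction k with
    | zero => intro u; exact ⟨0, S.zero_mem, u, by simp⟩
    | succ k ih =>
      intro u
      obtain ⟨s, hs, u', h⟩ := ih u
      obtain ⟨s', hs', t, ⟨u'', hu''⟩, h'⟩ := Submodule.mem_sup.1 (hQ u')
      refine ⟨s + (p : ℤ) ^ k • s', S.add_mem hs (S.smul_mem _ hs'), u'', ?_⟩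
      rw [h, ← h', ← hu'', smul_add, LinearMap.smul_apply, smul_smul, pow_succ, add_assoc]
  intro u
  obtain ⟨s, hs, u', h⟩ := hk J u
  obtain ⟨s1, ⟨a, ha⟩, s2, ⟨b, hb⟩, hss⟩ := Submodule.mem_sup.1 hs
  refine ⟨a, fun P hP hPf => ?_⟩
  have h1 := congrFun h ⟨P, hP, hPf⟩
  rw [hev, ← hss, ← ha, ← hb] at h1
  simp only [Pi.add_apply, hS1, LinearMap.smul_apply, LinearMap.id_apply, Pi.smul_apply, smul_eq_mul] at h1
  refine ⟨b ⟨P, hP, hPf⟩ + ev u' ⟨P, hP, hPf⟩, ?_⟩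
  rw [h1]
  simp only [hym]
  ring

end EV

namespace EV

open MvPolynomial

theorem padic_dvd {N p : ℕ} [hp : Fact p.Prime] (f : MvPolynomial (Fin N) ℤ)
    (hf : map (Int.castRingHom (ZMod p)) f ≠ 0) {ι : Type*} [Fintype ι] [DecidableEq ι]
    (P : ι → Fin N → ℤ) (hP : ∀ i, eval (P i) f = 0) (u : ι → MvPolynomial (Fin N) ℤ) (J : ℕ) :
    (p : ℤ) ^ (J * Fintype.card ι -
        (∑ c : Fin N → ZMod p, mu c (map (Int.castRingHom (ZMod p)) f)) * (mons N J).card) ∣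
      (Matrix.of fun i j => eval (P i) (u j)).det := by
  classical
  choose m0 hm0 hred using fun c => padic_reduce f c hf J
  choose a ha using hred
  let cl : ι → Fin N → ZMod p := fun i k => (P i k : ZMod p)
  have hR : ∀ i j, (p : ℤ) ^ J ∣ eval (P i) (u j) -
      ∑ m ∈ redK N J (m0 (cl i)), a (cl i) (u j) m * ∏ k, (P i k - (cl i k).val) ^ m k := by
    intro i j
    exact ha (cl i) (u j) (P i) (fun k => rfl) (hP i)
  choose R hR using hR
  let L := (Σ c : Fin N → ZMod p, {m // m ∈ redK N J (m0 c)}) ⊕ ι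
  let w : L → ℕ := Sum.elim (fun x => x.2.1.degree) (fun _ => J)
  let XX : ι → L → ℤ := fun i => Sum.elim
    (fun x => if x.1 = cl i then ∏ k, (P i k - (x.1 k).val) ^ x.2.1 k else 0) (fun i' => if i' = i then (p : ℤ) ^ J else 0)
  let E : L → ι → ℤ := Sum.elim (fun x j => a x.1 (u j) x.2.1) (fun i j => R i j)
  have hw : ∀ l, w l ≤ J := by
    rintro (⟨c, m, hm⟩ | i)
    · exact (mem_redK.1 hm).1.le
    · exact le_rfl
  have hX : ∀ i l, (p : ℤ) ^ w l ∣ XX i l := by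
    rintro i (⟨c, m, hm⟩ | i')
    · change (p : ℤ) ^ m.degree ∣ if c = cl i then ∏ k, (P i k - (c k).val) ^ m k else 0
      split_ifs with h
      · rw [Finsupp.degree_eq_sum, ← Finset.prod_pow_eq_pow_sum]
        apply Finset.prod_dvd_prod_of_dvd
        intro k _
        apply pow_dvd_pow_of_dvd
        rw [← ZMod.intCast_zmod_eq_zero_iff_dvd, h]
        simp [cl]
      · exact dvd_zero _
    · change (p : ℤ) ^ J ∣ if i' = i then (p : ℤ) ^ J else 0
      split_ifs
      · exact dvd_rfl
      · exact dvd_zero _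
  have key := det_dvd p J w hw XX E hX
  have e1 : (Matrix.of fun i j => ∑ l, XX i l * E l j) = Matrix.of fun i j => eval (P i) (u j) := by
    ext i j
    rw [Matrix.of_apply, Matrix.of_apply, Fintype.sum_sum_type, Fintype.sum_sigma, Finset.sum_eq_single (cl i)]
    · have h1 : ∑ x : {m // m ∈ redK N J (m0 (cl i))}, XX i (Sum.inl ⟨cl i, x⟩) * E (Sum.inl ⟨cl i, x⟩) j =
          ∑ m ∈ redK N J (m0 (cl i)), a (cl i) (u j) m * ∏ k, (P i k - (cl i k).val) ^ m k := by
        rw [← Finset.sum_coe_sort (redK N J (m0 (cl i)))]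
        apply Finset.sum_congr rfl
        intro x _
        simp only [XX, E, Sum.elim_inl, if_true]
        ring
      have h2 : ∑ x : ι, XX i (Sum.inr x) * E (Sum.inr x) j = (p : ℤ) ^ J * R i j := by
        rw [Finset.sum_eq_single i]
        · simp [XX, E]
        · intro b _ hb
          simp [XX, hb]
        · simp
      rw [h1, h2, ← hR]
      ring
    · intro c _ hc
      apply Finset.sum_eq_zero
      intro x _
      simp [XX, hc]
    · simp
  rw [e1] at key
  refine (pow_dvd_pow _ ?_).trans key
  apply Nat.sub_le_sub_left
  rw [Fintype.sum_sum_type, Fintype.sum_sigma, Finset.sum_mul]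
  have h3 : ∑ x : ι, (J - w (Sum.inr x)) = 0 := by
    apply Finset.sum_eq_zero
    intro x _
    simp [w]
  rw [h3, add_zero]
  apply Finset.sum_le_sum
  intro c _
  rw [← hm0 c]
  refine le_trans (le_of_eq ?_) (sum_redK_le N J (m0 c))
  rw [← Finset.sum_coe_sort (redK N J (m0 c))]
  rfl

end EV

namespace EV

open MvPolynomial

theorem totalDegree_le_iff {N M : ℕ} {R : Type*} [CommRing R] {q : MvPolynomial (Fin N) R} :
    q.totalDegree ≤ M ↔ ∀ m ∈ q.support, m ∈ mons N (M + 1) := by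
  constructor
  · intro h m hm
    rw [mem_mons, Nat.lt_succ_iff]
    exact (degree_le_totalDegree hm).trans h
  · intro h
    rw [MvPolynomial.totalDegree]
    apply Finset.sup_le
    intro m hm
    have := h m hm
    rw [mem_mons, Nat.lt_succ_iff] at this
    refine le_trans (le_of_eq ?_) this
    rw [Finsupp.degree]; rfl

/-- polynomial from coefficients -/
noncomputable def ofCo {N J : ℕ} {R : Type*} [CommRing R] : (mons N J → R) →ₗ[R] MvPolynomial (Fin N) R :=
  ∑ m : mons N J, (monomial m.1).comp (LinearMap.proj m)

theorem ofCo_apply {N J : ℕ} {R : Type*} [CommRing R] (c : mons N J → R) :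
    ofCo c = ∑ m : mons N J, monomial m.1 (c m) := by
  simp [ofCo]

theorem coeff_ofCo {N J : ℕ} {R : Type*} [CommRing R] (c : mons N J → R) (m : mons N J) :
    (ofCo c).coeff m.1 = c m := by
  classical
  rw [ofCo_apply, coeff_sum, Finset.sum_eq_single m]
  · rw [coeff_monomial, if_pos rfl]
  · intro b _ hb
    rw [coeff_monomial, if_neg (fun h => hb (Subtype.ext h))]
  · simp

theorem support_ofCo {N J : ℕ} {R : Type*} [CommRing R] (c : mons N J → R) (m) (hm : m ∈ (ofCo c).support) : m ∈ mons N J := by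
  classical
  by_contra h
  rw [mem_support_iff] at hm
  apply hm
  rw [ofCo_apply, coeff_sum]
  apply Finset.sum_eq_zero
  intro b _
  rw [coeff_monomial, if_neg]
  rintro rfl
  exact h b.2

theorem ofCo_coeff {N J : ℕ} {R : Type*} [CommRing R] (q : MvPolynomial (Fin N) R) (hq : ∀ m ∈ q.support, m ∈ mons N J) :
    ofCo (fun m : mons N J => q.coeff m.1) = q := by
  ext m
  by_cases hm : m ∈ mons N J
  · exact coeff_ofCo (J := J) (fun m => q.coeff m.1) ⟨m, hm⟩
  · have h1 : m ∉ q.support := fun h => hm (hq m h)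
    have h2 : m ∉ (ofCo (fun m : mons N J => q.coeff m.1)).support := fun h => hm (support_ofCo _ _ h)
    rw [notMem_support_iff] at h1 h2
    rw [h1, h2]

theorem not_C_dvd {σ : Type*} {f : MvPolynomial σ ℤ} (hprim : Finset.gcd f.support f.coeff = 1) {p : ℤ} (hp : Prime p) : ¬ C p ∣ f := by
  intro h
  rw [C_dvd_iff_dvd_coeff] at h
  have : p ∣ Finset.gcd f.support f.coeff := Finset.dvd_gcd fun m _ => h m
  rw [hprim] at this
  exact hp.not_isUnit (isUnit_of_dvd_one this)

theorem C_dvd_of_mul {σ : Type*} {f : MvPolynomial σ ℤ} (hprim : Finset.gcd f.support f.coeff = 1) (k : ℤ) (hk : k ≠ 0) :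
    ∀ h : MvPolynomial σ ℤ, C k ∣ f * h → C k ∣ h := by
  induction k using UniqueFactorizationMonoid.induction_on_prime with
  | h₁ => exact absurd rfl hk
  | h₂ x hx => intro h _; exact (hx.map C).dvd
  | h₃ a p ha hp ih =>
    intro h hdvd
    have hp' : Prime (C p : MvPolynomial σ ℤ) := (prime_C_iff σ).2 hp
    rw [C_mul] at hdvd ⊢
    have h1 : C p ∣ f * h := (dvd_mul_right _ _).trans hdvd
    rcases hp'.dvd_or_dvd h1 with h2 | ⟨h', rfl⟩
    · exact absurd h2 (not_C_dvd hprim hp)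
    · apply mul_dvd_mul_left
      apply ih ha
      rw [mul_left_comm] at hdvd
      exact (mul_dvd_mul_iff_left hp'.ne_zero).1 hdvd

theorem exists_quot_basis {N d M : ℕ} {f : MvPolynomial (Fin N) ℤ} (hf : f.totalDegree = d) (hf0 : f ≠ 0)
    (hprim : Finset.gcd f.support f.coeff = 1) (hM : d ≤ M) :
    ∃ u : Fin ((mons N (M + 1)).card - (mons N (M + 1 - d)).card) → MvPolynomial (Fin N) ℤ,
      (∀ q : MvPolynomial (Fin N) ℤ, q.totalDegree ≤ M → ∃ c : _ → ℤ, ∃ h : MvPolynomial (Fin N) ℤ,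
        h.totalDegree ≤ M - d ∧ q = ∑ j, c j • u j + f * h) ∧
      (∀ j, (u j).totalDegree ≤ M) ∧
      (∀ c : _ → ℤ, f ∣ ∑ j, c j • u j → c = 0) := by
  classical
  have hMd : M + 1 - d = (M - d) + 1 := by omega
  rw [hMd]
  let φ : (mons N (M - d + 1) → ℤ) →ₗ[ℤ] (mons N (M + 1) → ℤ) :=
    { toFun := fun h m => (f * ofCo h).coeff m.1
      map_add' := fun a b => by ext m; simp [mul_add]
      map_smul' := fun r a => by
        ext m
        rw [LinearMap.map_smul, mul_smul_comm, coeff_smul]; rfl }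
  have hφ : ∀ h, ofCo (φ h) = f * ofCo h := by
    intro h
    apply ofCo_coeff
    rw [← totalDegree_le_iff]
    have h1 := totalDegree_le_iff.2 (support_ofCo h)
    have := totalDegree_mul f (ofCo h)
    omega
  have hoinj : ∀ J, Function.Injective (ofCo : (mons N J → ℤ) →ₗ[ℤ] _) := by
    intro J a b hab
    ext m
    rw [← coeff_ofCo a m, ← coeff_ofCo b m, hab]
  have hφinj : Function.Injective φ := by
    intro a b hab
    have := congrArg ofCo hab
    rw [hφ, hφ] at this
    exact hoinj _ (mul_left_cancel₀ hf0 this)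
  let Q := (mons N (M + 1) → ℤ) ⧸ LinearMap.range φ
  have htf : Module.IsTorsionFree ℤ Q := by
    rw [Module.isTorsionFree_iff_smul_eq_zero]
    intro k x hkx
    by_cases hk : k = 0
    · exact Or.inl hk
    right
    obtain ⟨y, rfl⟩ := Submodule.mkQ_surjective _ x
    rw [← map_smul, Submodule.mkQ_apply, Submodule.Quotient.mk_eq_zero] at hkx
    obtain ⟨h, hh⟩ := hkx
    have h1 : f * ofCo h = C k * ofCo y := by
      rw [← hφ, hh, LinearMap.map_smul, smul_eq_C_mul]
    obtain ⟨g, hg⟩ := C_dvd_of_mul hprim k hk _ ⟨_, h1⟩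
    rw [Submodule.mkQ_apply, Submodule.Quotient.mk_eq_zero]
    have h2 : f * g = ofCo y := by
      rw [hg, mul_left_comm] at h1
      exact mul_left_cancel₀ (by rwa [Ne, C_eq_zero]) h1
    have hgs : ∀ m ∈ g.support, m ∈ mons N (M - d + 1) := by
      intro m hm
      apply support_ofCo h
      rw [hg, mem_support_iff, coeff_C_mul]
      exact mul_ne_zero hk (mem_support_iff.1 hm)
    refine ⟨fun m => g.coeff m.1, ?_⟩
    apply hoinj
    rw [hφ, ofCo_coeff g hgs, h2]
  have : Module.Free ℤ Q := Module.free_of_finite_type_torsion_free'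
  have hrank : Module.finrank ℤ Q = (mons N (M + 1)).card - (mons N (M - d + 1)).card := by
    have h1 := Submodule.finrank_quotient_add_finrank (LinearMap.range φ)
    rw [LinearMap.finrank_range_of_inj hφinj, Module.finrank_fintype_fun_eq_card, Module.finrank_fintype_fun_eq_card,
      Fintype.card_coe, Fintype.card_coe] at h1
    change Module.finrank ℤ Q + _ = _ at h1
    omega
  let b := Module.finBasisOfFinrankEq ℤ Q hrank
  have hsurj := Submodule.mkQ_surjective (LinearMap.range φ)
  choose v hv using fun j => hsurj (b j)
  have hker : ∀ x, (LinearMap.range φ).mkQ x = 0 → ∃ h : MvPolynomial (Fin N) ℤ, h.totalDegree ≤ M - d ∧ ofCo x = f * h := by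
    intro x hx
    rw [Submodule.mkQ_apply, Submodule.Quotient.mk_eq_zero] at hx
    obtain ⟨h, rfl⟩ := hx
    exact ⟨ofCo h, totalDegree_le_iff.2 (support_ofCo h), hφ h⟩
  refine ⟨fun j => ofCo (v j), ?_, fun j => totalDegree_le_iff.2 (support_ofCo _), ?_⟩
  · intro q hq
    set x : mons N (M + 1) → ℤ := fun m => q.coeff m.1 with hx
    have hqx : ofCo x = q := ofCo_coeff q (totalDegree_le_iff.1 hq)
    refine ⟨fun j => b.repr ((LinearMap.range φ).mkQ x) j, ?_⟩
    obtain ⟨h, hh, he⟩ := hker (x - ∑ j, b.repr ((LinearMap.range φ).mkQ x) j • v j) (by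
      rw [map_sub, map_sum]
      simp only [map_smul, hv]
      rw [b.sum_repr, sub_self])
    refine ⟨h, hh, ?_⟩
    rw [← he, map_sub, map_sum, hqx]
    simp only [map_smul]
    ring
  · intro c hc
    obtain ⟨h, hh⟩ := hc
    change ∑ j, c j • ofCo (v j) = f * h at hh
    have hdeg : h.totalDegree ≤ M - d := by
      by_cases h0 : h = 0
      · rw [h0]; simp
      have h1 := totalDegree_mul_of_isDomain hf0 h0
      rw [← hh] at h1
      have h2 : (∑ j, c j • ofCo (v j)).totalDegree ≤ M := by
        have : ∑ j, c j • ofCo (v j) = ofCo (∑ j, c j • v j) := by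
          rw [map_sum]
          exact Finset.sum_congr rfl fun j _ => (LinearMap.map_smul _ _ _).symm
        rw [this]
        exact totalDegree_le_iff.2 (support_ofCo _)
      omega
    have h3 : ∑ j, c j • v j = φ (fun m => h.coeff m.1) := by
      apply hoinj
      rw [hφ, ofCo_coeff h (totalDegree_le_iff.1 hdeg), ← hh, map_sum]
      exact Finset.sum_congr rfl fun j _ => LinearMap.map_smul _ _ _
    have h4 : ∑ j, c j • b j = 0 := by
      have := congrArg (LinearMap.range φ).mkQ h3
      rw [map_sum] at this
      simp only [map_smul, hv] at this
      rw [this, Submodule.mkQ_apply, Submodule.Quotient.mk_eq_zero]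
      exact ⟨_, rfl⟩
    have := Fintype.linearIndependent_iff.1 b.linearIndependent c h4
    ext j; exact this j

end EV

namespace EV

open MvPolynomial

theorem det_tri {R κ : Type*} [CommRing R] [Fintype κ] [DecidableEq κ] (A : Matrix κ κ R) (deg : κ → ℕ) (α : R)
    (h : ∀ i j, deg j ≤ deg i → i ≠ j → A i j = 0) (hd : ∀ i, A i i = α) : A.det = α ^ Fintype.card κ := by
  have h1 : A.BlockTriangular deg := by
    intro i j hij
    apply h i j hij.le
    rintro rfl
    exact lt_irrefl _ hij
  rw [h1.det]
  have h2 : ∀ a ∈ Finset.univ.image deg, (A.toSquareBlock deg a).det = α ^ (Finset.univ.filter (fun i => deg i = a)).card := by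
    intro a _
    have : A.toSquareBlock deg a = α • (1 : Matrix _ _ R) := by
      ext i j
      rw [Matrix.toSquareBlock_def, Matrix.of_apply, Matrix.smul_apply, Matrix.one_apply]
      split_ifs with hij
      · rw [hij, hd, smul_eq_mul, mul_one]
      · rw [smul_zero]
        exact h _ _ (by rw [i.2, j.2]) (fun h => hij (Subtype.ext h))
    rw [this, Matrix.det_smul, Matrix.det_one, mul_one, Fintype.card_subtype]
  rw [Finset.prod_congr rfl h2, Finset.prod_pow_eq_pow_sum, ← Finset.card_univ]
  congr 1
  exact (Finset.card_eq_sum_card_image deg Finset.univ).symm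

theorem totalDegree_shift_le {R : Type*} [CommRing R] {N : ℕ} (z : Fin N → R) (q : MvPolynomial (Fin N) R) :
    (shift z q).totalDegree ≤ q.totalDegree := by
  have : shift z q = ∑ m ∈ q.support, C (q.coeff m) * ∏ i, (X i + C (z i)) ^ m i := by
    rw [shift, coe_eval₂Hom, eval₂_eq']
  rw [this]
  apply MvPolynomial.totalDegree_finsetSum_le
  intro m hm
  refine (totalDegree_mul _ _).trans ?_
  rw [totalDegree_C, zero_add]
  refine (totalDegree_finsetProd _ _).trans ?_
  refine le_trans ?_ (degree_le_totalDegree hm)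
  rw [Finsupp.degree_eq_sum]
  apply Finset.sum_le_sum
  intro i _
  refine (totalDegree_pow _ _).trans ?_
  have h1 : (X i + C (z i) : MvPolynomial (Fin N) R).totalDegree ≤ 1 := by
    refine (totalDegree_add _ _).trans ?_
    rw [totalDegree_C]
    have := (isHomogeneous_X R i).totalDegree_le
    exact max_le this (by norm_num)
  calc m i * _ ≤ m i * 1 := Nat.mul_le_mul_left _ h1
    _ = m i := mul_one _

theorem eval_shift {R : Type*} [CommRing R] {σ : Type*} (z x : σ → R) (q : MvPolynomial σ R) :
    eval x (shift z q) = eval (fun i => x i + z i) q := by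
  have : (eval x).comp (shift z) = eval (fun i => x i + z i) := by
    apply MvPolynomial.ringHom_ext
    · intro r; simp [shift]
    · intro i; simp [shift]
  exact RingHom.congr_fun this q

theorem span_R {N d M s : ℕ} {f : MvPolynomial (Fin N) ℤ} {u : Fin s → MvPolynomial (Fin N) ℤ}
    (hspan : ∀ q : MvPolynomial (Fin N) ℤ, q.totalDegree ≤ M → ∃ c : Fin s → ℤ, ∃ h : MvPolynomial (Fin N) ℤ,
        h.totalDegree ≤ M - d ∧ q = ∑ j, c j • u j + f * h) {R : Type*} [CommRing R]
    (q : MvPolynomial (Fin N) R) (hq : q.totalDegree ≤ M) :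
    ∃ c : Fin s → R, ∃ h : MvPolynomial (Fin N) R,
        h.totalDegree ≤ M - d ∧
        q = ∑ j, C (c j) * map (Int.castRingHom R) (u j) + map (Int.castRingHom R) f * h := by
  have key : ∀ m : Fin N →₀ ℕ, ∃ c : Fin s → ℤ, ∃ h : MvPolynomial (Fin N) ℤ, h.totalDegree ≤ M - d ∧
      (m.degree ≤ M → monomial m 1 = ∑ j, c j • u j + f * h) := by
    intro m
    by_cases hm : m.degree ≤ M
    · obtain ⟨c, h, h1, h2⟩ := hspan (monomial m 1) (by
        rw [totalDegree_le_iff]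
        intro m' hm'
        have := support_monomial_subset hm'
        rw [Finset.mem_singleton] at this
        rw [this, mem_mons]
        omega)
      exact ⟨c, h, h1, fun _ => h2⟩
    · exact ⟨0, 0, by simp, fun h => absurd h hm⟩
  choose c h h1 h2 using key
  refine ⟨fun j => ∑ m ∈ q.support, q.coeff m * (c m j : R), ∑ m ∈ q.support, C (q.coeff m) * map (Int.castRingHom R) (h m), ?_, ?_⟩
  · apply MvPolynomial.totalDegree_finsetSum_le
    intro m _
    refine (totalDegree_mul _ _).trans ?_
    rw [totalDegree_C, zero_add]
    exact (Finset.sup_mono (MvPolynomial.support_map_subset _ _)).trans (h1 m)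
  · have e1 : ∀ m ∈ q.support, monomial m (q.coeff m) =
        C (q.coeff m) * (∑ j, C ((c m j : ℤ) : R) * map (Int.castRingHom R) (u j) + map (Int.castRingHom R) f * map (Int.castRingHom R) (h m)) := by
      intro m hm
      have h3 := congrArg (map (Int.castRingHom R)) (h2 m ((degree_le_totalDegree hm).trans hq))
      rw [map_monomial, map_one, RingHom.map_add, map_sum, RingHom.map_mul] at h3
      have h4 : ∀ j, map (Int.castRingHom R) (c m j • u j) = C ((c m j : ℤ) : R) * map (Int.castRingHom R) (u j) := by
        intro j
        rw [smul_eq_C_mul, RingHom.map_mul, map_C, eq_intCast]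
      rw [Finset.sum_congr rfl fun j _ => h4 j] at h3
      rw [← h3, C_mul_monomial, mul_one]
    conv_lhs => rw [q.as_sum, Finset.sum_congr rfl e1]
    simp only [mul_add, Finset.sum_add_distrib, Finset.mul_sum]
    congr 1
    · rw [Finset.sum_comm]
      apply Finset.sum_congr rfl
      intro j _
      rw [map_sum, Finset.sum_mul]
      apply Finset.sum_congr rfl
      intro m _
      rw [C_mul]; ring
    · apply Finset.sum_congr rfl
      intro m _
      ring

set_option maxHeartbeats 2000000 in
theorem arch_identity {N d M s : ℕ} {f : MvPolynomial (Fin N) ℤ} (hf : f.totalDegree = d) (hM : d ≤ M)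
    {u : Fin s → MvPolynomial (Fin N) ℤ}
    (hspan : ∀ q : MvPolynomial (Fin N) ℤ, q.totalDegree ≤ M → ∃ c : Fin s → ℤ, ∃ h : MvPolynomial (Fin N) ℤ,
        h.totalDegree ≤ M - d ∧ q = ∑ j, c j • u j + f * h) (hu : ∀ j, (u j).totalDegree ≤ M)
    (e : Fin s → (Fin N →₀ ℕ)) (he : Function.Injective e)
    (hes : ∀ m, m ∈ mons N (M + 1) ↔ m ∈ mons N (M - d + 1) ∨ ∃ j, e j = m)
    (hed : ∀ j, e j ∉ mons N (M - d + 1))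
    (P : Fin s → Fin N → ℤ) (hP : ∀ i, eval (P i) f = 0) {R : Type*} [CommRing R] (z : Fin N → R) :
    ∃ ε : R, IsUnit ε ∧ (((Matrix.of fun i j => eval (P i) (u j)).det : ℤ) : R) *
        eval z (map (Int.castRingHom R) f) ^ (mons N (M - d + 1)).card =
      ε * (Matrix.of fun i j => ∏ l, ((P i l : R) - z l) ^ e j l).det := by
  classical
  set φ := Int.castRingHom R with hφ
  let τ := mons N (M - d + 1)
  let kk : Fin s ⊕ τ → (Fin N →₀ ℕ) := Sum.elim e (fun m => m.1)
  have hkinj : Function.Injective kk := by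
    rintro (a | a) (b | b) hab
    · exact congrArg _ (he hab)
    · exact absurd (by change e a = b.1 at hab; rw [hab]; exact b.2) (hed a)
    · exact absurd (by change a.1 = e b at hab; rw [← hab]; exact a.2) (hed b)
    · exact congrArg _ (Subtype.ext hab)
  have hkim : Finset.univ.image kk = mons N (M + 1) := by
    ext m
    rw [hes, Finset.mem_image]
    constructor
    · rintro ⟨x | x, _, rfl⟩
      · exact Or.inr ⟨x, rfl⟩
      · exact Or.inl x.2
    · rintro (h | ⟨j, rfl⟩)
      · exact ⟨Sum.inr ⟨m, h⟩, Finset.mem_univ _, rfl⟩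
      · exact ⟨Sum.inl j, Finset.mem_univ _, rfl⟩
  have hsum : ∀ g : (Fin N →₀ ℕ) → R, ∑ y, g (kk y) = ∑ m ∈ mons N (M + 1), g m := by
    intro g
    rw [← hkim, Finset.sum_image (fun x _ y _ h => hkinj h)]
  let ft := shift z (map φ f)
  have hmapdeg : ∀ q : MvPolynomial (Fin N) ℤ, (map φ q).totalDegree ≤ q.totalDegree := fun q =>
    Finset.sup_mono (MvPolynomial.support_map_subset _ _)
  let rp : Fin s ⊕ τ → MvPolynomial (Fin N) R :=
    Sum.elim (fun j => shift z (map φ (u j))) (fun m => ft * monomial m.1 1)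
  have hrp : ∀ x, (rp x).totalDegree ≤ M := by
    rintro (j | m)
    · exact (totalDegree_shift_le _ _).trans ((hmapdeg _).trans (hu j))
    · refine (totalDegree_mul _ _).trans ?_
      have h1 : ft.totalDegree ≤ d := (totalDegree_shift_le _ _).trans ((hmapdeg _).trans hf.le)
      have h2 : (monomial m.1 (1 : R)).totalDegree ≤ M - d := by
        rw [totalDegree_le_iff]
        intro m' hm'
        have := support_monomial_subset hm'
        rw [Finset.mem_singleton] at this
        rw [this]
        exact m.2
      omega
  let U : Matrix (Fin s ⊕ τ) (Fin s ⊕ τ) R := Matrix.of fun x y => (rp x).coeff (kk y)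
  let Pt : Fin s → Fin N → R := fun i l => (P i l : R) - z l
  let E : Matrix (Fin s ⊕ τ) (Fin s ⊕ τ) R := Matrix.of fun y x =>
    Sum.elim (fun i => ∏ l, Pt i l ^ kk y l) (fun m => if kk y = m.1 then 1 else 0) x
  have hev : ∀ (q : MvPolynomial (Fin N) R) (hq : q.totalDegree ≤ M) (x : Fin N → R),
      eval x q = ∑ y, q.coeff (kk y) * ∏ l, x l ^ kk y l := by
    intro q hq x
    rw [hsum (fun m => q.coeff m * ∏ l, x l ^ m l), eval_eq']
    apply Finset.sum_subset (totalDegree_le_iff.1 hq)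
    intro m _ hm
    rw [notMem_support_iff.1 hm, zero_mul]
  have hevP : ∀ (q : MvPolynomial (Fin N) ℤ) i, eval (Pt i) (shift z (map φ q)) = ((eval (P i) q : ℤ) : R) := by
    intro q i
    rw [eval_shift]
    have : (fun l => Pt i l + z l) = fun l => φ (P i l) := by
      ext l; simp [Pt, hφ]
    rw [this, eval_map_comp, hφ, eq_intCast]
  -- U is a unit
  have hU : IsUnit U.det := by
    have hW : ∀ y, ∃ w : Fin s ⊕ τ → R, ∀ y', ∑ x, w x * U x y' = if y = y' then 1 else 0 := by
      intro y
      have hy : kk y ∈ mons N (M + 1) := by rw [← hkim]; exact Finset.mem_image_of_mem _ (Finset.mem_univ _)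
      have hmon : (monomial (kk y) (1 : R)).totalDegree ≤ M := by
        rw [totalDegree_le_iff]
        intro m' hm'
        have := support_monomial_subset hm'
        rw [Finset.mem_singleton] at this
        rw [this]
        exact hy
      obtain ⟨c, h, hh, hq⟩ := span_R hspan (shift (fun i => - z i) (monomial (kk y) (1 : R)))
        ((totalDegree_shift_le _ _).trans hmon)
      have h1 := congrArg (shift z) hq
      have h0 : shift z (shift (fun i => - z i) (monomial (kk y) (1 : R))) = monomial (kk y) 1 := shift_shift' z _
      rw [h0, RingHom.map_add, map_sum, RingHom.map_mul] at h1
      have hht : (shift z h).totalDegree ≤ M - d := (totalDegree_shift_le _ _).trans hh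
      refine ⟨Sum.elim c (fun m => (shift z h).coeff m.1), fun y' => ?_⟩
      have h2 := congrArg (coeff (kk y')) h1
      rw [coeff_monomial] at h2
      have h3 : (if y = y' then (1 : R) else 0) = if kk y = kk y' then 1 else 0 := by
        simp [hkinj.eq_iff]
      rw [h3, h2, Fintype.sum_sum_type, coeff_add, coeff_sum]
      congr 1
      · apply Finset.sum_congr rfl
        intro j _
        have : shift z (C (c j) * map φ (u j)) = C (c j) * rp (Sum.inl j) := by
          rw [RingHom.map_mul]; simp [shift, rp]
        rw [this, coeff_C_mul]
        rfl
      · have h4 : shift z h = ∑ m : τ, monomial m.1 ((shift z h).coeff m.1) := by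
          rw [← ofCo_apply, ofCo_coeff _ (totalDegree_le_iff.1 hht)]
        rw [h4, Finset.mul_sum, coeff_sum]
        apply Finset.sum_congr rfl
        intro m _
        rw [← h4]
        have : shift z (map φ f) * monomial m.1 ((shift z h).coeff m.1) = C ((shift z h).coeff m.1) * rp (Sum.inr m) := by
          change ft * _ = _ * (ft * _)
          rw [mul_left_comm, C_mul_monomial, mul_one]
        rw [this, coeff_C_mul]
        rfl
    choose w hw using hW
    have : (Matrix.of w) * U = 1 := by
      ext y y'
      rw [Matrix.mul_apply, Matrix.one_apply, ← hw]
      rfl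
    have h5 := congrArg Matrix.det this
    rw [Matrix.det_mul, Matrix.det_one] at h5
    exact IsUnit.of_mul_eq_one_right _ h5
  have hE : E.det = (Matrix.of fun i j => ∏ l, ((P i l : R) - z l) ^ e j l).det := by
    have : E = Matrix.fromBlocks (Matrix.of fun i j => ∏ l, ((P i l : R) - z l) ^ e j l).transpose 0
        (Matrix.of fun (m : τ) i => ∏ l, Pt i l ^ m.1 l) 1 := by
      ext x y
      rcases x with x | x <;> rcases y with y | y
      · rfl
      · change (if e x = y.1 then (1 : R) else 0) = 0
        rw [if_neg]
        intro h
        exact hed x (h ▸ y.2)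
      · rfl
      · change (if x.1 = y.1 then (1 : R) else 0) = (1 : Matrix τ τ R) x y
        rw [Matrix.one_apply]
        by_cases hxy : x = y
        · rw [if_pos hxy, if_pos (congrArg _ hxy)]
        · rw [if_neg hxy, if_neg (fun h => hxy (Subtype.ext h))]
    rw [this, Matrix.det_fromBlocks_zero₁₂, Matrix.det_one, mul_one, Matrix.det_transpose]
  have hUE : (U * E).det = (((Matrix.of fun i j => eval (P i) (u j)).det : ℤ) : R) *
        eval z (map φ f) ^ (mons N (M - d + 1)).card := by
    have hl : ∀ x i, (U * E) x (Sum.inl i) = eval (Pt i) (rp x) := by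
      intro x i
      rw [Matrix.mul_apply, hev _ (hrp x)]
      rfl
    have hr : ∀ x (m : τ), (U * E) x (Sum.inr m) = (rp x).coeff m.1 := by
      intro x m
      rw [Matrix.mul_apply, Finset.sum_eq_single (Sum.inr m)]
      · change (rp x).coeff m.1 * (if m.1 = m.1 then 1 else 0) = _
        rw [if_pos rfl, mul_one]
      · intro y _ hy
        change _ * (if kk y = kk (Sum.inr m) then (1 : R) else 0) = 0
        rw [if_neg (fun h => hy (hkinj h)), mul_zero]
      · simp
    have : U * E = Matrix.fromBlocks (Matrix.of fun i j => ((eval (P i) (u j) : ℤ) : R)).transpose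
        (Matrix.of fun j (m : τ) => (rp (Sum.inl j)).coeff m.1) 0 (Matrix.of fun (m' m : τ) => (rp (Sum.inr m')).coeff m.1) := by
      ext x y
      rcases x with x | x <;> rcases y with y | y
      · rw [hl]; exact hevP _ _
      · rw [hr]; rfl
      · rw [hl]
        change eval (Pt y) (ft * _) = 0
        rw [RingHom.map_mul, hevP, hP, Int.cast_zero, zero_mul]
      · rw [hr]; rfl
    rw [this, Matrix.det_fromBlocks_zero₂₁, Matrix.det_transpose]
    congr 1
    · rw [← eq_intCast φ, RingHom.map_det]
      congr 1
    · rw [det_tri _ (fun m : τ => m.1.degree) (eval z (map φ f)), Fintype.card_coe]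
      · intro i j hij hne
        change coeff j.1 (ft * monomial i.1 1) = 0
        rw [coeff_mul_monomial', if_neg]
        intro hle
        apply hne
        apply Subtype.ext
        obtain ⟨r, hr⟩ := exists_add_of_le hle
        rw [hr, map_add] at hij
        have : r = 0 := (Finsupp.degree_eq_zero_iff r).1 (by omega)
        rw [hr, this, add_zero]
      · intro i
        change coeff i.1 (ft * monomial i.1 1) = _
        rw [coeff_mul_monomial', if_pos le_rfl, tsub_self, mul_one, ← constantCoeff_eq, ← eval_zero]
        rw [eval_shift]
        simp
  refine ⟨U.det, hU, ?_⟩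
  rw [← hUE, Matrix.det_mul, hE]

end EV

namespace EV

open MvPolynomial

/-- a point of the torus of radius `B` where `f` is at least as large as one of its terms -/
theorem exists_torus {N d : ℕ} (f : MvPolynomial (Fin N) ℤ) (hf : f.totalDegree = d) {B : ℝ} (hB : 0 ≤ B)
    (m : Fin N →₀ ℕ) (hm : m ∈ f.support) :
    ∃ z : Fin N → ℂ, (∀ i, ‖z i‖ = B) ∧
      |((f.coeff m : ℤ) : ℝ)| * B ^ m.degree ≤ ‖eval z (map (Int.castRingHom ℂ) f)‖ := by
  classical
  set K := d + 1 with hK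
  set ζ : ℂ := Complex.exp (2 * Real.pi * Complex.I / (K : ℕ)) with hζ
  have hprim : IsPrimitiveRoot ζ K := Complex.isPrimitiveRoot_exp K (by omega)
  have hζn : ‖ζ‖ = 1 := hprim.norm'_eq_one (by omega)
  have hle : ∀ m' ∈ f.support, ∀ i, m' i ≤ d := by
    intro m' hm' i
    have h1 : m'.degree ≤ d := by rw [← hf]; exact le_totalDegree hm'
    exact (Finsupp.le_degree i m').trans h1
  -- one variable orthogonality
  have horth : ∀ a b : ℕ, a ≤ d → b ≤ d →
      ∑ k ∈ Finset.range K, ζ ^ (k * (a + K - b)) = if a = b then (K : ℂ) else 0 := by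
    intro a b ha hb
    have h0 : ∀ k, ζ ^ (k * (a + K - b)) = (ζ ^ (a + K - b)) ^ k := fun k => by
      rw [mul_comm, pow_mul]
    simp only [h0]
    split_ifs with h
    · have : ζ ^ (a + K - b) = 1 := by
        rw [hprim.pow_eq_one_iff_dvd, h]
        exact ⟨1, by omega⟩
      simp [this]
    · have hne : ζ ^ (a + K - b) ≠ 1 := by
        rw [Ne, hprim.pow_eq_one_iff_dvd]
        rintro ⟨c, hc⟩
        rcases c with _ | _ | c
        · omega
        · omega
        · have : K * (c + 1 + 1) = K * c + K + K := by ring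
          have := Nat.zero_le (K * c)
          omega
      have h1 : (ζ ^ (a + K - b)) ^ K = 1 := by
        rw [← pow_mul, mul_comm, pow_mul, hprim.pow_eq_one, one_pow]
      have h2 := mul_geom_sum (ζ ^ (a + K - b)) K
      rw [h1, sub_self] at h2
      exact (mul_eq_zero.1 h2).resolve_left (sub_ne_zero.2 hne)
  let T := Fintype.piFinset (fun _ : Fin N => Finset.range K)
  let zz : (Fin N → ℕ) → Fin N → ℂ := fun a i => B * ζ ^ a i
  have hsum : ∑ a ∈ T, (∏ i, ζ ^ (a i * (K - m i))) * eval (zz a) (map (Int.castRingHom ℂ) f) =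
      (K : ℂ) ^ N * (((f.coeff m : ℤ) : ℂ) * (B : ℂ) ^ m.degree) := by
    have h1 : ∀ a, eval (zz a) (map (Int.castRingHom ℂ) f) =
        ∑ m' ∈ f.support, ((f.coeff m' : ℤ) : ℂ) * ∏ i, zz a i ^ m' i := by
      intro a
      rw [eval_map, eval₂_eq']
      rfl
    simp only [h1, Finset.mul_sum]
    rw [Finset.sum_comm]
    have h2 : ∀ m' ∈ f.support, ∑ a ∈ T, (∏ i, ζ ^ (a i * (K - m i))) * (((f.coeff m' : ℤ) : ℂ) * ∏ i, zz a i ^ m' i) =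
        if m' = m then (K : ℂ) ^ N * (((f.coeff m : ℤ) : ℂ) * (B : ℂ) ^ m.degree) else 0 := by
      intro m' hm'
      have h3 : ∀ a, (∏ i, ζ ^ (a i * (K - m i))) * (((f.coeff m' : ℤ) : ℂ) * ∏ i, zz a i ^ m' i) =
          (((f.coeff m' : ℤ) : ℂ) * (B : ℂ) ^ m'.degree) * ∏ i, ζ ^ (a i * (m' i + K - m i)) := by
        intro a
        have h4 : ∏ i, zz a i ^ m' i = (B : ℂ) ^ m'.degree * ∏ i, ζ ^ (a i * m' i) := by
          rw [Finsupp.degree_eq_sum, ← Finset.prod_pow_eq_pow_sum, ← Finset.prod_mul_distrib]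
          apply Finset.prod_congr rfl
          intro i _
          simp only [zz]
          rw [mul_pow, ← pow_mul]
        have h5 : ∏ i, ζ ^ (a i * (m' i + K - m i)) = (∏ i, ζ ^ (a i * (K - m i))) * ∏ i, ζ ^ (a i * m' i) := by
          rw [← Finset.prod_mul_distrib]
          apply Finset.prod_congr rfl
          intro i _
          rw [← pow_add, ← mul_add]
          congr 2
          have := hle m hm i
          omega
        rw [h4, h5]; ring
      simp only [h3]
      rw [← Finset.mul_sum]
      have h6 : ∑ a ∈ T, ∏ i, ζ ^ (a i * (m' i + K - m i)) =
          ∏ i, ∑ k ∈ Finset.range K, ζ ^ (k * (m' i + K - m i)) :=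
        (Finset.prod_univ_sum (fun _ : Fin N => Finset.range K) (fun i k => ζ ^ (k * (m' i + K - m i)))).symm
      rw [h6, Finset.prod_congr rfl (fun i _ => horth (m' i) (m i) (hle m' hm' i) (hle m hm i))]
      split_ifs with h
      · subst h
        simp
        ring
      · obtain ⟨i, hi⟩ : ∃ i, m' i ≠ m i := by
          by_contra hcon
          push Not at hcon
          exact h (Finsupp.ext hcon)
        rw [Finset.prod_eq_zero (Finset.mem_univ i) (if_neg hi), mul_zero]
    rw [Finset.sum_congr rfl h2, Finset.sum_ite_eq', if_pos hm]
  by_contra hcon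
  push Not at hcon
  have hlt : ∀ a ∈ T, ‖(∏ i, ζ ^ (a i * (K - m i))) * eval (zz a) (map (Int.castRingHom ℂ) f)‖ <
      |((f.coeff m : ℤ) : ℝ)| * B ^ m.degree := by
    intro a _
    have h1 := hcon (zz a) (fun i => by simp [zz, hζn, abs_of_nonneg hB])
    rw [norm_mul, norm_prod]
    simpa [hζn] using h1
  have hTne : T.Nonempty := ⟨fun _ => 0, by simp [T, hK]⟩
  have h7 := Finset.sum_lt_sum_of_nonempty hTne hlt
  have h8 := norm_sum_le T (fun a => (∏ i, ζ ^ (a i * (K - m i))) * eval (zz a) (map (Int.castRingHom ℂ) f))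
  rw [hsum] at h8
  have h9 : T.card = K ^ N := by simp [T]
  rw [Finset.sum_const, h9, nsmul_eq_mul] at h7
  have h10 : ‖(K : ℂ) ^ N * (((f.coeff m : ℤ) : ℂ) * (B : ℂ) ^ m.degree)‖ = ((K ^ N : ℕ) : ℝ) * (|((f.coeff m : ℤ) : ℝ)| * B ^ m.degree) := by
    rw [norm_mul, norm_mul, norm_pow, norm_pow, Complex.norm_natCast, Complex.norm_intCast, Complex.norm_real,
      Real.norm_of_nonneg hB]
    push_cast
    rfl
  rw [h10] at h8
  linarith

theorem arch_bound {N d M s : ℕ} {f : MvPolynomial (Fin N) ℤ} (hf : f.totalDegree = d) (hM : d ≤ M)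
    {u : Fin s → MvPolynomial (Fin N) ℤ}
    (hs : s = (mons N (M + 1)).card - (mons N (M + 1 - d)).card)
    (hspan : ∀ q : MvPolynomial (Fin N) ℤ, q.totalDegree ≤ M → ∃ c : Fin s → ℤ, ∃ h : MvPolynomial (Fin N) ℤ,
        h.totalDegree ≤ M - d ∧ q = ∑ j, c j • u j + f * h) (hu : ∀ j, (u j).totalDegree ≤ M)
    (P : Fin s → Fin N → ℤ) (hP : ∀ i, eval (P i) f = 0) {B : ℝ} (hB : 1 ≤ B)
    (hPB : ∀ i l, |(P i l : ℝ)| ≤ B) (m : Fin N →₀ ℕ) (hm : m ∈ f.support) :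
    |(((Matrix.of fun i j => eval (P i) (u j)).det : ℤ) : ℝ)| * (|((f.coeff m : ℤ) : ℝ)| * B ^ m.degree) ^ (mons N (M + 1 - d)).card
      ≤ s.factorial * (2 * B) ^ (M * s) := by
  classical
  have hMd : M + 1 - d = M - d + 1 := by omega
  rw [hMd] at hs ⊢
  have hsub : mons N (M - d + 1) ⊆ mons N (M + 1) := by
    intro m hm
    rw [mem_mons] at hm ⊢
    omega
  have hcard : (mons N (M + 1) \ mons N (M - d + 1)).card = s := by
    rw [Finset.card_sdiff_of_subset hsub, hs]
  let E := Finset.equivFinOfCardEq hcard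
  let e : Fin s → (Fin N →₀ ℕ) := fun j => (E.symm j).1
  have heM : ∀ j, e j ∈ mons N (M + 1) ∧ e j ∉ mons N (M - d + 1) := fun j =>
    Finset.mem_sdiff.1 (E.symm j).2
  obtain ⟨ε, hε, hid⟩ := arch_identity hf hM hspan hu e
    (fun a b h => E.symm.injective (Subtype.ext h))
    (fun m => by
      constructor
      · intro h
        by_cases h' : m ∈ mons N (M - d + 1)
        · exact Or.inl h'
        · refine Or.inr ⟨E ⟨m, Finset.mem_sdiff.2 ⟨h, h'⟩⟩, ?_⟩
          simp [e]
      · rintro (h | ⟨j, rfl⟩)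
        · exact hsub h
        · exact (heM j).1)
    (fun j => (heM j).2) P hP (R := MvPolynomial (Fin N) ℤ) X
  obtain ⟨z, hz, hzf⟩ := exists_torus f hf (by linarith : 0 ≤ B) m hm
  obtain ⟨r, hr, rfl⟩ := isUnit_iff_eq_C_of_isReduced.1 hε
  let ψ : MvPolynomial (Fin N) ℤ →+* ℂ := eval₂Hom (Int.castRingHom ℂ) z
  have h1 := congrArg ψ hid
  rw [RingHom.map_mul, RingHom.map_mul, RingHom.map_pow, map_intCast, RingHom.map_det] at h1
  have h2 : ψ (eval X (map (Int.castRingHom (MvPolynomial (Fin N) ℤ)) f)) = eval z (map (Int.castRingHom ℂ) f) := by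
    have : (ψ.comp (eval X)).comp (map (Int.castRingHom (MvPolynomial (Fin N) ℤ))) =
        (eval z).comp (map (Int.castRingHom ℂ)) := by
      apply ringHom_ext
      · intro r; simp [ψ]
      · intro i; simp [ψ]
    exact congrArg (fun g => g f) this
  have h3 : ‖ψ (C r)‖ = 1 := by
    have : ψ (C r) = (r : ℂ) := by simp [ψ]
    rw [this, Complex.norm_intCast]
    rcases Int.isUnit_iff.1 hr with rfl | rfl <;> simp
  have h4 := congrArg norm h1
  rw [h2, norm_mul, norm_mul, norm_pow, h3, one_mul, Complex.norm_intCast] at h4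
  have h5 : ‖(ψ.mapMatrix (Matrix.of fun i j => ∏ l, ((P i l : MvPolynomial (Fin N) ℤ) - X l) ^ e j l)).det‖ ≤
      s.factorial * (2 * B) ^ (M * s) := by
    have h6 := Matrix.det_le (abv := NormedField.toAbsoluteValue ℂ) (x := (2 * B) ^ M)
      (A := ψ.mapMatrix (Matrix.of fun i j => ∏ l, ((P i l : MvPolynomial (Fin N) ℤ) - X l) ^ e j l)) ?_
    · rw [Fintype.card_fin, nsmul_eq_mul, ← pow_mul] at h6
      exact h6
    · intro i j
      change ‖ψ (∏ l, ((P i l : MvPolynomial (Fin N) ℤ) - X l) ^ e j l)‖ ≤ _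
      rw [map_prod, norm_prod]
      have h7 : ∀ l, ‖ψ (((P i l : MvPolynomial (Fin N) ℤ) - X l) ^ e j l)‖ ≤ (2 * B) ^ e j l := by
        intro l
        rw [RingHom.map_pow, norm_pow, RingHom.map_sub, map_intCast]
        have h8 : ψ (X l) = z l := by simp [ψ]
        rw [h8]
        apply pow_le_pow_left₀ (norm_nonneg _)
        have := norm_sub_le (P i l : ℂ) (z l)
        rw [hz, Complex.norm_intCast] at this
        have := hPB i l
        linarith
      refine (Finset.prod_le_prod (fun l _ => norm_nonneg _) (fun l _ => h7 l)).trans ?_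
      rw [Finset.prod_pow_eq_pow_sum, ← Finsupp.degree_eq_sum]
      apply pow_le_pow_right₀ (by linarith)
      have := (heM j).1
      rw [mem_mons] at this
      omega
  refine le_trans ?_ (h4.le.trans h5)
  apply mul_le_mul_of_nonneg_left _ (abs_nonneg _)
  apply pow_le_pow_left₀ _ hzf
  have : 0 ≤ B := by linarith
  positivity

/-- If no polynomial of degree at most `M` does the job, there is a nonzero determinant. -/
theorem exists_det {N d M : ℕ} {f : MvPolynomial (Fin N) ℤ} (hf : f.totalDegree = d) (hf0 : f ≠ 0)
    (hprim : f.support.gcd f.coeff = 1) (hM : d ≤ M) {B : ℝ} (hB : 1 ≤ B)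
    (hno : ∀ g : MvPolynomial (Fin N) ℤ, g.totalDegree ≤ M →
      (∀ x : Fin N → ℤ, eval x f = 0 → (∀ i, |(x i : ℝ)| ≤ B) → eval x g = 0) → f ∣ g)
    {s : ℕ} (hs : s = (mons N (M + 1)).card - (mons N (M + 1 - d)).card) :
    ∃ (u : Fin s → MvPolynomial (Fin N) ℤ) (P : Fin s → Fin N → ℤ), (∀ i, eval (P i) f = 0) ∧
      (Matrix.of fun i j => eval (P i) (u j)).det ≠ 0 ∧
      ∀ m ∈ f.support,
    |(((Matrix.of fun i j => eval (P i) (u j)).det : ℤ) : ℝ)| * (|((f.coeff m : ℤ) : ℝ)| * B ^ m.degree) ^ (mons N (M + 1 - d)).card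
      ≤ s.factorial * (2 * B) ^ (M * s) := by
  classical
  subst hs
  obtain ⟨u, hspan, hu, hind⟩ := exists_quot_basis hf hf0 hprim hM
  let Ω := {x : Fin N → ℤ // eval x f = 0 ∧ ∀ i, |(x i : ℝ)| ≤ B}
  obtain ⟨e, he⟩ := exists_minor (ι := Ω) (K := ℚ) (fun x j => ((eval x.1 (u j) : ℤ) : ℚ)) (by
    intro v hv
    obtain ⟨b, hb⟩ := IsLocalization.exist_integer_multiples (nonZeroDivisors ℤ) Finset.univ v
    have hb0 : (b : ℤ) ≠ 0 := nonZeroDivisors.coe_ne_zero b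
    have hb' : ∀ j, ∃ c : ℤ, (c : ℚ) = (b : ℤ) * v j := by
      intro j
      obtain ⟨c, hc⟩ := hb j (Finset.mem_univ _)
      refine ⟨c, ?_⟩
      have : ((b : ℤ) • v j : ℚ) = (b : ℤ) * v j := by rw [zsmul_eq_mul]
      rw [← this, ← hc]
      simp
    choose c hc using hb'
    have hev : ∀ x : Fin N → ℤ, eval x (∑ j, c j • u j) = ∑ j, eval x (u j) * c j := by
      intro x
      rw [map_sum]
      apply Finset.sum_congr rfl
      intro j _
      rw [smul_eval, mul_comm]
    have hc0 : c = 0 := by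
      apply hind
      apply hno
      · refine (totalDegree_finsetSum _ _).trans ?_
        apply Finset.sup_le
        intro j _
        exact (totalDegree_smul_le _ _).trans (hu j)
      · intro x hx hxB
        rw [hev]
        have h1 := hv ⟨x, hx, hxB⟩
        have h2 : ((∑ j, eval x (u j) * c j : ℤ) : ℚ) = 0 := by
          push_cast
          have : ∀ j, ((eval x (u j) : ℤ) : ℚ) * (c j : ℚ) = (b : ℤ) * (((eval x (u j) : ℤ) : ℚ) * v j) := by
            intro j; rw [hc]; ring
          rw [Finset.sum_congr rfl (fun j _ => this j), ← Finset.mul_sum, h1, mul_zero]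
        exact_mod_cast h2
    funext j
    have h3 := hc j
    rw [hc0] at h3
    simp only [Pi.zero_apply, Int.cast_zero] at h3
    rcases mul_eq_zero.1 h3.symm with h | h
    · exact absurd (by exact_mod_cast h) hb0
    · exact h)
  refine ⟨u, fun i => (e i).1, fun i => (e i).2.1, ?_, fun m hm => ?_⟩
  · intro h0
    apply he
    have := congrArg (Int.castRingHom ℚ) h0
    rw [RingHom.map_det, RingHom.map_zero] at this
    rw [← this]
    congr 1
  · exact arch_bound hf hM rfl hspan hu _ (fun i => (e i).2.1) hB (fun i l => (e i).2.2 l) m hm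

end EV

namespace EV

theorem choose_lower (k n : ℕ) : (k + 1) ^ n ≤ n.factorial * (k + n).choose n := by
  rw [← Nat.descFactorial_eq_factorial_mul_choose]
  have := Nat.pow_sub_le_descFactorial (k + n) n
  rwa [show k + n + 1 - n = k + 1 by omega] at this

theorem choose_upper (k n : ℕ) : n.factorial * (k + n).choose n ≤ (k + n) ^ n := by
  rw [← Nat.descFactorial_eq_factorial_mul_choose]
  exact Nat.descFactorial_le_pow _ _

theorem card_mons_succ (n J : ℕ) : (mons (n + 1) (J + 1)).card = (mons (n + 1) J).card + (J + n).choose n := by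
  rw [card_mons, card_mons, show J + 1 + n = (J + n) + 1 by ring, Nat.choose_succ_succ, add_comm]

theorem card_diff_bounds (n K d : ℕ) :
    (mons (n + 1) K).card ≤ (mons (n + 1) (K + d)).card ∧
    d * (K + 1) ^ n ≤ n.factorial * ((mons (n + 1) (K + d)).card - (mons (n + 1) K).card) ∧
    n.factorial * ((mons (n + 1) (K + d)).card - (mons (n + 1) K).card) ≤ d * (K + d - 1 + n) ^ n := by
  induction d with
  | zero => simp
  | succ d ih =>
    obtain ⟨h0, h1, h2⟩ := ih
    have h3 := card_mons_succ n (K + d)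
    have h4 : (mons (n + 1) (K + (d + 1))).card - (mons (n + 1) K).card =
        ((mons (n + 1) (K + d)).card - (mons (n + 1) K).card) + (K + d + n).choose n := by
      rw [← add_assoc, h3]; omega
    refine ⟨by rw [← add_assoc, h3]; omega, ?_, ?_⟩
    · rw [h4, mul_add, add_mul, one_mul]
      have h5 : (K + 1) ^ n ≤ (K + d + 1) ^ n := Nat.pow_le_pow_left (by omega) n
      have := choose_lower (K + d) n
      omega
    · rw [h4, mul_add, add_mul, one_mul]
      have h5 : (K + d - 1 + n) ^ n ≤ (K + (d + 1) - 1 + n) ^ n := Nat.pow_le_pow_left (by omega) n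
      have h6 := choose_upper (K + d) n
      have h7 : d * (K + d - 1 + n) ^ n ≤ d * (K + (d + 1) - 1 + n) ^ n := Nat.mul_le_mul_left _ h5
      have h8 : K + (d + 1) - 1 + n = K + d + n := by omega
      rw [h8] at h7 ⊢
      omega

theorem card_mons_lower (n K : ℕ) : K ^ (n + 1) ≤ (n + 1).factorial * (mons (n + 1) K).card := by
  rw [card_mons]
  rcases K with _ | K
  · simp
  · have := choose_lower K (n + 1)
    rwa [show K + (n + 1) = K + 1 + n by ring] at this

theorem card_mons_upper (n J : ℕ) : (n + 1).factorial * (mons (n + 1) J).card ≤ (J + n) ^ (n + 1) := by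
  rw [card_mons, ← Nat.descFactorial_eq_factorial_mul_choose]
  exact Nat.descFactorial_le_pow _ _

/-- `(y+n)^(n+1) ≤ y^n (y + C)` for `y ≥ 1` -/
theorem pow_add_bound (n : ℕ) : ∃ C : ℝ, 0 ≤ C ∧ ∀ y : ℝ, 1 ≤ y → (y + n) ^ (n + 1) ≤ y ^ n * (y + C) := by
  refine ⟨((n : ℝ) + 1) ^ (n + 1) * (n + 1), by positivity, fun y hy => ?_⟩
  -- (1 + n/y)^(n+1) ≤ 1 + C / y
  have key : ∀ (k : ℕ) (a : ℝ), 0 ≤ a → ∀ x : ℝ, 0 ≤ x → x ≤ 1 → (1 + a * x) ^ k ≤ 1 + (1 + a) ^ k * x := by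
    intro k a ha x hx hx1
    have h1 : ConvexOn ℝ (Set.Ici 0) (fun x : ℝ => x ^ k) := convexOn_pow k
    have h2 := h1.2 (show (1 : ℝ) ∈ Set.Ici 0 by simp) (show 1 + a ∈ Set.Ici 0 by simp; linarith)
      (show 0 ≤ 1 - x by linarith) hx (by ring)
    simp only [smul_eq_mul, one_pow, mul_one] at h2
    have h3 : 1 - x + x * (1 + a) = 1 + a * x := by ring
    rw [h3] at h2
    linarith
  have hy0 : 0 < y := by linarith
  have h1 := key (n + 1) n (by positivity) (1 / y) (by positivity) (by rw [div_le_one hy0]; exact hy)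
  have h2 : (y + n) ^ (n + 1) = y ^ (n + 1) * (1 + n * (1 / y)) ^ (n + 1) := by
    rw [← mul_pow]; congr 1; field_simp
  rw [h2]
  calc y ^ (n + 1) * (1 + n * (1 / y)) ^ (n + 1) ≤ y ^ (n + 1) * (1 + (1 + n) ^ (n + 1) * (1 / y)) := by gcongr
    _ = y ^ n * (y + (1 + n) ^ (n + 1))   := by field_simp; ring
    _ ≤ y ^ n * (y + ((n : ℝ) + 1) ^ (n + 1) * (n + 1)) := by
      gcongr
      rw [add_comm (1 : ℝ)]
      have : 0 ≤ ((n : ℝ) + 1) ^ (n + 1) * n := by positivity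
      nlinarith

end EV

namespace EV

open MvPolynomial

theorem lw_real {N n p d : ℕ} (hN : N = n + 1) (hp : p.Prime) (f : MvPolynomial (Fin N) ℤ) (hd : 1 ≤ d) (hf : f.totalDegree = d)
    (hpd : 10 ^ 4 * d ^ 4 < p)
    (hirr : Irreducible (letI : Fact (Nat.Prime p) := ⟨hp⟩; map (Int.castRingHom (AlgebraicClosure (ZMod p))) f)) :
    letI : Fact (Nat.Prime p) := ⟨hp⟩
    map (Int.castRingHom (ZMod p)) f ≠ 0 ∧
    ((∑ c : Fin N → ZMod p, mu c (map (Int.castRingHom (ZMod p)) f) : ℕ) : ℝ) ≤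
      (p : ℝ) ^ n * (1 + 38 * d ^ 2 / √p) := by
  let _ : Fact (Nat.Prime p) := ⟨hp⟩
  set f' := map (Int.castRingHom (ZMod p)) f with hf'
  have h1 : map (algebraMap (ZMod p) (AlgebraicClosure (ZMod p))) f' =
      map (Int.castRingHom (AlgebraicClosure (ZMod p))) f := by
    rw [hf', map_map]
    congr 1
  have hirr' : Irreducible (map (algebraMap (ZMod p) (AlgebraicClosure (ZMod p))) f') := by
    rw [h1]; exact hirr
  have hne : f' ≠ 0 := by
    intro h
    rw [h, map_zero] at hirr'
    exact not_irreducible_zero hirr'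
  refine ⟨hne, ?_⟩
  have hδ : f'.totalDegree ≤ d := by
    rw [← hf]
    exact Finset.sup_mono (MvPolynomial.support_map_subset _ _)
  have hδ0 : f'.totalDegree ≠ 0 := by
    intro h
    rw [totalDegree_eq_zero_iff_eq_C] at h
    rw [h, map_C] at hirr'
    have hc : coeff 0 f' ≠ 0 := by
      intro h'
      rw [h', C_0] at h
      exact hne h
    apply hirr'.not_isUnit
    apply IsUnit.map
    rw [isUnit_iff_ne_zero]
    simpa using hc
  have hq1 : 100 * d ^ 2 ≤ Nat.sqrt p := by
    rw [Nat.le_sqrt']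
    have : (100 * d ^ 2) ^ 2 = 10 ^ 4 * d ^ 4 := by ring
    omega
  have hq2 : 100 * f'.totalDegree ^ 2 ≤ Nat.sqrt p :=
    le_trans (Nat.mul_le_mul_left _ (Nat.pow_le_pow_left hδ 2)) hq1
  have hlw := lang_weil (f := f') (δ := f'.totalDegree) (q := Nat.sqrt p) rfl (by omega) hirr'
    (Nat.sqrt_le' p) (Nat.lt_succ_sqrt' p) hq2
  have hpN : p ^ N = p ^ (n + 1) := by rw [hN]
  rw [Fintype.card_fin, hpN] at hlw
  have hp0 : (0 : ℝ) < p := by exact_mod_cast hp.pos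
  have hsq : (Nat.sqrt p : ℝ) ≤ √p := Real.nat_sqrt_le_real_sqrt
  have hsp : (0 : ℝ) < √p := Real.sqrt_pos.2 hp0
  have hss : √(p : ℝ) * √p = p := Real.mul_self_sqrt hp0.le
  have h2 : ((∑ c : Fin N → ZMod p, mu c f' : ℕ) : ℝ) * ((p : ℝ) * p) ≤
      (p : ℝ) ^ (n + 1) * (p + 38 * (f'.totalDegree : ℝ) ^ 2 * (Nat.sqrt p : ℕ)) := by
    exact_mod_cast hlw
  have h3 : (p : ℝ) + 38 * (f'.totalDegree : ℝ) ^ 2 * (Nat.sqrt p : ℕ) ≤ p * (1 + 38 * d ^ 2 / √p) := by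
    have h4 : (p : ℝ) * (1 + 38 * d ^ 2 / √p) = p + 38 * d ^ 2 * √p := by
      field_simp
      linear_combination (-(38 * (d : ℝ) ^ 2)) * hss
    rw [h4]
    gcongr
  have h5 : (p : ℝ) ^ (n + 1) * (p + 38 * (f'.totalDegree : ℝ) ^ 2 * (Nat.sqrt p : ℕ)) ≤
      ((p : ℝ) ^ n * (1 + 38 * d ^ 2 / √p)) * (p * p) := by
    calc _ ≤ (p : ℝ) ^ (n + 1) * (p * (1 + 38 * d ^ 2 / √p)) := by gcongr
      _ = _ := by ring
  exact le_of_mul_le_mul_right (h2.trans h5) (by positivity)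

theorem prime_exp (n : ℕ) (hn : 1 ≤ n) : ∃ C : ℝ, 0 ≤ C ∧ ∀ (d p s : ℕ) (hp : p.Prime) (f : MvPolynomial (Fin (n + 1)) ℤ)
    (Y : ℝ), 1 ≤ d → f.totalDegree = d → 10 ^ 4 * d ^ 4 < p →
    Irreducible (letI : Fact (Nat.Prime p) := ⟨hp⟩; map (Int.castRingHom (AlgebraicClosure (ZMod p))) f) →
    Y ^ n = n.factorial * s → (p : ℝ) ≤ Y →
    ∀ (P : Fin s → Fin (n + 1) → ℤ) (u : Fin s → MvPolynomial (Fin (n + 1)) ℤ), (∀ i, eval (P i) f = 0) →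
    ∃ e : ℕ, (p : ℤ) ^ e ∣ (Matrix.of fun i j => eval (P i) (u j)).det ∧
      s * ((n : ℝ) / (n + 1) * (Y / p) - 38 * d ^ 2 * Y / (p * √p) - C) ≤ e := by
  obtain ⟨C, hC, hCb⟩ := pow_add_bound n
  refine ⟨1 + 2 * C, by positivity, ?_⟩
  intro d p s hp f Y hd hf hpd hirr hY hpY P u hP
  let _ : Fact (Nat.Prime p) := ⟨hp⟩
  obtain ⟨hne, hlw⟩ := lw_real rfl hp f hd hf hpd hirr
  have hp0 : (0 : ℝ) < p := by exact_mod_cast hp.pos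
  have hsp : (0 : ℝ) < √p := Real.sqrt_pos.2 hp0
  set y := Y / p with hy
  have hy1 : 1 ≤ y := by rw [hy, one_le_div hp0]; exact hpY
  set J := ⌊y⌋₊ with hJ
  have hJy : (J : ℝ) ≤ y := Nat.floor_le (by linarith)
  have hJy' : y - 1 ≤ J := by have := Nat.lt_floor_add_one y; rw [← hJ] at this; linarith
  have hdvd := padic_dvd f hne P hP u J
  rw [Fintype.card_fin] at hdvd
  refine ⟨_, hdvd, ?_⟩
  set np := ∑ c : Fin (n + 1) → ZMod p, mu c (map (Int.castRingHom (ZMod p)) f) with hnp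
  set ε : ℝ := 38 * d ^ 2 / √p with hε
  have hε0 : 0 ≤ ε := by positivity
  have hε1 : ε ≤ 1 := by
    rw [hε, div_le_one hsp]
    have : (100 * (d : ℝ) ^ 2) ≤ √p := by
      apply Real.le_sqrt_of_sq_le
      have h : ((10 ^ 4 * d ^ 4 : ℕ) : ℝ) ≤ p := by exact_mod_cast hpd.le
      push_cast at h
      nlinarith
    nlinarith [sq_nonneg (d : ℝ)]
  have h1 : ((n + 1).factorial : ℝ) * (mons (n + 1) J).card ≤ y ^ n * (y + C) := by
    have h := card_mons_upper n J
    have h' : ((n + 1).factorial : ℝ) * (mons (n + 1) J).card ≤ ((J : ℝ) + n) ^ (n + 1) := by exact_mod_cast h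
    refine h'.trans (le_trans ?_ (hCb y hy1))
    gcongr
  have hfac : (0 : ℝ) < ((n + 1).factorial : ℝ) := by exact_mod_cast Nat.factorial_pos _
  have hpy : (p : ℝ) ^ n * y ^ n = n.factorial * s := by
    rw [← mul_pow, ← hY, hy]; congr 1; field_simp
  have h2 : (np : ℝ) * (mons (n + 1) J).card ≤ s * ((1 + ε) * (y + C) / (n + 1)) := by
    have h3 : ((n + 1).factorial : ℝ) * ((np : ℝ) * (mons (n + 1) J).card) ≤
        ((n + 1).factorial : ℝ) * (s * ((1 + ε) * (y + C) / (n + 1))) := by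
      calc ((n + 1).factorial : ℝ) * ((np : ℝ) * (mons (n + 1) J).card)
          = np * (((n + 1).factorial : ℝ) * (mons (n + 1) J).card) := by ring
        _ ≤ ((p : ℝ) ^ n * (1 + ε)) * (y ^ n * (y + C)) := by
            apply mul_le_mul hlw h1 (by positivity) (by positivity)
        _ = ((p : ℝ) ^ n * y ^ n) * ((1 + ε) * (y + C)) := by ring
        _ = _ := by
            rw [hpy, Nat.factorial_succ]
            push_cast
            field_simp
    exact le_of_mul_le_mul_left h3 hfac
  have h4 : ((J * s : ℕ) : ℝ) - ((np * (mons (n + 1) J).card : ℕ) : ℝ) ≤ ((J * s - np * (mons (n + 1) J).card : ℕ) : ℝ) := by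
    rw [sub_le_iff_le_add]
    have : J * s ≤ (J * s - np * (mons (n + 1) J).card) + np * (mons (n + 1) J).card := by omega
    exact_mod_cast this
  refine le_trans ?_ h4
  push_cast
  have hs0 : (0 : ℝ) ≤ s := by positivity
  have h5 : (s : ℝ) * (y - 1) ≤ J * s := by rw [mul_comm]; gcongr
  have h6 : 38 * (d : ℝ) ^ 2 * Y / (p * √p) = ε * y := by rw [hε, hy]; field_simp
  rw [h6]
  have h7 : (n : ℝ) / (n + 1) * y - ε * y - (1 + 2 * C) ≤ (y - 1) - (1 + ε) * (y + C) / (n + 1) := by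
    have hn1 : (0 : ℝ) < n + 1 := by positivity
    have h8 : (1 + ε) * (y + C) / (n + 1) ≤ y / (n + 1) + (ε * y + 2 * C) := by
      have h13 : (y / (n + 1) + (ε * y + 2 * C)) * (n + 1) = y + (ε * y + 2 * C) * (n + 1) := by field_simp
      rw [div_le_iff₀ hn1, h13]
      have h9 : 0 ≤ (ε * y + 2 * C) * n := by positivity
      have h10 : ε * C ≤ C := by nlinarith
      nlinarith
    have h11 : (n : ℝ) / (n + 1) * y = y - y / (n + 1) := by field_simp; ring
    rw [h11]
    linarith
  have h12 := mul_le_mul_of_nonneg_left h7 hs0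
  rw [mul_sub (s : ℝ) (y - 1)] at h12
  linarith

end EV

namespace EV

open MvPolynomial

/-- `f` stays absolutely irreducible modulo `p`. -/
def goodP {N : ℕ} (f : MvPolynomial (Fin N) ℤ) (p : ℕ) : Prop :=
  ∃ hp : p.Prime, Irreducible (letI : Fact (Nat.Prime p) := ⟨hp⟩; map (Int.castRingHom (AlgebraicClosure (ZMod p))) f)

theorem log_of_dvd {D : ℤ} (hD : D ≠ 0) (S : Finset ℕ) (hS : ∀ p ∈ S, p.Prime) (e : ℕ → ℕ)
    (he : ∀ p ∈ S, (p : ℤ) ^ e p ∣ D) : ∑ p ∈ S, (e p : ℝ) * Real.log p ≤ Real.log |(D : ℝ)| := by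
  have h1 : ∏ p ∈ S, (p : ℤ) ^ e p ∣ D := by
    apply Finset.prod_dvd_of_coprime
    · intro p hp q hq hpq
      apply IsCoprime.pow
      rw [Nat.isCoprime_iff_coprime]
      exact (Nat.coprime_primes (hS p hp) (hS q hq)).2 hpq
    · exact he
  have h2 : |∏ p ∈ S, (p : ℤ) ^ e p| ≤ |D| := by
    rw [Int.abs_eq_natAbs, Int.abs_eq_natAbs]
    exact_mod_cast Nat.le_of_dvd (Int.natAbs_pos.2 hD) (Int.natAbs_dvd_natAbs.2 h1)
  have h3 : (∏ p ∈ S, (p : ℝ) ^ e p) ≤ |(D : ℝ)| := by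
    have h4 : ((|∏ p ∈ S, (p : ℤ) ^ e p| : ℤ) : ℝ) ≤ ((|D| : ℤ) : ℝ) := by exact_mod_cast h2
    push_cast at h4
    exact (le_abs_self _).trans h4
  have hpos : ∀ p ∈ S, (p : ℝ) ^ e p ≠ 0 := fun p hp => by
    have := (hS p hp).pos
    positivity
  have h5 : 0 < ∏ p ∈ S, (p : ℝ) ^ e p := Finset.prod_pos (fun p hp => by
    have := (hS p hp).pos
    positivity)
  have h6 := Real.log_le_log h5 h3
  rw [Real.log_prod hpos] at h6
  simpa [Real.log_pow] using h6

theorem sum_primes (n : ℕ) (hn : 1 ≤ n) : ∃ C : ℝ, 0 ≤ C ∧ ∀ (d s : ℕ) (f : MvPolynomial (Fin (n + 1)) ℤ)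
    (Y Lb : ℝ), 1 ≤ d → f.totalDegree = d →
    (∀ S : Finset ℕ, (∀ p ∈ S, p.Prime ∧ 27 * d ^ 4 < p ∧ ¬ goodP f p) → ∑ p ∈ S, Real.log p / p ≤ Lb) →
    Y ^ n = n.factorial * s → 1 ≤ Y →
    ∀ (P : Fin s → Fin (n + 1) → ℤ) (u : Fin s → MvPolynomial (Fin (n + 1)) ℤ), (∀ i, eval (P i) f = 0) →
    (Matrix.of fun i j => eval (P i) (u j)).det ≠ 0 →
    s * ((n : ℝ) / (n + 1) * Y * (Real.log Y - 4 * Real.log d - Lb - C)) ≤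
      Real.log |(((Matrix.of fun i j => eval (P i) (u j)).det : ℤ) : ℝ)| := by
  classical
  obtain ⟨C0, hC0, hpe⟩ := prime_exp n hn
  obtain ⟨Cm, hCm, hml⟩ := msum_lower
  obtain ⟨C1, hC1, htail⟩ := tail_three_half
  have hl4 : 0 ≤ Real.log 4 := Real.log_nonneg (by norm_num)
  have hl2 : 0 ≤ Real.log 2 := Real.log_nonneg (by norm_num)
  have hlT : 0 ≤ Real.log (10 ^ 4) := Real.log_nonneg (by norm_num)
  refine ⟨Cm + Real.log (10 ^ 4) + Real.log 4 + Real.log 2 + 2 * (38 / 100 * C1 + C0 * Real.log 4), by positivity, ?_⟩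
  intro d s f Y Lb hd hf hbad hY hY1 P u hP hdet
  set Ny := ⌊Y⌋₊ with hNy
  have hNyY : (Ny : ℝ) ≤ Y := Nat.floor_le (by linarith)
  have hNy1 : 1 ≤ Ny := by rw [hNy, Nat.one_le_floor_iff]; exact hY1
  set K := 10 ^ 4 * d ^ 4 with hK
  have hK1 : 1 ≤ K := by
    have : 1 ≤ d ^ 4 := Nat.one_le_pow _ _ hd
    omega
  set G := (prs Ny).filter (fun p => K < p ∧ goodP f p) with hG
  set Bd := (prs Ny).filter (fun p => K < p ∧ ¬ goodP f p) with hBd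
  have hGp : ∀ p ∈ G, p.Prime ∧ p ≤ Ny ∧ K < p ∧ goodP f p := by
    intro p hp
    rw [hG, Finset.mem_filter, mem_prs] at hp
    exact ⟨hp.1.2, hp.1.1, hp.2⟩
  have hex : ∀ p, ∃ e : ℕ, p ∈ G → (p : ℤ) ^ e ∣ (Matrix.of fun i j => eval (P i) (u j)).det ∧
      s * ((n : ℝ) / (n + 1) * (Y / p) - 38 * d ^ 2 * Y / (p * √p) - C0) ≤ e := by
    intro p
    by_cases hp : p ∈ G
    · obtain ⟨h1, h2, h3, h4, h5⟩ := hGp p hp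
      obtain ⟨e, he⟩ := hpe d p s h1 f Y hd hf h3 h5 hY ((by exact_mod_cast h2 : (p : ℝ) ≤ Ny).trans hNyY) P u hP
      exact ⟨e, fun _ => he⟩
    · exact ⟨0, fun h => absurd h hp⟩
  choose e he using hex
  have hlog := log_of_dvd hdet G (fun p hp => (hGp p hp).1) e (fun p hp => (he p hp).1)
  refine le_trans ?_ hlog
  have hlp : ∀ p ∈ G, 0 ≤ Real.log p := fun p hp => Real.log_natCast_nonneg p
  have h1 : ∑ p ∈ G, (s * ((n : ℝ) / (n + 1) * (Y / p) - 38 * d ^ 2 * Y / (p * √p) - C0)) * Real.log p ≤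
      ∑ p ∈ G, (e p : ℝ) * Real.log p :=
    Finset.sum_le_sum (fun p hp => mul_le_mul_of_nonneg_right (he p hp).2 (hlp p hp))
  refine le_trans ?_ h1
  have h2 : ∑ p ∈ G, (s * ((n : ℝ) / (n + 1) * (Y / p) - 38 * d ^ 2 * Y / (p * √p) - C0)) * Real.log p =
      s * ((n : ℝ) / (n + 1) * Y * (∑ p ∈ G, Real.log p / p) - 38 * d ^ 2 * Y * (∑ p ∈ G, Real.log p / (p * √p))
        - C0 * ∑ p ∈ G, Real.log p) := by
    rw [Finset.mul_sum, Finset.mul_sum, Finset.mul_sum, ← Finset.sum_sub_distrib, ← Finset.sum_sub_distrib, Finset.mul_sum]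
    apply Finset.sum_congr rfl
    intro p _
    ring
  rw [h2]
  apply mul_le_mul_of_nonneg_left _ (by positivity)
  -- the three sums
  have hS1 : Real.log Y - Real.log 2 - Cm - (Real.log (10 ^ 4) + 4 * Real.log d) - Real.log 4 - Lb ≤
      ∑ p ∈ G, Real.log p / p := by
    have a1 : msum Ny ≤ msum K + (∑ p ∈ G, Real.log p / p) + ∑ p ∈ Bd, Real.log p / p := by
      unfold msum
      have hsub : prs Ny ⊆ prs K ∪ G ∪ Bd := by
        intro p hp
        rw [Finset.mem_union, Finset.mem_union, mem_prs, hG, hBd, Finset.mem_filter, Finset.mem_filter]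
        have := (mem_prs.1 hp).2
        by_cases hpK : p ≤ K
        · exact Or.inl (Or.inl ⟨hpK, this⟩)
        · by_cases hg : goodP f p
          · exact Or.inl (Or.inr ⟨hp, by omega, hg⟩)
          · exact Or.inr ⟨hp, by omega, hg⟩
      have hnn : ∀ p : ℕ, 0 ≤ Real.log p / p := fun p => div_nonneg (Real.log_natCast_nonneg p) (by positivity)
      refine (Finset.sum_le_sum_of_subset_of_nonneg hsub (fun p _ _ => hnn p)).trans ?_
      have b1 := Finset.sum_union_inter (s₁ := prs K ∪ G) (s₂ := Bd) (f := fun p : ℕ => Real.log p / p)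
      have b2 := Finset.sum_union_inter (s₁ := prs K) (s₂ := G) (f := fun p : ℕ => Real.log p / p)
      have b3 : 0 ≤ ∑ p ∈ (prs K ∪ G) ∩ Bd, Real.log (p : ℕ) / (p : ℝ) := Finset.sum_nonneg (fun p _ => hnn p)
      have b4 : 0 ≤ ∑ p ∈ prs K ∩ G, Real.log (p : ℕ) / (p : ℝ) := Finset.sum_nonneg (fun p _ => hnn p)
      linarith
    have a2 := hml Ny hNy1
    have a3 := msum_upper hK1
    have a4 : ∑ p ∈ Bd, Real.log p / p ≤ Lb := by
      apply hbad
      intro p hp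
      rw [hBd, Finset.mem_filter, mem_prs] at hp
      refine ⟨hp.1.2, ?_, hp.2.2⟩
      have := hp.2.1
      omega
    have a5 : Real.log K = Real.log (10 ^ 4) + 4 * Real.log d := by
      have hd0 : (d : ℝ) ≠ 0 := by positivity
      rw [hK]; push_cast
      rw [Real.log_mul (by norm_num) (by positivity), Real.log_pow (d : ℝ) 4]
      norm_num
    have a6 : Real.log Y - Real.log 2 ≤ Real.log Ny := by
      rw [← Real.log_div (by linarith) (by norm_num)]
      apply Real.log_le_log (by linarith)
      have := Nat.lt_floor_add_one Y
      rw [← hNy] at this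
      have : (1 : ℝ) ≤ Ny := by exact_mod_cast hNy1
      linarith
    rw [a5] at a3
    generalize Real.log (10 ^ 4) = L4 at a3 ⊢
    linarith only [a1, a2, a3, a4, a6]
  have hS2 : 38 * (d : ℝ) ^ 2 * Y * (∑ p ∈ G, Real.log p / (p * √p)) ≤ Y * (38 / 100 * C1) := by
    have a1 : ∑ p ∈ G, Real.log p / (p * √p) ≤ C1 / √(K : ℕ) := by
      refine le_trans ?_ (htail K Ny hK1)
      apply Finset.sum_le_sum_of_subset_of_nonneg
      · intro p hp
        rw [hG, Finset.mem_filter] at hp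
        exact Finset.mem_filter.2 ⟨hp.1, hp.2.1⟩
      · intro p _ _
        exact div_nonneg (Real.log_natCast_nonneg p) (by positivity)
    have a2 : √((K : ℕ) : ℝ) = 100 * d ^ 2 := by
      have : ((K : ℕ) : ℝ) = (100 * (d : ℝ) ^ 2) ^ 2 := by rw [hK]; push_cast; ring
      rw [this, Real.sqrt_sq (by positivity)]
    rw [a2] at a1
    have hd0 : (d : ℝ) ≠ 0 := by positivity
    calc 38 * (d : ℝ) ^ 2 * Y * (∑ p ∈ G, Real.log p / (p * √p)) ≤ 38 * (d : ℝ) ^ 2 * Y * (C1 / (100 * d ^ 2)) := by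
          gcongr
      _ = Y * (38 / 100 * C1) := by field_simp
  have hS3 : C0 * ∑ p ∈ G, Real.log p ≤ Y * (C0 * Real.log 4) := by
    have a1 : ∑ p ∈ G, Real.log p ≤ Real.log 4 * Ny := by
      refine le_trans ?_ (sum_log_prs_le Ny)
      apply Finset.sum_le_sum_of_subset_of_nonneg (Finset.filter_subset _ _)
      intro p _ _
      exact Real.log_natCast_nonneg p
    calc C0 * ∑ p ∈ G, Real.log p ≤ C0 * (Real.log 4 * Y) := by
          apply mul_le_mul_of_nonneg_left _ hC0
          exact a1.trans (mul_le_mul_of_nonneg_left hNyY hl4)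
      _ = _ := by ring
  have hhalf : (1 : ℝ) / 2 ≤ (n : ℝ) / (n + 1) := by
    have : (1 : ℝ) ≤ n := by exact_mod_cast hn
    rw [div_le_div_iff₀ (by norm_num) (by positivity)]
    linarith
  set r : ℝ := (n : ℝ) / (n + 1) with hr
  have hY0 : 0 ≤ Y := by linarith
  have hrY : 0 ≤ r * Y := by positivity
  have c1 := mul_le_mul_of_nonneg_left hS1 hrY
  set A : ℝ := 38 / 100 * C1 + C0 * Real.log 4 with hA
  have hA0 : 0 ≤ A := by positivity
  have c2 : Y * A ≤ r * Y * (2 * A) := by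
    have : 0 ≤ Y * A := by positivity
    nlinarith
  have c3 : r * Y * (Real.log Y - 4 * Real.log d - Lb - (Cm + Real.log (10 ^ 4) + Real.log 4 + Real.log 2 + 2 * A)) =
     r * Y * (Real.log Y - Real.log 2 - Cm - (Real.log (10 ^ 4) + 4 * Real.log d) - Real.log 4 - Lb) - r * Y * (2 * A) := by ring
  rw [c3]
  have c4 : Y * A = Y * (38 / 100 * C1) + Y * (C0 * Real.log 4) := by rw [hA]; ring
  linarith

end EV

namespace EV

open MvPolynomial

theorem key_real {n d δ M Y lB lξ ls W : ℝ} (hn : 1 ≤ n) (hd : 1 ≤ d) (hδ : 1 ≤ δ) (hM : 2 * d ≤ M)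
    (hY1 : δ * (M - d) ≤ Y) (hY2 : Y ≤ δ * (M + n)) (hlB : 0 ≤ lB) (hlξ : 0 ≤ lξ) (hls : ls ≤ n * Y)
    (h : n / (n + 1) * Y * W ≤ ls + M * (Real.log 2 + lB) - (M - (n + 1) ^ 2 * d) / ((n + 1) * d) * (lξ + d * lB)) :
    W ≤ 2 * (n + 2) + lB / δ - 1 / (n * d * δ) * lξ + (2 * (n + 1) ^ 2 + 2) * ((lξ + d * lB) / (δ * M)) := by
  have hM0 : 0 < M := by linarith
  have hd0 : 0 < d := by linarith
  have hδ0 : 0 < δ := by linarith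
  have hn0 : 0 < n := by linarith
  have hYM : δ * M / 2 ≤ Y := by
    refine le_trans ?_ hY1
    have : δ * (M / 2) ≤ δ * (M - d) := mul_le_mul_of_nonneg_left (by linarith) hδ0.le
    linarith
  have hδM : 0 < δ * M := by positivity
  have hY0 : 0 < Y := by linarith
  have hMY : M / 2 ≤ Y := by nlinarith
  have hpos : 0 < (n + 1) / (n * Y) := by positivity
  have h1 := mul_le_mul_of_nonneg_left h hpos.le
  have e1 : (n + 1) / (n * Y) * (n / (n + 1) * Y * W) = W := by field_simp
  have e2 : (n + 1) / (n * Y) * (ls + M * (Real.log 2 + lB) - (M - (n + 1) ^ 2 * d) / ((n + 1) * d) * (lξ + d * lB)) =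
      (n + 1) / (n * Y) * (ls + M * Real.log 2) + (M / Y) * lB - (M / Y) * (lξ / (n * d)) +
        (n + 1) ^ 2 / (n * Y) * (lξ + d * lB) := by
    field_simp
    ring
  rw [e1, e2] at h1
  have a1 : (n + 1) / (n * Y) * (ls + M * Real.log 2) ≤ 2 * (n + 2) := by
    have hl2 : Real.log 2 ≤ 1 := by
      have := Real.log_le_sub_one_of_pos (show (0 : ℝ) < 2 by norm_num)
      linarith
    have b1 : ls + M * Real.log 2 ≤ (n + 2) * Y := by
      have : M * Real.log 2 ≤ M * 1 := mul_le_mul_of_nonneg_left hl2 hM0.le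
      linarith
    calc (n + 1) / (n * Y) * (ls + M * Real.log 2) ≤ (n + 1) / (n * Y) * ((n + 2) * Y) :=
          mul_le_mul_of_nonneg_left b1 hpos.le
      _ = (n + 1) / n * (n + 2) := by field_simp
      _ ≤ 2 * (n + 2) := by
          apply mul_le_mul_of_nonneg_right _ (by linarith)
          rw [div_le_iff₀ hn0]; linarith
  have a2 : M / Y ≤ 1 / δ + 2 * (d / (δ * M)) := by
    have e3 : 1 / δ + 2 * (d / (δ * M)) = (M + 2 * d) / (δ * M) := by field_simp
    rw [e3, div_le_div_iff₀ hY0 hδM]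
    have b1 : (M + 2 * d) * (δ * (M - d)) ≤ (M + 2 * d) * Y := mul_le_mul_of_nonneg_left hY1 (by linarith)
    have b2 : (M + 2 * d) * (δ * (M - d)) - M * (δ * M) = δ * d * (M - 2 * d) := by ring
    have b3 : 0 ≤ δ * d * (M - 2 * d) := mul_nonneg (by positivity) (by linarith)
    linarith
  have a3 : 1 / δ - n / (δ * M) ≤ M / Y := by
    have e3 : 1 / δ - n / (δ * M) = (M - n) / (δ * M) := by field_simp
    rw [e3, div_le_div_iff₀ hδM hY0]
    rcases le_total M n with hMn | hMn
    · have : (M - n) * Y ≤ 0 := mul_nonpos_of_nonpos_of_nonneg (by linarith) hY0.le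
      have : 0 < M * (δ * M) := by positivity
      linarith
    · have b1 : (M - n) * Y ≤ (M - n) * (δ * (M + n)) := mul_le_mul_of_nonneg_left hY2 (by linarith)
      have b2 : M * (δ * M) - (M - n) * (δ * (M + n)) = δ * n ^ 2 := by ring
      have b3 : 0 ≤ δ * n ^ 2 := by positivity
      linarith
  have a4 : (n + 1) ^ 2 / (n * Y) * (lξ + d * lB) ≤ (2 * (n + 1) ^ 2) * ((lξ + d * lB) / (δ * M)) := by
    have b1 : (n + 1) ^ 2 / (n * Y) ≤ 2 * (n + 1) ^ 2 / (δ * M) := by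
      rw [div_le_div_iff₀ (by positivity) hδM]
      have : δ * M ≤ 2 * (n * Y) := by nlinarith
      nlinarith [sq_nonneg (n + 1)]
    have b2 : 0 ≤ lξ + d * lB := by positivity
    have := mul_le_mul_of_nonneg_right b1 b2
    refine this.trans (le_of_eq ?_)
    field_simp
  have c2 := mul_le_mul_of_nonneg_right a2 hlB
  have c3 := mul_le_mul_of_nonneg_right a3 (show 0 ≤ lξ / (n * d) by positivity)
  have e4 : (1 / δ - n / (δ * M)) * (lξ / (n * d)) = 1 / (n * d * δ) * lξ - lξ / (d * (δ * M)) := by field_simp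
  have e5 : (1 / δ + 2 * (d / (δ * M))) * lB = lB / δ + 2 * (d * lB / (δ * M)) := by ring
  have c4 : lξ / (d * (δ * M)) ≤ lξ / (δ * M) := by
    apply div_le_div_of_nonneg_left hlξ hδM
    nlinarith
  have e6 : (2 * (n + 1) ^ 2 + 2) * ((lξ + d * lB) / (δ * M)) = (2 * (n + 1) ^ 2) * ((lξ + d * lB) / (δ * M)) +
     2 * (lξ / (δ * M)) + 2 * (d * lB / (δ * M)) := by ring
  have c5 : 0 ≤ lξ / (δ * M) := by positivity
  rw [e4] at c3
  rw [e5] at c2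
  rw [e6]
  linarith

theorem ts_real {n : ℕ} {d M s t F : ℝ} (hn1 : (1 : ℝ) ≤ n) (hd1 : 1 ≤ d) (hMr : 2 * d ≤ M) (hs0 : 0 < s) (ht0 : 0 ≤ t)
    (hfac0 : 0 < F) (hs2r : F * s ≤ d * (M + n) ^ n) (h1r : (M + 1 - d) ^ (n + 1) ≤ (n + 1) * (F * t)) :
    s * ((M - ((n : ℝ) + 1) ^ 2 * d) / ((n + 1) * d)) ≤ t := by
  set A : ℝ := M + n with hA
  have hA0 : 0 < A := by
      linarith
  set K : ℝ := M + 1 - d with hK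
  have hK0 : 0 ≤ K := by rw [hK]; linarith
  have h3 : A ^ n * (M - ((n : ℝ) + 1) ^ 2 * d) ≤ K ^ (n + 1) := by
    have b1 := one_add_mul_le_pow (show (-2 : ℝ) ≤ -((A - K) / A) by
      have : (A - K) / A ≤ 1 := by rw [div_le_one hA0]; linarith
      linarith) (n + 1)
    have b2 : 1 + -((A - K) / A) = K / A := by field_simp; ring
    rw [b2, div_pow, le_div_iff₀ (by positivity)] at b1
    refine le_trans ?_ b1
    push_cast
    have b3 : (1 + ((n : ℝ) + 1) * -((A - K) / A)) * A ^ (n + 1) = A ^ n * (A - (n + 1) * (A - K)) := by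
      rw [pow_succ]; field_simp
      ring
    rw [b3]
    apply mul_le_mul_of_nonneg_left _ (by positivity)
    have b4 : A - K ≤ (n + 1) * d := by
      rw [hA, hK]
      nlinarith
    have b5 : ((n : ℝ) + 1) * (A - K) ≤ (n + 1) * ((n + 1) * d) := mul_le_mul_of_nonneg_left b4 (by positivity)
    have b6 : M ≤ A := by rw [hA]; linarith
    nlinarith
  rcases le_total (M - ((n : ℝ) + 1) ^ 2 * d) 0 with hneg | hpos
  · have : s * ((M - ((n : ℝ) + 1) ^ 2 * d) / ((n + 1) * d)) ≤ 0 :=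
      mul_nonpos_of_nonneg_of_nonpos hs0.le (div_nonpos_of_nonpos_of_nonneg hneg (by positivity))
    have : (0 : ℝ) ≤ t := by positivity
    linarith
  · rw [← mul_div_assoc, div_le_iff₀ (by positivity)]
    have h4 : F * (s * (M - ((n : ℝ) + 1) ^ 2 * d)) ≤ F * (t * ((n + 1) * d)) := by
      calc F * (s * (M - ((n : ℝ) + 1) ^ 2 * d)) = (F * s) * (M - ((n : ℝ) + 1) ^ 2 * d) := by ring
        _ ≤ (d * A ^ n) * (M - ((n : ℝ) + 1) ^ 2 * d) := mul_le_mul_of_nonneg_right hs2r hpos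
        _ = d * (A ^ n * (M - ((n : ℝ) + 1) ^ 2 * d)) := by ring
        _ ≤ d * ((n + 1) * (F * t)) := mul_le_mul_of_nonneg_left (h3.trans h1r) (by positivity)
        _ = _ := by ring
    exact le_of_mul_le_mul_left h4 hfac0

set_option maxHeartbeats 1000000 in
theorem key_ineq (n : ℕ) (hn : 1 ≤ n) : ∃ C : ℝ, 0 ≤ C ∧ ∀ (d M : ℕ) (f : MvPolynomial (Fin (n + 1)) ℤ)
    (B Lb : ℝ) (m : Fin (n + 1) →₀ ℕ), 1 ≤ d → f.totalDegree = d → f.support.gcd f.coeff = 1 → 1 ≤ B → 2 * d ≤ M →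
    (∀ S : Finset ℕ, (∀ p ∈ S, p.Prime ∧ 27 * d ^ 4 < p ∧ ¬ goodP f p) → ∑ p ∈ S, Real.log p / p ≤ Lb) →
    (∀ g : MvPolynomial (Fin (n + 1)) ℤ, g.totalDegree ≤ M →
      (∀ x : Fin (n + 1) → ℤ, eval x f = 0 → (∀ i, |(x i : ℝ)| ≤ B) → eval x g = 0) → f ∣ g) →
    m ∈ f.support → B ^ d ≤ |((f.coeff m : ℤ) : ℝ)| * B ^ m.degree →
    ∀ δ lξ : ℝ, δ = (d : ℝ) ^ ((1 : ℝ) / n) →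
    lξ = Real.log (|((f.coeff m : ℤ) : ℝ)| * B ^ m.degree) - d * Real.log B →
    Real.log (δ * M) ≤ 4 * Real.log d + Lb + C + Real.log B / δ - 1 / (n * d * δ) * lξ +
      C * ((lξ + d * Real.log B) / (δ * M)) := by
  obtain ⟨C, hC, hsp⟩ := sum_primes n hn
  have hn1 : (1 : ℝ) ≤ n := by exact_mod_cast hn
  have hl2 : 0 ≤ Real.log 2 := Real.log_nonneg (by norm_num)
  refine ⟨C + 2 * (n + 2) + Real.log 2 + (2 * (n + 1) ^ 2 + 2), by positivity, ?_⟩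
  intro d M f B Lb m hd hf hprim hB hM hbad hno hm hX δ lξ hδ hlξ
  have hf0 : f ≠ 0 := by
    rintro rfl
    simp at hm
  obtain ⟨s, hs⟩ : ∃ s, s = (mons (n + 1) (M + 1)).card - (mons (n + 1) (M + 1 - d)).card := ⟨_, rfl⟩
  obtain ⟨u, P, hP, hdet, hdb⟩ := exists_det hf hf0 hprim (by omega : d ≤ M) hB hno hs
  obtain ⟨t, ht⟩ : ∃ t, t = (mons (n + 1) (M + 1 - d)).card := ⟨_, rfl⟩
  obtain ⟨Δ, hΔ⟩ : ∃ Δ : ℤ, Δ = (Matrix.of fun i j => eval (P i) (u j)).det := ⟨_, rfl⟩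
  set X : ℝ := |((f.coeff m : ℤ) : ℝ)| * B ^ m.degree with hXdef
  have hB0 : 0 < B := by linarith
  have hlB : 0 ≤ Real.log B := Real.log_nonneg hB
  have hBd : 1 ≤ B ^ d := one_le_pow₀ hB
  have hX0 : 0 < X := by linarith
  have hlX : lξ + d * Real.log B = Real.log X := by rw [hlξ]; ring
  have hlξ0 : 0 ≤ lξ := by
    rw [hlξ, ← Real.log_pow]
    have := Real.log_le_log (by linarith) hX
    linarith
  have hd1 : (1 : ℝ) ≤ d := by exact_mod_cast hd
  have hδ1 : 1 ≤ δ := by rw [hδ]; exact Real.one_le_rpow hd1 (by positivity)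
  have hδn : δ ^ n = d := by
    rw [hδ, one_div]
    exact Real.rpow_inv_natCast_pow (by positivity) (by omega)
  have hMr : 2 * (d : ℝ) ≤ M := by exact_mod_cast hM
  -- bounds on s
  obtain ⟨_, hs1, hs2⟩ := card_diff_bounds n (M + 1 - d) d
  rw [show M + 1 - d + d = M + 1 by omega, ← hs] at hs1 hs2
  rw [show M + 1 - 1 + n = M + n by omega] at hs2
  have hfac0 : (0 : ℝ) < n.factorial := by exact_mod_cast Nat.factorial_pos n
  have hfac1 : (1 : ℝ) ≤ n.factorial := by exact_mod_cast Nat.factorial_pos n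
  have hs1r : (d : ℝ) * ((M : ℝ) - d) ^ n ≤ n.factorial * s := by
    have h1 : ((d * (M + 1 - d + 1) ^ n : ℕ) : ℝ) ≤ ((n.factorial * s : ℕ) : ℝ) := by exact_mod_cast hs1
    push_cast at h1
    refine le_trans ?_ h1
    apply mul_le_mul_of_nonneg_left _ (by positivity)
    apply pow_le_pow_left₀ (by linarith)
    rw [Nat.cast_sub (by omega)]
    push_cast
    linarith
  have hs2r : (n.factorial : ℝ) * s ≤ d * ((M : ℝ) + n) ^ n := by exact_mod_cast hs2
  have hs0 : (0 : ℝ) < s := by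
    have : 0 < (d : ℝ) * ((M : ℝ) - d) ^ n := by
      have : 0 < (M : ℝ) - d := by linarith
      positivity
    by_contra hcon
    have : (n.factorial : ℝ) * s ≤ 0 := mul_nonpos_of_nonneg_of_nonpos hfac0.le (by linarith)
    linarith
  have hs1' : (1 : ℝ) ≤ s := by
    have : 0 < s := by exact_mod_cast hs0
    exact_mod_cast this
  set Y : ℝ := ((n.factorial : ℝ) * s) ^ ((1 : ℝ) / n) with hYdef
  have hYn : Y ^ n = n.factorial * s := by
    rw [hYdef, one_div]
    exact Real.rpow_inv_natCast_pow (by positivity) (by omega)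
  have hYnn : 0 ≤ Y := by rw [hYdef]; positivity
  have hY1 : δ * (M - d) ≤ Y := by
    apply le_of_pow_le_pow_left₀ (by omega : n ≠ 0) hYnn
    rw [mul_pow, hδn, hYn]
    exact hs1r
  have hY2 : Y ≤ δ * (M + n) := by
    apply le_of_pow_le_pow_left₀ (by omega : n ≠ 0) (by positivity)
    rw [mul_pow, hδn, hYn]
    exact hs2r
  have hYge1 : 1 ≤ Y := by nlinarith
  have hls : Real.log s ≤ n * Y := by
    have h1 : (s : ℝ) ≤ Y ^ n := by rw [hYn]; nlinarith
    have h2 := Real.log_le_log hs0 h1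
    rw [Real.log_pow] at h2
    have h3 := Real.log_le_sub_one_of_pos (show 0 < Y by linarith)
    have h4 : (n : ℝ) * Real.log Y ≤ n * Y := by
      apply mul_le_mul_of_nonneg_left _ (by positivity)
      linarith
    linarith
  have hsum := hsp d s f Y Lb hd hf hbad hYn hYge1 P u hP hdet
  rw [← hΔ] at hsum hdet
  -- upper bound
  have hΔ0 : 0 < |(Δ : ℝ)| := abs_pos.2 (by exact_mod_cast hdet)
  have hup : Real.log |(Δ : ℝ)| + t * Real.log X ≤ s * Real.log s + M * s * (Real.log 2 + Real.log B) := by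
    have h1 := hdb m hm
    rw [← hΔ, ← ht, ← hXdef] at h1
    have h2 : (s.factorial : ℝ) * (2 * B) ^ (M * s) ≤ (s : ℝ) ^ s * (2 * B) ^ (M * s) := by
      apply mul_le_mul_of_nonneg_right _ (by positivity)
      exact_mod_cast Nat.factorial_le_pow s
    have h3 := Real.log_le_log (by positivity) (h1.trans h2)
    rw [Real.log_mul hΔ0.ne' (by positivity), Real.log_mul (by positivity) (by positivity), Real.log_pow, Real.log_pow,
      Real.log_pow, Real.log_mul (by norm_num) hB0.ne'] at h3
    push_cast at h3
    exact h3
  -- t versus s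
  have hts : (s : ℝ) * ((M - ((n : ℝ) + 1) ^ 2 * d) / ((n + 1) * d)) ≤ t := by
    have h1 := card_mons_lower n (M + 1 - d)
    rw [← ht] at h1
    have h1r : ((M : ℝ) + 1 - d) ^ (n + 1) ≤ (n + 1) * (n.factorial * t) := by
      have h2 : (((M + 1 - d) ^ (n + 1) : ℕ) : ℝ) ≤ (((n + 1).factorial * t : ℕ) : ℝ) := by exact_mod_cast h1
      rw [Nat.factorial_succ] at h2
      push_cast at h2
      rw [Nat.cast_sub (by omega)] at h2
      push_cast at h2
      linarith
    exact ts_real hn1 hd1 hMr hs0 (by positivity) hfac0 hs2r h1r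
  have hlX0 : 0 ≤ Real.log X := Real.log_nonneg (by linarith)
  have hmain : (n : ℝ) / (n + 1) * Y * (Real.log Y - 4 * Real.log d - Lb - C) ≤
      Real.log s + M * (Real.log 2 + Real.log B) - (M - ((n : ℝ) + 1) ^ 2 * d) / ((n + 1) * d) * (lξ + d * Real.log B) := by
    rw [hlX]
    have h5 := mul_le_mul_of_nonneg_right hts hlX0
    have h6 : (s : ℝ) * ((n : ℝ) / (n + 1) * Y * (Real.log Y - 4 * Real.log d - Lb - C)) ≤
        s * (Real.log s + M * (Real.log 2 + Real.log B) - (M - ((n : ℝ) + 1) ^ 2 * d) / ((n + 1) * d) * Real.log X) := by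
      refine hsum.trans ?_
      linarith
    exact le_of_mul_le_mul_left h6 hs0
  have hfin := key_real hn1 hd1 hδ1 hMr hY1 hY2 hlB hlξ0 hls hmain
  have hM0 : (0 : ℝ) < M := by linarith
  have hlogY : Real.log (δ * M) - Real.log 2 ≤ Real.log Y := by
    rw [← Real.log_div (by positivity) (by norm_num)]
    apply Real.log_le_log (by positivity)
    have : δ * (M / 2) ≤ δ * (M - d) := mul_le_mul_of_nonneg_left (by linarith) (by linarith)
    linarith
  set Q : ℝ := (lξ + d * Real.log B) / (δ * M) with hQ
  have hQ0 : 0 ≤ Q := by positivity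
  have h7 : 0 ≤ (C + 2 * ((n : ℝ) + 2) + Real.log 2) * Q := by positivity
  have h8 : (C + 2 * ((n : ℝ) + 2) + Real.log 2 + (2 * (n + 1) ^ 2 + 2)) * Q = (C + 2 * ((n : ℝ) + 2) + Real.log 2) * Q +
    (2 * (n + 1) ^ 2 + 2) * Q := by ring
  have h9 : (0 : ℝ) ≤ 2 * (n + 1) ^ 2 + 2 := by positivity
  rw [h8]
  linarith

end EV

namespace EV

set_option maxHeartbeats 4000000 in
theorem final_real {n C Cb : ℝ} (hn : 1 ≤ n) (hC : 0 ≤ C) (hCb : 0 < Cb) : ∃ k : ℝ, 1 ≤ k ∧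
    ∀ d δ lB lξ lξ0 b μ τ : ℝ, 1 ≤ d → 1 ≤ δ → δ ≤ d → 0 ≤ lB → 0 ≤ lξ0 → lξ0 ≤ lξ → 1 ≤ b →
    d ^ 2 * b ≤ Cb * (d ^ 2 + (lξ + d * lB)) →
    τ = Real.exp (lB / δ - 1 / (n * d * δ) * lξ0) * d ^ 2 * min (lξ0 + d * lB + d ^ 2) (d ^ 2 * b) →
    k * (τ + d * lB + d ^ 4) ≤ μ →
    Real.log μ ≤ 4 * Real.log d + Real.log b + C + lB / δ - 1 / (n * d * δ) * lξ + C * ((lξ + d * lB) / μ) → False := by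
  set k : ℝ := 1 + 2 * C * n + 4 * n + Real.exp (3 * C) * (1 + Cb * (1 + n)) + 8 * n * Cb * Real.exp (2 * C) with hk
  have hE3 : 0 < Real.exp (3 * C) := Real.exp_pos _
  have hE2 : 0 < Real.exp (2 * C) := Real.exp_pos _
  have hn0 : 0 < n := by linarith
  have p1 : 0 ≤ 2 * C * n := by positivity
  have p2 : 0 ≤ Real.exp (3 * C) * (1 + Cb * (1 + n)) := by positivity
  have p3 : 0 ≤ 8 * n * Cb * Real.exp (2 * C) := by positivity
  have hk1 : 1 ≤ k := by linarith
  refine ⟨k, hk1, ?_⟩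
  intro d δ lB lξ lξ0 b μ τ hd hδ hδd hlB hlξ0 hlξ hb hbC hτ hμ hkey
  have hd0 : 0 < d := by linarith
  have hδ0 : 0 < δ := by linarith
  have hb0 : 0 < b := by linarith
  have hlξn : 0 ≤ lξ := by linarith
  obtain ⟨α, hα⟩ : ∃ α, α = 1 / (n * d * δ) := ⟨_, rfl⟩
  rw [← hα] at hτ hkey
  have hα0 : 0 < α := by rw [hα]; positivity
  have hαi : α * (n * d * δ) = 1 := by rw [hα]; field_simp
  have hmin0 : 0 < min (lξ0 + d * lB + d ^ 2) (d ^ 2 * b) := lt_min (by positivity) (by positivity)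
  have hτ0 : 0 < τ := by rw [hτ]; positivity
  have hk0 : 0 < k := by linarith
  have hdB : 0 ≤ d * lB := by positivity
  have hd4 : 0 < d ^ 4 := by positivity
  have m0 : 0 < k * (τ + d * lB + d ^ 4) := by positivity
  have hμ0 : 0 < μ := by linarith
  have m1 : k * τ < μ := by
    have : k * (τ + d * lB + d ^ 4) = k * τ + k * (d * lB) + k * d ^ 4 := by ring
    have : 0 ≤ k * (d * lB) := by positivity
    have : 0 < k * d ^ 4 := by positivity
    linarith
  have m2 : k * (d * lB) ≤ μ := by
    have : k * (τ + d * lB + d ^ 4) = k * τ + k * (d * lB) + k * d ^ 4 := by ring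
    have : 0 ≤ k * τ := by positivity
    have : 0 < k * d ^ 4 := by positivity
    linarith
  have m3 : k * d ^ 4 ≤ μ := by
    have : k * (τ + d * lB + d ^ 4) = k * τ + k * (d * lB) + k * d ^ 4 := by ring
    have : 0 ≤ k * τ := by positivity
    have : 0 ≤ k * (d * lB) := by positivity
    linarith
  have m4 : d * lB ≤ μ := (le_mul_of_one_le_left hdB hk1).trans m2
  have hsplit : C * ((lξ + d * lB) / μ) ≤ C * (lξ / μ) + C := by
    have : (lξ + d * lB) / μ ≤ lξ / μ + 1 := by
      rw [add_div]
      have : d * lB / μ ≤ 1 := by rw [div_le_one hμ0]; exact m4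
      linarith
    have := mul_le_mul_of_nonneg_left this hC
    linarith
  rcases le_total lξ μ with hcase | hcase
  · -- Case 1
    have h1 : C * (lξ / μ) ≤ C := by
      have : lξ / μ ≤ 1 := by rw [div_le_one hμ0]; exact hcase
      exact mul_le_of_le_one_right hC this
    have h2 : Real.log μ ≤ Real.log (d ^ 4 * b) + (3 * C + (lB / δ - α * lξ)) := by
      rw [Real.log_mul (by positivity) hb0.ne', Real.log_pow]
      push_cast
      linarith
    have h3 : μ ≤ d ^ 4 * b * (Real.exp (3 * C) * Real.exp (lB / δ - α * lξ)) := by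
      rw [← Real.exp_add]
      have := Real.exp_le_exp.2 h2
      rwa [Real.exp_log hμ0, Real.exp_add, Real.exp_log (by positivity)] at this
    obtain ⟨L, hL⟩ : ∃ L, L = lξ - lξ0 := ⟨_, rfl⟩
    have hL0 : 0 ≤ L := by linarith
    have h4 : Real.exp (lB / δ - α * lξ) = Real.exp (lB / δ - α * lξ0) * Real.exp (-(α * L)) := by
      rw [← Real.exp_add, hL]; congr 1; ring
    have hEx : 0 < Real.exp (lB / δ - α * lξ0) := Real.exp_pos _
    obtain ⟨Z, hZ⟩ : ∃ Z, Z = Real.exp (lB / δ - α * lξ0) := ⟨_, rfl⟩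
    rw [← hZ] at h4 hEx hτ
    obtain ⟨w, hw⟩ : ∃ w, w = Real.exp (-(α * L)) := ⟨_, rfl⟩
    have hw0 : 0 < w := by rw [hw]; exact Real.exp_pos _
    have hw1 : w ≤ 1 := by
      rw [hw]; apply Real.exp_le_one_iff.2
      have : 0 ≤ α * L := by positivity
      linarith
    have hw2 : w * (1 + α * L) ≤ 1 := by
      have h5 := Real.add_one_le_exp (α * L)
      have h6 : w * Real.exp (α * L) = 1 := by rw [hw, ← Real.exp_add]; simp
      rw [← h6]
      apply mul_le_mul_of_nonneg_left _ hw0.le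
      linarith
    rw [h4, ← hw] at h3
    rw [hτ] at m1
    have h7 : k * min (lξ0 + d * lB + d ^ 2) (d ^ 2 * b) < Real.exp (3 * C) * (d ^ 2 * b * w) := by
      have h8 : (Z * d ^ 2) * (k * min (lξ0 + d * lB + d ^ 2) (d ^ 2 * b)) < (Z * d ^ 2) * (Real.exp (3 * C) * (d ^ 2 * b * w)) := by
        have e1 : (Z * d ^ 2) * (k * min (lξ0 + d * lB + d ^ 2) (d ^ 2 * b)) = k * (Z * d ^ 2 * min (lξ0 + d * lB + d ^ 2) (d ^ 2 * b)) := by ring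
        have e2 : (Z * d ^ 2) * (Real.exp (3 * C) * (d ^ 2 * b * w)) = d ^ 4 * b * (Real.exp (3 * C) * (Z * w)) := by ring
        rw [e1, e2]
        linarith
      exact lt_of_mul_lt_mul_left h8 (by positivity)
    have hA1 : d ^ 2 * b * w ≤ d ^ 2 * b := by
      have : 0 ≤ d ^ 2 * b := by positivity
      exact mul_le_of_le_one_right this hw1
    have hA2 : d ^ 2 * b * w ≤ Cb * (1 + n) * (lξ0 + d * lB + d ^ 2) := by
      obtain ⟨A, hA⟩ : ∃ A, A = lξ0 + d * lB + d ^ 2 := ⟨_, rfl⟩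
      have hAd : d ^ 2 ≤ A := by rw [hA]; linarith
      have hA0 : 0 < A := lt_of_lt_of_le (by positivity) hAd
      have e1 : d ^ 2 + (lξ + d * lB) = A + L := by rw [hA, hL]; ring
      rw [e1] at hbC
      rw [← hA]
      have h9 : L ≤ n * A * (α * L) := by
        have : 1 ≤ n * A * α := by
          rw [← hαi]
          have : d * δ ≤ A := by
            refine le_trans ?_ hAd
            rw [pow_two]
            exact mul_le_mul_of_nonneg_left hδd hd0.le
          have h10 : α * (n * (d * δ)) ≤ α * (n * A) := by gcongr
          linarith
        calc L = 1 * L := (one_mul L).symm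
          _ ≤ (n * A * α) * L := mul_le_mul_of_nonneg_right this hL0
          _ = _ := by ring
      have h11 : A + L ≤ (1 + n) * A * (1 + α * L) := by
        have : 0 ≤ A * (α * L) := by positivity
        have : 0 ≤ n * A := by positivity
        have : (1 + n) * A * (1 + α * L) = A + n * A + A * (α * L) + n * A * (α * L) := by ring
        linarith
      calc d ^ 2 * b * w ≤ Cb * (A + L) * w := mul_le_mul_of_nonneg_right hbC hw0.le
        _ ≤ Cb * ((1 + n) * A * (1 + α * L)) * w := by gcongr
        _ = Cb * (1 + n) * A * (w * (1 + α * L)) := by ring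
        _ ≤ Cb * (1 + n) * A * 1 := by gcongr
        _ = _ := by ring
    have hfin : d ^ 2 * b * w ≤ (1 + Cb * (1 + n)) * min (lξ0 + d * lB + d ^ 2) (d ^ 2 * b) := by
      have q : 0 ≤ Cb * (1 + n) := by positivity
      rcases min_choice (lξ0 + d * lB + d ^ 2) (d ^ 2 * b) with h | h <;> rw [h]
      · rw [h] at hmin0
        rw [one_add_mul]
        linarith
      · rw [h] at hmin0
        rw [one_add_mul]
        have := mul_nonneg q hmin0.le
        linarith
    have h12 := mul_le_mul_of_nonneg_left hfin hE3.le
    have h13 : Real.exp (3 * C) * (1 + Cb * (1 + n)) * min (lξ0 + d * lB + d ^ 2) (d ^ 2 * b) ≤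
        k * min (lξ0 + d * lB + d ^ 2) (d ^ 2 * b) := by
      apply mul_le_mul_of_nonneg_right _ hmin0.le
      linarith
    linarith
  · -- Case 2
    have hdd : d * δ ≤ d ^ 2 := by
      rw [pow_two]
      exact mul_le_mul_of_nonneg_left hδd hd0.le
    have hd24 : d ^ 2 ≤ d ^ 4 := pow_le_pow_right₀ hd (by norm_num)
    obtain ⟨v, hv⟩ : ∃ v, v = α * lξ := ⟨_, rfl⟩
    have hv0 : 0 ≤ v := by rw [hv]; positivity
    have hlv : lξ = n * d * δ * v := by rw [hv, ← mul_assoc, mul_comm (n * d * δ), hαi, one_mul]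
    have h1 : C * (lξ / μ) ≤ v / 2 := by
      have h2 : 2 * C * n * (d * δ) ≤ μ := by
        have : 2 * C * n * (d * δ) ≤ k * d ^ 4 := by
          apply mul_le_mul _ (hdd.trans hd24) (by positivity) hk0.le
          linarith
        linarith
      rw [hlv, ← mul_div_assoc, div_le_iff₀ hμ0]
      have := mul_le_mul_of_nonneg_right h2 hv0
      linarith
    have h3 : lB / δ ≤ v / 4 := by
      rw [div_le_iff₀ hδ0]
      have h4 : 4 * n * (d * lB) ≤ n * d * δ * v := by
        rw [← hlv]
        have : 4 * n * (d * lB) ≤ k * (d * lB) := by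
          apply mul_le_mul_of_nonneg_right _ hdB
          linarith
        linarith
      have h5 : (n * d) * (4 * lB) ≤ (n * d) * (δ * v) := by linarith
      have := le_of_mul_le_mul_left h5 (by positivity)
      linarith
    have h6 : b ≤ Cb * (8 * n) * ((1 + 2 * n * v) / (8 * n)) := by
      have h7 : d ^ 2 * b ≤ d ^ 2 * (Cb * (1 + 2 * n * v)) := by
        refine hbC.trans ?_
        have h8 : lξ + d * lB ≤ 2 * lξ := by linarith
        have h9 : lξ ≤ n * v * d ^ 2 := by
          rw [hlv]
          have : n * v * (d * δ) ≤ n * v * d ^ 2 := mul_le_mul_of_nonneg_left hdd (by positivity)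
          linarith
        have h10 : d ^ 2 + (lξ + d * lB) ≤ d ^ 2 * (1 + 2 * n * v) := by linarith
        calc _ ≤ Cb * (d ^ 2 * (1 + 2 * n * v)) := mul_le_mul_of_nonneg_left h10 hCb.le
          _ = _ := by ring
      have h11 := le_of_mul_le_mul_left h7 (by positivity)
      refine h11.trans (le_of_eq ?_)
      field_simp
    have h12 : Real.log b ≤ Real.log (Cb * (8 * n)) + v / 4 := by
      have h13 := Real.log_le_log hb0 h6
      rw [Real.log_mul (by positivity) (by positivity)] at h13
      have h14 := Real.log_le_sub_one_of_pos (show 0 < (1 + 2 * n * v) / (8 * n) by positivity)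
      have h15 : (1 + 2 * n * v) / (8 * n) = 1 / (8 * n) + v / 4 := by field_simp; ring
      have h16 : 1 / (8 * n) ≤ 1 := by rw [div_le_one (by positivity)]; linarith
      linarith
    have h17 : Real.log μ ≤ Real.log (d ^ 4) + (Real.log (Cb * (8 * n)) + 2 * C) := by
      rw [Real.log_pow]
      push_cast
      rw [← hv] at hkey
      linarith
    have h18 : μ ≤ d ^ 4 * (Cb * (8 * n) * Real.exp (2 * C)) := by
      have := Real.exp_le_exp.2 h17
      rwa [Real.exp_log hμ0, Real.exp_add, Real.exp_log hd4, Real.exp_add, Real.exp_log (by positivity)] at this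
    have h19 : d ^ 4 * k ≤ d ^ 4 * (Cb * (8 * n) * Real.exp (2 * C)) := by linarith
    have h20 := le_of_mul_le_mul_left h19 hd4
    have : 8 * n * Cb * Real.exp (2 * C) = Cb * (8 * n) * Real.exp (2 * C) := by ring
    linarith

end EV

namespace EV
open MvPolynomial

/-- Facts about the finite set of bad primes. -/
theorem bad_facts {n : ℕ} {Cb : ℝ}
    (hCb : ∀ (d : ℕ), 1 ≤ d → ∀ (H : ℕ), 1 ≤ H → ∀ (Y : ℤ), Y ≠ 0 →
      |Y| ≤ (4 * d ^ 3 * ((d + 1) ^ (n + 1) * H * (5 * d ^ 3) ^ d) : ℤ) ^ (2 * d ^ 2 + 1) →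
      ∀ S : Finset ℕ, (∀ p ∈ S, p.Prime ∧ 27 * d ^ 4 < p ∧ (p : ℤ) ∣ Y) →
      Real.exp (∑ p ∈ S, Real.log p / p) ≤ Cb * (1 + Real.log H / d ^ 2))
    (f : MvPolynomial (Fin (n + 1)) ℤ) {d : ℕ} (hd : 1 ≤ d) (hf : f.totalDegree = d)
    (hirr : Irreducible (map (Int.castRingHom (AlgebraicClosure ℚ)) f))
    {H : ℕ} (hH1 : 1 ≤ H) (hH : ∀ m, |f.coeff m| ≤ H)
    (A : Set ℕ) (hA : ∀ p, p ∈ A ↔ (p.Prime ∧ 27 * d ^ 4 < p ∧ ¬ goodP f p)) (b : ℝ)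
    (hb : b = ∏ᶠ p ∈ A, Real.exp (Real.log p / p)) :
    1 ≤ b ∧ b ≤ Cb * (1 + Real.log H / d ^ 2) ∧
    (∀ S : Finset ℕ, (∀ p ∈ S, p.Prime ∧ 27 * d ^ 4 < p ∧ ¬ goodP f p) →
      ∑ p ∈ S, Real.log p / p ≤ Real.log b) := by
  classical
  obtain ⟨Y, hY, hYb, hYd⟩ := exists_bad_div f hd hf hirr hH1 hH
  rw [Fintype.card_fin] at hYb
  have hdvd : ∀ p ∈ A, (p : ℤ) ∣ Y := by
    intro p hp
    obtain ⟨h1, h2, h3⟩ := (hA p).1 hp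
    refine hYd p h1 ?_ ?_
    · have : d ^ 1 ≤ d ^ 4 := Nat.pow_le_pow_right hd (by norm_num)
      rw [pow_one] at this
      omega
    · intro h
      exact h3 ⟨h1, h⟩
  have hfin : A.Finite := by
    apply (Finset.finite_toSet (Finset.range (Y.natAbs + 1))).subset
    intro p hp
    have h := Int.natAbs_dvd_natAbs.2 (hdvd p hp)
    have := Nat.le_of_dvd (Int.natAbs_pos.2 hY) h
    simp only [Int.natAbs_natCast] at this
    simp only [Finset.coe_range, Set.mem_Iio]
    omega
  have hbe : b = Real.exp (∑ p ∈ hfin.toFinset, Real.log p / p) := by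
    rw [hb, finprod_mem_eq_finite_toFinset_prod _ hfin, Real.exp_sum]
  have hnn : ∀ p : ℕ, 0 ≤ Real.log p / p := fun p =>
    div_nonneg (Real.log_natCast_nonneg p) (Nat.cast_nonneg p)
  refine ⟨?_, ?_, ?_⟩
  · rw [hbe]
    exact Real.one_le_exp (Finset.sum_nonneg fun p _ => hnn p)
  · rw [hbe]
    refine hCb d hd H hH1 Y hY hYb _ ?_
    intro p hp
    have hp' : p ∈ A := by simpa using hp
    obtain ⟨h1, h2, h3⟩ := (hA p).1 hp'
    exact ⟨h1, h2, hdvd p hp'⟩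
  · intro S hS
    rw [hbe, Real.log_exp]
    apply Finset.sum_le_sum_of_subset_of_nonneg
    · intro p hp
      simpa using (hA p).2 (hS p hp)
    · intro p _ _
      exact hnn p

/-- Rewriting of the real powers. -/
theorem bound_rewrite {n d : ℕ} (hn : 1 ≤ n) (hd : 1 ≤ d) {B N δ c m : ℝ} (hB : 1 ≤ B) (hN : 1 ≤ N)
    (hδ : δ = (d : ℝ) ^ ((1 : ℝ) / n)) :
    c * B ^ ((1 : ℝ) / (d : ℝ) ^ ((1 : ℝ) / n)) * (d : ℝ) ^ ((2 : ℝ) - 1 / n) * m /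
        N ^ ((1 : ℝ) / ((n : ℝ) * (d : ℝ) ^ (1 + 1 / (n : ℝ))))
      + c * (d : ℝ) ^ ((1 : ℝ) - 1 / n) * Real.log B + c * (d : ℝ) ^ ((4 : ℝ) - 1 / n) =
    c * (Real.exp (Real.log B / δ - 1 / (n * d * δ) * Real.log N) * d ^ 2 * m + d * Real.log B + d ^ 4) / δ := by
  have hd0 : (0 : ℝ) < d := by exact_mod_cast hd
  have hn0 : (0 : ℝ) < n := by exact_mod_cast hn
  have hδ0 : 0 < δ := by rw [hδ]; positivity
  rw [Real.rpow_sub hd0, Real.rpow_sub hd0, Real.rpow_sub hd0, Real.rpow_add hd0, ← hδ, Real.rpow_one]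
  have e2 : (d : ℝ) ^ (2 : ℝ) = (d : ℝ) ^ 2 := by exact_mod_cast Real.rpow_natCast (d : ℝ) 2
  have e4 : (d : ℝ) ^ (4 : ℝ) = (d : ℝ) ^ 4 := by exact_mod_cast Real.rpow_natCast (d : ℝ) 4
  rw [e2, e4, Real.rpow_def_of_pos (by linarith : 0 < B), Real.rpow_def_of_pos (by linarith : 0 < N),
    Real.exp_sub]
  have e5 : Real.log N * (1 / (n * (d * δ))) = 1 / (n * d * δ) * Real.log N := by
    rw [← mul_assoc (n : ℝ), mul_comm]
  have e6 : Real.log B * (1 / δ) = Real.log B / δ := by ring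
  rw [e5, e6]
  have := Real.exp_pos (1 / (n * d * δ) * Real.log N)
  field_simp

end EV

/-- **Affine Ellenberg–Venkatesh–Walsh theorem.** Fix `n ≥ 1`. There is a constant
`c = c(n) > 0` such that for every primitive `f ∈ ℤ[x_1,…,x_{n+1}]` of degree `d ≥ 1`
irreducible over `ℚ`, with degree-`d` homogeneous part `f_d`, and every `B ≥ 1`,
there is a polynomial `g ∈ ℤ[x_1,…,x_{n+1}]`, not divisible by `f`, vanishing at all
`x ∈ ℤ^{n+1}` with `f(x) = 0` and `|x_i| ≤ B`, of degree at most
`c·B^(1/d^(1/n))·d^(2-1/n)·min(log‖f_d‖ + d·log B + d², d²·b(f))/‖f_d‖^(1/(n·d^(1+1/n)))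
+ c·d^(1-1/n)·log B + c·d^(4-1/n)`. -/
theorem ellenberg_venkatesh_affine (n : ℕ) (hn : 1 ≤ n) :
    ∃ c : ℝ, 0 < c ∧
      ∀ (d : ℕ) (f : MvPolynomial (Fin (n + 1)) ℤ) (B : ℝ),
        1 ≤ d → f.totalDegree = d →
        Finset.gcd f.support f.coeff = 1 →
        Irreducible (MvPolynomial.map (Int.castRingHom ℚ) f) →
        1 ≤ B →
        ∃ g : MvPolynomial (Fin (n + 1)) ℤ,
          ¬ f ∣ g ∧
          (∀ x : Fin (n + 1) → ℤ, MvPolynomial.eval x f = 0 → (∀ i, |(x i : ℝ)| ≤ B) →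
            MvPolynomial.eval x g = 0) ∧
          (g.totalDegree : ℝ) ≤
            c * B ^ ((1 : ℝ) / (d : ℝ) ^ ((1 : ℝ) / n)) * (d : ℝ) ^ ((2 : ℝ) - 1 / n) *
                min (Real.log (normMax (MvPolynomial.homogeneousComponent d f)) +
                      (d : ℝ) * Real.log B + (d : ℝ) ^ 2)
                    ((d : ℝ) ^ 2 * badness f) /
                (normMax (MvPolynomial.homogeneousComponent d f)) ^
                  ((1 : ℝ) / ((n : ℝ) * (d : ℝ) ^ (1 + 1 / (n : ℝ))))
              + c * (d : ℝ) ^ ((1 : ℝ) - 1 / n) * Real.log B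
              + c * (d : ℝ) ^ ((4 : ℝ) - 1 / n) := by
  classical
  obtain ⟨C, hC, hkey⟩ := EV.key_ineq n hn
  obtain ⟨Cb, hCb0, hCb⟩ := EV.sum_bad (n + 1)
  have hn1 : (1 : ℝ) ≤ n := by exact_mod_cast hn
  obtain ⟨k, hk1, hreal⟩ := EV.final_real hn1 hC hCb0
  refine ⟨4 * k, by linarith, ?_⟩
  intro d f B hd hf hprim hirr hB
  have hd1 : (1 : ℝ) ≤ d := by exact_mod_cast hd
  have hd0 : (0 : ℝ) < d := by linarith
  have hf0 : f ≠ 0 := by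
    rintro rfl
    simp at hf
    omega
  have hB0 : 0 < B := by linarith
  have hlB : 0 ≤ Real.log B := Real.log_nonneg hB
  -- the top degree part
  have hfd := EV.hcomp_ne_zero hd hf
  obtain ⟨m0, hm0, hm0e⟩ := Finset.exists_mem_eq_sup
    (MvPolynomial.homogeneousComponent d f).support (MvPolynomial.support_nonempty.2 hfd)
    (fun m => ((MvPolynomial.homogeneousComponent d f).coeff m).natAbs)
  have hm0d : m0.degree = d ∧ (MvPolynomial.homogeneousComponent d f).coeff m0 = f.coeff m0 := by
    have h := MvPolynomial.mem_support_iff.1 hm0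
    rw [MvPolynomial.coeff_homogeneousComponent] at h ⊢
    split_ifs at h with h1
    · exact ⟨h1, by rw [if_pos h1]⟩
    · exact absurd rfl h
  have hm0s : f.coeff m0 ≠ 0 := by
    rw [← hm0d.2]
    exact MvPolynomial.mem_support_iff.1 hm0
  obtain ⟨N, hN⟩ : ∃ N, N = normMax (MvPolynomial.homogeneousComponent d f) := ⟨_, rfl⟩
  have hNe : N = |((f.coeff m0 : ℤ) : ℝ)| := by
    rw [hN, normMax, hm0e, hm0d.2, Nat.cast_natAbs, Int.cast_abs]
  have hN1 : 1 ≤ N := by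
    rw [hNe]
    have := Int.one_le_abs hm0s
    exact_mod_cast this
  have hlN : 0 ≤ Real.log N := Real.log_nonneg hN1
  rw [← hN]
  obtain ⟨δ, hδ⟩ : ∃ δ : ℝ, δ = (d : ℝ) ^ ((1 : ℝ) / n) := ⟨_, rfl⟩
  have hδ1 : 1 ≤ δ := by
    rw [hδ]
    exact Real.one_le_rpow hd1 (by positivity)
  have hδd : δ ≤ d := by
    rw [hδ]
    calc (d : ℝ) ^ ((1 : ℝ) / n) ≤ (d : ℝ) ^ (1 : ℝ) := by
          apply Real.rpow_le_rpow_of_exponent_le hd1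
          rw [div_le_one (by linarith)]
          exact hn1
      _ = d := Real.rpow_one _
  have hδ0 : 0 < δ := by linarith
  rw [EV.bound_rewrite hn hd hB hN1 hδ]
  have hdlB : 0 ≤ d * Real.log B := by positivity
  have hd4 : (d : ℝ) * δ ≤ d ^ 4 := by
    calc (d : ℝ) * δ ≤ d * d := mul_le_mul_of_nonneg_left hδd hd0.le
      _ = (d : ℝ) ^ 2 := (pow_two _).symm
      _ ≤ (d : ℝ) ^ 4 := pow_le_pow_right₀ hd1 (by norm_num)
  by_cases habs : Irreducible (MvPolynomial.map (Int.castRingHom (AlgebraicClosure ℚ)) f)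
  swap
  · obtain ⟨g, hg1, hg2, hg3⟩ := EV.nonabs_case f hirr habs
    refine ⟨g, hg1, fun x hx _ => hg2 x hx, ?_⟩
    have hb0 : badness f = 0 := by
      unfold badness
      rw [if_neg habs]
    have hmin : min (Real.log N + (d : ℝ) * Real.log B + (d : ℝ) ^ 2) ((d : ℝ) ^ 2 * badness f) = 0 := by
      rw [hb0, mul_zero]
      exact min_eq_right (by positivity)
    rw [hmin, mul_zero, zero_add, le_div_iff₀ hδ0]
    have hgd : (g.totalDegree : ℝ) ≤ d := by
      rw [← hf]
      exact_mod_cast hg3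
    have h1 : (g.totalDegree : ℝ) * δ ≤ d * δ := mul_le_mul_of_nonneg_right hgd hδ0.le
    have h2 : (d : ℝ) * Real.log B + d ^ 4 ≤ 4 * k * (d * Real.log B + d ^ 4) :=
      le_mul_of_one_le_left (by positivity) (by linarith)
    linarith
  -- the maximal term
  obtain ⟨m, hm, hmmax⟩ := Finset.exists_max_image f.support
    (fun m => |((f.coeff m : ℤ) : ℝ)| * B ^ m.degree) (MvPolynomial.support_nonempty.2 hf0)
  obtain ⟨X, hX⟩ : ∃ X, X = |((f.coeff m : ℤ) : ℝ)| * B ^ m.degree := ⟨_, rfl⟩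
  have hNX : N * B ^ d ≤ X := by
    have h := hmmax m0 (MvPolynomial.mem_support_iff.2 hm0s)
    simp only [hm0d.1] at h
    rw [hX, hNe]
    exact h
  have hBd : 0 < B ^ d := by positivity
  have hBX : B ^ d ≤ X := le_trans (le_mul_of_one_le_left hBd.le hN1) hNX
  obtain ⟨lξ, hlξ⟩ : ∃ lξ, lξ = Real.log X - d * Real.log B := ⟨_, rfl⟩
  have hlξN : Real.log N ≤ lξ := by
    have h := Real.log_le_log (by positivity) hNX
    rw [Real.log_mul (by positivity) hBd.ne', Real.log_pow] at h
    linarith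
  -- height
  obtain ⟨H, hH⟩ : ∃ H, H = f.support.sup fun m => (f.coeff m).natAbs := ⟨_, rfl⟩
  have hHall : ∀ m, |f.coeff m| ≤ (H : ℤ) := by
    intro m
    by_cases h : m ∈ f.support
    · have := Finset.le_sup (f := fun m => (f.coeff m).natAbs) h
      rw [← hH] at this
      rw [← Int.natCast_natAbs]
      exact_mod_cast this
    · rw [MvPolynomial.notMem_support_iff.1 h]
      simp
  have hH1 : 1 ≤ H := by
    have h1 := hHall m0
    have h2 := Int.one_le_abs hm0s
    omega
  have hHX : (H : ℝ) ≤ X := by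
    obtain ⟨m1, hm1, hm1e⟩ := Finset.exists_mem_eq_sup f.support (MvPolynomial.support_nonempty.2 hf0)
      (fun m => (f.coeff m).natAbs)
    rw [hH, hm1e, hX, Nat.cast_natAbs, Int.cast_abs]
    refine le_trans ?_ (hmmax m1 hm1)
    exact le_mul_of_one_le_right (abs_nonneg _) (one_le_pow₀ hB)
  have hlH : Real.log H ≤ lξ + d * Real.log B := by
    have h : (0 : ℝ) < H := by exact_mod_cast hH1
    have := Real.log_le_log h hHX
    linarith
  -- badness
  obtain ⟨b, hb⟩ : ∃ b, b = badness f := ⟨_, rfl⟩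
  have hb' := hb
  unfold badness at hb'
  rw [if_pos habs] at hb'
  obtain ⟨hb1, hb2, hb3⟩ := EV.bad_facts hCb f hd hf habs hH1 hHall _ (by
    intro p
    simp only [Set.mem_ofPred_eq]
    constructor
    · rintro ⟨hp, h1, h2⟩
      refine ⟨hp, by rw [← hf]; exact h1, ?_⟩
      rintro ⟨_, h3⟩
      exact h2 h3
    · rintro ⟨hp, h1, h2⟩
      exact ⟨hp, by rw [hf]; exact h1, fun h3 => h2 ⟨hp, h3⟩⟩) b hb'
  rw [← hb]
  have hbC : (d : ℝ) ^ 2 * b ≤ Cb * ((d : ℝ) ^ 2 + (lξ + d * Real.log B)) := by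
    calc (d : ℝ) ^ 2 * b ≤ (d : ℝ) ^ 2 * (Cb * (1 + Real.log H / d ^ 2)) :=
          mul_le_mul_of_nonneg_left hb2 (by positivity)
      _ = Cb * ((d : ℝ) ^ 2 + Real.log H) := by field_simp
      _ ≤ _ := by
          apply mul_le_mul_of_nonneg_left _ hCb0.le
          linarith
  obtain ⟨τ, hτ⟩ : ∃ τ, τ = Real.exp (Real.log B / δ - 1 / (n * d * δ) * Real.log N) * (d : ℝ) ^ 2 *
    min (Real.log N + (d : ℝ) * Real.log B + (d : ℝ) ^ 2) ((d : ℝ) ^ 2 * b) := ⟨_, rfl⟩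
  rw [← hτ]
  have hτ0 : 0 ≤ τ := by
    have hmin0 : 0 ≤ min (Real.log N + (d : ℝ) * Real.log B + (d : ℝ) ^ 2) ((d : ℝ) ^ 2 * b) :=
      le_min (by positivity) (by positivity)
    rw [hτ]
    positivity
  obtain ⟨S, hS⟩ : ∃ S, S = τ + d * Real.log B + (d : ℝ) ^ 4 := ⟨_, rfl⟩
  rw [← hS]
  have hdS : d * δ ≤ S := by linarith
  have hS0 : 0 < S := lt_of_lt_of_le (by positivity) hdS
  have hkS : S ≤ k * S := le_mul_of_one_le_left hS0.le hk1
  obtain ⟨M, hM⟩ : ∃ M : ℕ, M = ⌊4 * k * S / δ⌋₊ := ⟨_, rfl⟩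
  have hMle : (M : ℝ) ≤ 4 * k * S / δ := by
    rw [hM]
    exact Nat.floor_le (by positivity)
  have hMge : 4 * k * S / δ < M + 1 := by
    rw [hM]
    exact Nat.lt_floor_add_one _
  have hM2 : 2 * d ≤ M := by
    rw [hM]
    apply Nat.le_floor
    push_cast
    rw [le_div_iff₀ hδ0]
    linarith
  have hMμ : k * S ≤ δ * M := by
    rw [div_lt_iff₀ hδ0] at hMge
    have : δ ≤ d * δ := le_mul_of_one_le_left hδ0.le hd1
    linarith
  by_contra hcon
  push Not at hcon
  have hno : ∀ g : MvPolynomial (Fin (n + 1)) ℤ, g.totalDegree ≤ M →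
      (∀ x : Fin (n + 1) → ℤ, MvPolynomial.eval x f = 0 → (∀ i, |(x i : ℝ)| ≤ B) →
        MvPolynomial.eval x g = 0) → f ∣ g := by
    intro g hg hgx
    by_contra hfg
    have h := hcon g hfg hgx
    have hg' : (g.totalDegree : ℝ) ≤ M := by exact_mod_cast hg
    linarith
  have hfinal := hkey d M f B (Real.log b) m hd hf hprim hB hM2 hb3 hno hm (by rw [← hX]; exact hBX) δ lξ hδ
    (by rw [← hX]; exact hlξ)
  exact hreal d δ (Real.log B) lξ (Real.log N) b (δ * M) τ hd1 hδ1 hδd hlB hlN hlξN hb1 hbC hτ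
    (by rw [← hS]; exact hMμ) hfinal
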